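/- arXiv:1609.06284 — 2 statements merged into one kernel-verified Lean document; each statement's English description precedes it below -/
import Mathlib

section
/- There exist absolute constants c > 0 and C > 0 such that the following holds. Let F be a field and let A ⊆ F be a finite nonempty set. If F has positive characteristic p, assume |A| ≤ c · p^{5/8}. Then (min{|A+A|, |A·A|})^3 · (max{|A+A|, |A·A|})^2 ≥ C · |A|^6. In particular, both |A+A|^3 · |A·A|^2 ≥ C·|A|^6 and |A+A|^2 · |A·A|^3 ≥ C·|A|^6. -/
open scoped Classical Pointwise

/-- The affine line `{(s, t s + a, t² s + t a + g)}` of direction `(1, t, t²)` in three-space. -/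
@[ext]
structure NullRay (K : Type*) where
  /-- The slope parameter of the direction `(1, t, t²)`. -/
  t : K
  /-- The intercept of the second coordinate. -/
  a : K
  /-- The intercept of the third coordinate, up to the shift `t * a`. -/
  g : K

namespace NullRay

open MvPolynomial

/-- Differentiation along the direction `(1, t, t²)`. -/
noncomputable def nullD {A : Type*} [CommRing A] (t : A) :
    Derivation A (MvPolynomial (Fin 3) A) (MvPolynomial (Fin 3) A) :=
  pderiv 0 + (C t : MvPolynomial (Fin 3) A) • pderiv 1 +
    (C (t ^ 2) : MvPolynomial (Fin 3) A) • pderiv 2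

theorem nullD_apply {A : Type*} [CommRing A] (t : A) (f : MvPolynomial (Fin 3) A) :
    nullD t f = pderiv 0 f + C t * pderiv 1 f + C (t ^ 2) * pderiv 2 f := by
  simp [nullD]

variable {K : Type*} [Field K]

/-- The point of a ray with first coordinate `s`. -/
def pt (r : NullRay K) (s : K) : Fin 3 → K :=
  ![s, r.t * s + r.a, r.t ^ 2 * s + r.t * r.a + r.g]

/-- Restriction of polynomials to a ray. -/
noncomputable def res (r : NullRay K) : MvPolynomial (Fin 3) K →ₐ[K] Polynomial K :=
  aeval ![Polynomial.X, Polynomial.C r.t * Polynomial.X + Polynomial.C r.a,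
    Polynomial.C (r.t ^ 2) * Polynomial.X + Polynomial.C (r.t * r.a + r.g)]

theorem eval_res (r : NullRay K) (s : K) (f : MvPolynomial (Fin 3) K) :
    (r.res f).eval s = eval (r.pt s) f := by
  induction f using MvPolynomial.induction_on with
  | C a => simp [res]
  | add p q hp hq => simp [hp, hq]
  | mul_X p i hp =>
    rw [map_mul, Polynomial.eval_mul, hp, map_mul]
    congr 1
    fin_cases i <;> simp [res, pt]
    ring

theorem natDegree_res_le (r : NullRay K) (f : MvPolynomial (Fin 3) K) :
    (r.res f).natDegree ≤ f.totalDegree := by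
  have := MvPolynomial.aeval_natDegree_le f le_rfl
    ![Polynomial.X, Polynomial.C r.t * Polynomial.X + Polynomial.C r.a,
      Polynomial.C (r.t ^ 2) * Polynomial.X + Polynomial.C (r.t * r.a + r.g)] (n := 1) (by
    intro i
    fin_cases i
    · simp
    · exact Polynomial.natDegree_linear_le
    · exact Polynomial.natDegree_linear_le)
  simpa [res] using this

theorem derivative_res (r : NullRay K) (f : MvPolynomial (Fin 3) K) :
    Polynomial.derivative (r.res f) = r.res (nullD r.t f) := by
  induction f using MvPolynomial.induction_on with
  | C a => simp [res]
  | add p q hp hq => simp [hp, hq]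
  | mul_X p i hp =>
    rw [map_mul, Polynomial.derivative_mul, hp, Derivation.leibniz, map_add, smul_eq_mul,
      smul_eq_mul, map_mul, map_mul]
    have : Polynomial.derivative (r.res (X i)) = r.res (nullD r.t (X i)) := by
      fin_cases i <;> simp [res, nullD_apply, pderiv_X, Polynomial.derivative_pow]
    rw [this]
    ring

theorem res_nullD_eq_zero {r : NullRay K} {f : MvPolynomial (Fin 3) K} (h : r.res f = 0) :
    r.res (nullD r.t f) = 0 := by
  rw [← derivative_res, h, Polynomial.derivative_zero]

/-- Two rays are conjugate if they are coplanar, that is, if they meet or are parallel in a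
common null plane. -/
def Conj (r r' : NullRay K) : Prop :=
  r.g - r'.g = r'.t * r.a - r.t * r'.a

theorem Conj.symm {r r' : NullRay K} (h : r.Conj r') : r'.Conj r := by
  unfold Conj at *
  linear_combination -h

/-- The first coordinate of the point where two conjugate rays meet. -/
noncomputable def meet (r r' : NullRay K) : K :=
  -(r.a - r'.a) / (r.t - r'.t)

theorem pt_meet {r r' : NullRay K} (h : r.Conj r') (ht : r.t ≠ r'.t) :
    r.pt (r.meet r') = r'.pt (r.meet r') := by
  have h1 : r.t - r'.t ≠ 0 := sub_ne_zero.2 ht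
  have h2 : r.meet r' * (r.t - r'.t) = -(r.a - r'.a) := by
    unfold meet
    field_simp
  unfold Conj at h
  ext i
  fin_cases i
  · simp [pt]
  · simp only [pt, Fin.mk_one, Matrix.cons_val_one, Matrix.cons_val_zero]
    linear_combination h2
  · simp only [pt, Fin.reduceFinMk, Matrix.cons_val]
    linear_combination h + (r.t + r'.t) * h2

theorem conj_of_pt_eq {r r' : NullRay K} {s : K} (h : r.pt s = r'.pt s) : r.Conj r' := by
  have h1 := congrFun h 1
  have h2 := congrFun h 2
  simp only [pt, Matrix.cons_val_one, Matrix.cons_val_zero, Matrix.cons_val] at h1 h2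
  unfold Conj
  linear_combination h2 - (r.t + r'.t) * h1

/-- A polynomial not vanishing on a ray `ℓ` has at most as many zeros as its degree among the
meeting points of `ℓ` with mutually disjoint rays. -/
theorem card_le_totalDegree {l : NullRay K} {M : Finset (NullRay K)} {h : MvPolynomial (Fin 3) K}
    (hl : l.res h ≠ 0) (hM : ∀ m ∈ M, l.Conj m ∧ l.t ≠ m.t)
    (hd : ∀ m ∈ M, ∀ m' ∈ M, m ≠ m' → ¬ m.Conj m')
    (h0 : ∀ m ∈ M, eval (l.pt (l.meet m)) h = 0) : M.card ≤ h.totalDegree := by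
  calc M.card ≤ (l.res h).roots.toFinset.card := by
        refine Finset.card_le_card_of_injOn (fun m => l.meet m) ?_ ?_
        · intro m hm
          simp only [Finset.mem_coe, Multiset.mem_toFinset]
          rw [Polynomial.mem_roots hl, Polynomial.IsRoot, eval_res]
          exact h0 m hm
        · intro m hm m' hm' hmm
          by_contra hne
          refine hd m hm m' hm' hne (conj_of_pt_eq (s := l.meet m) ?_)
          rw [← pt_meet (hM m hm).1 (hM m hm).2]
          simp only at hmm
          rw [hmm, ← pt_meet (hM m' hm').1 (hM m' hm').2]
    _ ≤ (l.res h).natDegree := (Multiset.toFinset_card_le _).trans (Polynomial.card_roots' _)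
    _ ≤ h.totalDegree := natDegree_res_le l h

theorem six_mul_finrank_restrictTotalDegree (d : ℕ) :
    6 * Module.finrank K (restrictTotalDegree (Fin 3) K d) = (d + 1) * (d + 2) * (d + 3) := by
  have hset : {n : Fin 3 →₀ ℕ | (n.sum fun _ e => e) ≤ d} =
      (((Finset.range (d + 1)).biUnion
        fun i => (Finset.univ : Finset (Fin 3)).finsuppAntidiag i : Finset (Fin 3 →₀ ℕ)) :
          Set (Fin 3 →₀ ℕ)) := by
    ext n
    simp [Finset.mem_finsuppAntidiag, Finsupp.sum_fintype]
  have h1 : Module.finrank K (restrictTotalDegree (Fin 3) K d) =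
      ∑ i ∈ Finset.range (d + 1), (3 + i - 1).choose i := by
    rw [restrictTotalDegree, Module.finrank_eq_nat_card_basis
      (basisRestrictSupport K {n : Fin 3 →₀ ℕ | (n.sum fun _ e => e) ≤ d}), hset,
      Nat.card_coe_set_eq, Set.ncard_coe_finset, Finset.card_biUnion]
    · refine Finset.sum_congr rfl fun i _ => ?_
      rw [Finset.card_finsuppAntidiag_nat_eq_choose]
      simp
    · intro i _ j _ hij
      rw [Function.onFun, Finset.disjoint_left]
      intro n hn hn'
      rw [Finset.mem_finsuppAntidiag] at hn hn'
      exact hij (hn.1.symm.trans hn'.1)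
  rw [h1]
  clear h1 hset
  induction d with
  | zero => simp
  | succ d ih =>
    rw [Finset.sum_range_succ, mul_add, ih]
    have h2 : (3 + (d + 1) - 1).choose (d + 1) * 2 = (d + 3) * (d + 2) := by
      have : 3 + (d + 1) - 1 = d + 1 + 2 := by omega
      rw [this, Nat.choose_symm_add, Nat.choose_two_right]
      have h3 : d + 1 + 2 - 1 = d + 2 := by omega
      rw [h3, Nat.div_mul_cancel]
      have := Nat.even_mul_succ_self (d + 2)
      rw [mul_comm] at this
      exact this.two_dvd
    nlinarith

/-- Parameter counting: a polynomial of degree at most `d` vanishing on few given rays. -/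
theorem exists_res_eq_zero (P : Finset (NullRay K)) (d : ℕ) (hP : 6 * P.card < (d + 2) * (d + 3)) :
    ∃ f : MvPolynomial (Fin 3) K, f ≠ 0 ∧ f.totalDegree ≤ d ∧ ∀ r ∈ P, r.res f = 0 := by
  let Φ : restrictTotalDegree (Fin 3) K d →ₗ[K] (P → Polynomial.degreeLT K (d + 1)) :=
    LinearMap.pi fun r => (r.1.res.toLinearMap).restrict (by
      intro f hf
      rw [mem_restrictTotalDegree] at hf
      rw [Polynomial.mem_degreeLT]
      refine lt_of_le_of_lt Polynomial.degree_le_natDegree ?_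
      exact_mod_cast Nat.lt_succ_of_le ((natDegree_res_le r.1 f).trans hf))
  have hlt : Module.finrank K (P → Polynomial.degreeLT K (d + 1)) <
      Module.finrank K (restrictTotalDegree (Fin 3) K d) := by
    have h1 : Module.finrank K (P → Polynomial.degreeLT K (d + 1)) = P.card * (d + 1) := by
      rw [Module.finrank_pi_fintype, Finset.sum_const, Finset.card_univ, Fintype.card_coe,
        (Polynomial.degreeLTEquiv K (d + 1)).finrank_eq]
      simp
    have h2 := six_mul_finrank_restrictTotalDegree (K := K) d
    rw [h1]
    nlinarith
  obtain ⟨f, hf, hf0⟩ := (Submodule.ne_bot_iff _).1 (LinearMap.ker_ne_bot_of_finrank_lt (f := Φ) hlt)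
  refine ⟨f.1, by simpa using hf0, (mem_restrictTotalDegree _ _ _).1 f.2, fun r hr => ?_⟩
  have := congrArg Subtype.val (congrFun (LinearMap.mem_ker.1 hf) ⟨r, hr⟩)
  simpa [Φ] using this

/-- The linear polynomial cutting out the vertical plane over the projection of a ray. -/
noncomputable def e₁ (r : NullRay K) : MvPolynomial (Fin 3) K := X 1 - C r.t * X 0 - C r.a

/-- The linear polynomial cutting out a second plane through a ray. -/
noncomputable def e₀ (r : NullRay K) : MvPolynomial (Fin 3) K := X 2 - C r.t * X 1 - C r.g

theorem totalDegree_e₁_le (r : NullRay K) : r.e₁.totalDegree ≤ 1 := by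
  unfold e₁
  refine (totalDegree_sub _ _).trans (max_le ((totalDegree_sub _ _).trans (max_le ?_ ?_)) ?_)
  · simp
  · exact (totalDegree_mul _ _).trans (by simp)
  · simp

theorem totalDegree_e₀_le (r : NullRay K) : r.e₀.totalDegree ≤ 1 := by
  unfold e₀
  refine (totalDegree_sub _ _).trans (max_le ((totalDegree_sub _ _).trans (max_le ?_ ?_)) ?_)
  · simp
  · exact (totalDegree_mul _ _).trans (by simp)
  · simp

theorem eval_e₁ (r : NullRay K) (x : Fin 3 → K) : eval x r.e₁ = x 1 - r.t * x 0 - r.a := by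
  simp [e₁]

theorem eval_e₀ (r : NullRay K) (x : Fin 3 → K) : eval x r.e₀ = x 2 - r.t * x 1 - r.g := by
  simp [e₀]

theorem res_e₁ (r r' : NullRay K) :
    r.res r'.e₁ = Polynomial.C (r.t - r'.t) * Polynomial.X + Polynomial.C (r.a - r'.a) := by
  simp [res, e₁]
  ring

theorem res_e₀ (r r' : NullRay K) :
    r.res r'.e₀ = Polynomial.C (r.t * (r.t - r'.t)) * Polynomial.X +
      Polynomial.C (r.t * r.a + r.g - r'.t * r.a - r'.g) := by
  simp [res, e₀]
  ring

theorem exists_separating {r r' : NullRay K} (h : r ≠ r') :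
    ∃ p : MvPolynomial (Fin 3) K, p.totalDegree ≤ 1 ∧ r'.res p = 0 ∧ r.res p ≠ 0 := by
  by_cases h1 : r.t = r'.t ∧ r.a = r'.a
  · refine ⟨r'.e₀, totalDegree_e₀_le _, by simp [res_e₀], ?_⟩
    rw [res_e₀, h1.1, h1.2]
    intro h0
    apply h
    ext
    · exact h1.1
    · exact h1.2
    · have := congrArg (Polynomial.eval 0) h0
      simp at this
      linear_combination this
  · refine ⟨r'.e₁, totalDegree_e₁_le _, by simp [res_e₁], ?_⟩
    rw [res_e₁]
    intro h0
    apply h1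
    have h2 := congrArg (Polynomial.eval 0) h0
    have h3 := congrArg (Polynomial.eval 1) h0
    simp at h2 h3
    exact ⟨by linear_combination h3 - h2, by linear_combination h2⟩

theorem totalDegree_aeval_X_le (c : Polynomial K) (i : Fin 3) :
    (Polynomial.aeval (X i : MvPolynomial (Fin 3) K) c).totalDegree ≤ c.natDegree := by
  rw [Polynomial.aeval_eq_sum_range]
  refine totalDegree_finsetSum_le fun j hj => ?_
  refine (totalDegree_smul_le _ _).trans ?_
  rw [totalDegree_X_pow]
  exact Nat.lt_succ_iff.1 (Finset.mem_range.1 hj)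

theorem res_aeval_X (r : NullRay K) (c : Polynomial K) :
    r.res (Polynomial.aeval (X 0 : MvPolynomial (Fin 3) K) c) = c := by
  rw [← Polynomial.aeval_algHom_apply]
  simp [res]

theorem exists_isolating (S : Finset (NullRay K)) (r : NullRay K) :
    ∃ p : MvPolynomial (Fin 3) K, p.totalDegree ≤ (S.erase r).card ∧ r.res p ≠ 0 ∧
      ∀ r' ∈ S, r' ≠ r → r'.res p = 0 := by
  choose! q hq1 hq2 hq3 using fun r' (h : r ≠ r') => exists_separating h
  refine ⟨∏ r' ∈ S.erase r, q r', ?_, ?_, ?_⟩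
  · refine (totalDegree_finsetProd _ _).trans ?_
    rw [Finset.card_eq_sum_ones]
    exact Finset.sum_le_sum fun r' hr' => hq1 r' (Finset.ne_of_mem_erase hr').symm
  · rw [map_prod, Finset.prod_ne_zero_iff]
    exact fun r' hr' => hq3 r' (Finset.ne_of_mem_erase hr').symm
  · intro r' hr' hne
    rw [map_prod, Finset.prod_eq_zero_iff]
    exact ⟨r', Finset.mem_erase.2 ⟨hne, hr'⟩, hq2 r' hne.symm⟩

/-- The comparison of dimensions behind Bézout's theorem for rays. -/
theorem card_mul_add_finrank_le {f g : MvPolynomial (Fin 3) K} (hf : Irreducible f)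
    (hfg : ¬ f ∣ g) {S : Finset (NullRay K)} (hSf : ∀ r ∈ S, r.res f = 0)
    (hSg : ∀ r ∈ S, r.res g = 0) (e m : ℕ)
    (hm : S.card + m ≤ e + f.totalDegree + g.totalDegree + 2) :
    S.card * m + Module.finrank K (restrictTotalDegree (Fin 3) K (e + g.totalDegree)) +
        Module.finrank K (restrictTotalDegree (Fin 3) K (e + f.totalDegree)) ≤
      Module.finrank K (restrictTotalDegree (Fin 3) K (e + f.totalDegree + g.totalDegree)) +
        Module.finrank K (restrictTotalDegree (Fin 3) K e) := by
  choose H hH1 hH2 hH3 using fun r => exists_isolating S r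
  let V := fun n => restrictTotalDegree (Fin 3) K n
  let Ψ₀ : (S → Polynomial.degreeLT K m) →ₗ[K] MvPolynomial (Fin 3) K :=
    ∑ r : S, (LinearMap.mulLeft K (H r.1)).comp
      ((Polynomial.aeval (X 0 : MvPolynomial (Fin 3) K)).toLinearMap.comp
        ((Polynomial.degreeLT K m).subtype.comp (LinearMap.proj r)))
  let Ψ : (S → Polynomial.degreeLT K m) × (V (e + g.totalDegree) × V (e + f.totalDegree)) →ₗ[K]
      MvPolynomial (Fin 3) K :=
    Ψ₀.coprod (((LinearMap.mulLeft K f).comp (V _).subtype).coprod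
      ((LinearMap.mulLeft K g).comp (V _).subtype))
  have hΨ : ∀ c h₁ h₂, Ψ (c, h₁, h₂) =
      ∑ r : S, H r.1 * Polynomial.aeval (X 0 : MvPolynomial (Fin 3) K) (c r).1 +
        (f * h₁.1 + g * h₂.1) := by
    intro c h₁ h₂
    simp [Ψ, Ψ₀]
  have hrange : LinearMap.range Ψ ≤ V (e + f.totalDegree + g.totalDegree) := by
    rintro _ ⟨⟨c, h₁, h₂⟩, rfl⟩
    rw [hΨ]
    have h₁' := (mem_restrictTotalDegree _ _ _).1 h₁.2
    have h₂' := (mem_restrictTotalDegree _ _ _).1 h₂.2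
    refine add_mem (sum_mem fun r _ => ?_) (add_mem ?_ ?_)
    · rw [mem_restrictTotalDegree]
      by_cases hc : (c r).1 = 0
      · rw [hc, map_zero, mul_zero, totalDegree_zero]
        exact Nat.zero_le _
      · refine (totalDegree_mul _ _).trans ?_
        have h1 := totalDegree_aeval_X_le (c r).1 0
        have h2 : (c r).1.natDegree < m := by
          rw [Polynomial.natDegree_lt_iff_degree_lt hc]
          exact Polynomial.mem_degreeLT.1 (c r).2
        have h3 := hH1 r.1
        rw [Finset.card_erase_of_mem r.2] at h3
        have h4 := Finset.card_pos.2 ⟨r.1, r.2⟩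
        omega
    · rw [mem_restrictTotalDegree]
      have := totalDegree_mul f h₁.1
      omega
    · rw [mem_restrictTotalDegree]
      have := totalDegree_mul g h₂.1
      omega
  let Θ : V e →ₗ[K]
      (S → Polynomial.degreeLT K m) × (V (e + g.totalDegree) × V (e + f.totalDegree)) :=
    LinearMap.prod 0 (LinearMap.prod
      ((LinearMap.mulLeft K (-g)).restrict (by
        intro h hh
        rw [mem_restrictTotalDegree] at hh ⊢
        have := totalDegree_mul (-g) h
        rw [totalDegree_neg] at this
        simp only [LinearMap.mulLeft_apply]
        omega))
      ((LinearMap.mulLeft K f).restrict (by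
        intro h hh
        rw [mem_restrictTotalDegree] at hh ⊢
        have := totalDegree_mul f h
        simp only [LinearMap.mulLeft_apply]
        omega)))
  have hker : LinearMap.ker Ψ ≤ LinearMap.range Θ := by
    rintro ⟨c, h₁, h₂⟩ hx
    rw [LinearMap.mem_ker, hΨ] at hx
    have hc : c = 0 := by
      funext r
      have h1 := congrArg r.1.res hx
      simp only [map_add, map_mul, hSf r.1 r.2, hSg r.1 r.2, zero_mul, add_zero, map_zero,
        map_sum, res_aeval_X] at h1
      rw [Finset.sum_eq_single r] at h1
      · exact Subtype.ext ((mul_eq_zero.1 h1).resolve_left (hH2 r.1))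
      · intro r' _ hr'
        rw [hH3 r'.1 r.1 r.2 (fun h => hr' (Subtype.ext h.symm)), zero_mul]
      · simp
    subst hc
    have h1 : f * h₁.1 + g * h₂.1 = 0 := by simpa using hx
    have h2 : f ∣ g * h₂.1 := ⟨-h₁.1, by linear_combination h1⟩
    obtain ⟨h, hh⟩ := (hf.prime.dvd_or_dvd h2).resolve_left hfg
    have h3 : h₁.1 = -g * h := by
      apply mul_left_cancel₀ hf.ne_zero
      linear_combination h1 - g * hh
    have h4 : h ∈ V e := by
      rw [mem_restrictTotalDegree]
      by_cases h0 : h = 0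
      · simp [h0]
      have h5 := (mem_restrictTotalDegree _ _ _).1 h₂.2
      rw [hh, totalDegree_mul_of_isDomain hf.ne_zero h0] at h5
      omega
    refine ⟨⟨h, h4⟩, ?_⟩
    ext1
    · rfl
    · ext1
      · exact Subtype.ext h3.symm
      · exact Subtype.ext hh.symm
  have k1 := LinearMap.finrank_range_add_finrank_ker Ψ
  have k2 := Submodule.finrank_mono hrange
  have k3 := (Submodule.finrank_mono hker).trans (LinearMap.finrank_range_le Θ)
  have k4 : Module.finrank K ((S → Polynomial.degreeLT K m) ×
      (V (e + g.totalDegree) × V (e + f.totalDegree))) =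
      S.card * m + (Module.finrank K (V (e + g.totalDegree)) +
        Module.finrank K (V (e + f.totalDegree))) := by
    rw [Module.finrank_prod, Module.finrank_prod, Module.finrank_pi_fintype, Finset.sum_const,
      Finset.card_univ, Fintype.card_coe, (Polynomial.degreeLTEquiv K m).finrank_eq]
    simp
  simp only [V] at *
  omega

/-- Bézout's bound for the number of rays in the intersection of two surfaces. -/
theorem card_le_mul_totalDegree {f g : MvPolynomial (Fin 3) K} (hf : Irreducible f)
    (hfg : ¬ f ∣ g) {S : Finset (NullRay K)} (hSf : ∀ r ∈ S, r.res f = 0)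
    (hSg : ∀ r ∈ S, r.res g = 0) : S.card ≤ f.totalDegree * g.totalDegree := by
  by_contra! hlt
  obtain ⟨S', hS', hcard⟩ := Finset.exists_subset_card_eq (Nat.succ_le_of_lt hlt)
  set a := f.totalDegree with ha
  set b := g.totalDegree with hb
  set e := (a * b + 1) ^ 2 with he
  have hle : a * b + 1 ≤ e := by rw [he]; nlinarith
  obtain ⟨m, hm⟩ := Nat.exists_eq_add_of_le (show a * b + 1 ≤ e + a + b + 2 by omega)
  have key := card_mul_add_finrank_le hf hfg (fun r hr => hSf r (hS' hr))
    (fun r hr => hSg r (hS' hr)) e m (by rw [← ha, ← hb]; omega)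
  rw [← ha, ← hb] at key
  have v1 := six_mul_finrank_restrictTotalDegree (K := K) (e + b)
  have v2 := six_mul_finrank_restrictTotalDegree (K := K) (e + a)
  have v3 := six_mul_finrank_restrictTotalDegree (K := K) (e + a + b)
  have v4 := six_mul_finrank_restrictTotalDegree (K := K) e
  rw [hcard] at key
  have key6 := Nat.mul_le_mul_left 6 key
  rw [mul_add, mul_add, mul_add, v1, v2, v3, v4] at key6
  zify at key6 hm he
  have hm' : (m : ℤ) = e + a + b + 2 - (a * b + 1) := by linarith
  rw [hm'] at key6
  have ha0 : (0 : ℤ) ≤ a := by positivity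
  have hb0 : (0 : ℤ) ≤ b := by positivity
  have hab : (0 : ℤ) ≤ a * b * (a + b) := by positivity
  nlinarith

/-- The ray of slope `t` through a point. -/
def through (x : Fin 3 → K) (t : K) : NullRay K := ⟨t, x 1 - t * x 0, x 2 - t * x 1⟩

theorem pt_through (x : Fin 3 → K) (t : K) : (through x t).pt (x 0) = x := by
  ext i
  fin_cases i
  · simp [pt, through]
  · simp [pt, through]
  · simp only [pt, through, Fin.reduceFinMk, Matrix.cons_val]
    ring

/-- The linear coefficient of `u³ q₂` reduced modulo `q₁`, where `qᵢ` is the `i`-th derivative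
of `f` along `(1, T, T²)` and `u` the leading coefficient of `q₁`. -/
noncomputable def remLin (f : MvPolynomial (Fin 3) K) : MvPolynomial (Fin 3) K :=
  let u := pderiv 2 f
  let v := pderiv 1 f
  let w := pderiv 0 f;
  -(pderiv 2 u * v * v * v) + 2 • (pderiv 2 u * u * v * w) + 2 • (pderiv 1 u * u * v * v) -
    2 • (pderiv 1 u * u * u * w) - pderiv 1 v * u * u * v - 2 • (pderiv 0 u * u * u * v) +
    2 • (pderiv 0 v * u * u * u)

/-- The constant coefficient of `u³ q₂` reduced modulo `q₁`. -/
noncomputable def remConst (f : MvPolynomial (Fin 3) K) : MvPolynomial (Fin 3) K :=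
  let u := pderiv 2 f
  let v := pderiv 1 f
  let w := pderiv 0 f;
  -(pderiv 2 u * w * v * v) + pderiv 2 u * w * w * u + 2 • (pderiv 1 u * u * v * w) -
    pderiv 1 v * u * u * w - 2 • (pderiv 0 u * u * u * w) + pderiv 0 w * u * u * u

theorem pderiv_comm (i j : Fin 3) (f : MvPolynomial (Fin 3) K) :
    pderiv i (pderiv j f) = pderiv j (pderiv i f) := by
  have hX : ∀ i j k : Fin 3, pderiv i (pderiv j (X k : MvPolynomial (Fin 3) K)) = 0 := by
    intro i j k
    rw [pderiv_X, Pi.single_apply]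
    split_ifs <;> simp
  induction f using MvPolynomial.induction_on with
  | C a => simp
  | add p q hp hq => simp [hp, hq]
  | mul_X p k hp =>
    simp only [Derivation.leibniz, map_add, smul_eq_mul, hX, hp]
    ring

theorem exists_mul_nullD_nullD (f : MvPolynomial (Fin 3) K) (t : K) :
    ∃ A, pderiv 2 f ^ 3 * nullD t (nullD t f) =
      A * nullD t f + (C t * remLin f + remConst f) := by
  let u := pderiv 2 f
  let v := pderiv 1 f
  let w := pderiv 0 f
  refine ⟨pderiv 2 u * (u ^ 2 * C t ^ 2 - u * v * C t + v ^ 2 - u * w) +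
    2 * pderiv 1 u * u * (u * C t - v) + (pderiv 1 v + 2 * pderiv 0 u) * u ^ 2, ?_⟩
  simp only [nullD_apply, remLin, remConst, u, v, w, map_add, Derivation.leibniz, pderiv_C,
    smul_eq_mul, pderiv_comm 1 0 f, pderiv_comm 2 0 f, pderiv_comm 2 1 f,
    C_pow, nsmul_eq_mul]
  push_cast
  simp only [Derivation.leibniz_pow, pderiv_C]
  simp
  ring

theorem exists_pow_mul_iterate_nullD {f : MvPolynomial (Fin 3) K} (hB : f ∣ remLin f)
    (hC : f ∣ remConst f) (t : K) (m : ℕ) :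
    ∃ (e : ℕ) (α β : MvPolynomial (Fin 3) K),
      pderiv 2 f ^ e * (nullD t)^[m] f = α * f + β * nullD t f := by
  obtain ⟨A, hA⟩ := exists_mul_nullD_nullD f t
  obtain ⟨B', hB'⟩ := hB
  obtain ⟨C', hC'⟩ := hC
  induction m with
  | zero => exact ⟨0, 1, 0, by simp⟩
  | succ m ih =>
    obtain ⟨e, α, β, h⟩ := ih
    have h1 := congrArg (nullD t) h
    simp only [map_add, Derivation.leibniz, smul_eq_mul, Derivation.leibniz_pow,
      nsmul_eq_mul] at h1
    rw [Function.iterate_succ_apply']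
    rcases e with _ | e
    · refine ⟨3, pderiv 2 f ^ 3 * nullD t α + β * (C t * B' + C'),
        pderiv 2 f ^ 3 * (α + nullD t β) + β * A, ?_⟩
      simp only [Nat.cast_zero, zero_mul, pow_zero, one_mul, mul_zero, add_zero] at h1
      rw [hB', hC'] at hA
      linear_combination pderiv 2 f ^ 3 * h1 + β * hA
    · refine ⟨e + 5, pderiv 2 f ^ 4 * nullD t α + pderiv 2 f * β * (C t * B' + C') -
          ((e + 1 : ℕ) : MvPolynomial (Fin 3) K) * pderiv 2 f ^ 3 * nullD t (pderiv 2 f) * α,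
        pderiv 2 f ^ 4 * (α + nullD t β) + pderiv 2 f * β * A -
          ((e + 1 : ℕ) : MvPolynomial (Fin 3) K) * pderiv 2 f ^ 3 * nullD t (pderiv 2 f) * β, ?_⟩
      rw [hB', hC'] at hA
      rw [Nat.add_sub_cancel] at h1
      linear_combination pderiv 2 f ^ 4 * h1 + pderiv 2 f * β * hA -
        ((e + 1 : ℕ) : MvPolynomial (Fin 3) K) * pderiv 2 f ^ 3 * nullD t (pderiv 2 f) * h

theorem iterate_derivative_res (r : NullRay K) (f : MvPolynomial (Fin 3) K) (m : ℕ) :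
    Polynomial.derivative^[m] (r.res f) = r.res ((nullD r.t)^[m] f) := by
  induction m with
  | zero => rfl
  | succ m ih => rw [Function.iterate_succ_apply', ih, derivative_res, Function.iterate_succ_apply']

/-- If the second-order remainder vanishes on `Z(f)`, then the null directions in which `f`
vanishes to first order are directions of rays contained in `Z(f)`. -/
theorem res_through_eq_zero {f : MvPolynomial (Fin 3) K}
    (hd : ((f.totalDegree.factorial : ℕ) : K) ≠ 0) (hB : f ∣ remLin f) (hC : f ∣ remConst f)
    {x : Fin 3 → K} {t : K} (h0 : eval x f = 0) (h1 : eval x (nullD t f) = 0)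
    (hu : eval x (pderiv 2 f) ≠ 0) : (through x t).res f = 0 := by
  by_contra hne
  have hroot : ∀ m, (Polynomial.derivative^[m] ((through x t).res f)).IsRoot (x 0) := by
    intro m
    obtain ⟨e, α, β, h⟩ := exists_pow_mul_iterate_nullD hB hC t m
    have h2 := congrArg (eval x) h
    simp only [map_mul, map_add, map_pow, h0, h1, mul_zero, add_zero] at h2
    rw [iterate_derivative_res, Polynomial.IsRoot, eval_res, pt_through]
    exact (mul_eq_zero.1 h2).resolve_left (pow_ne_zero _ hu)
  have hle := natDegree_res_le (through x t) f
  have hfac : ((((through x t).res f).natDegree.factorial : ℕ) : K) ≠ 0 := by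
    intro h
    obtain ⟨k, hk⟩ := Nat.factorial_dvd_factorial hle
    apply hd
    rw [hk, Nat.cast_mul, h, zero_mul]
  have := Polynomial.lt_rootMultiplicity_of_isRoot_iterate_derivative_of_mem_nonZeroDivisors
    hne (n := ((through x t).res f).natDegree) (t := x 0) (fun m _ => hroot m)
    (mem_nonZeroDivisors_of_ne_zero hfac)
  rw [← Polynomial.count_roots] at this
  have h3 := Multiset.count_le_card (x 0) ((through x t).res f).roots
  have h4 := Polynomial.card_roots' ((through x t).res f)
  omega

theorem succ_sum_le_of_mem_support_pderiv {f : MvPolynomial (Fin 3) K} {i : Fin 3}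
    {m : Fin 3 →₀ ℕ} (hm : m ∈ (pderiv i f).support) :
    (m.sum fun _ e => e) + 1 ≤ f.totalDegree := by
  rw [mem_support_iff, coeff_pderiv] at hm
  have h1 := le_totalDegree (mem_support_iff.2 (left_ne_zero_of_mul hm))
  rw [Finsupp.sum_add_index' (by simp) (by simp)] at h1
  simpa using h1

theorem totalDegree_pderiv_le (f : MvPolynomial (Fin 3) K) (i : Fin 3) :
    (pderiv i f).totalDegree ≤ f.totalDegree :=
  Finset.sup_le fun _ hm => (Nat.le_succ _).trans (succ_sum_le_of_mem_support_pderiv hm)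

theorem not_dvd_pderiv {f : MvPolynomial (Fin 3) K} {i : Fin 3} (h : pderiv i f ≠ 0) :
    ¬ f ∣ pderiv i f := by
  intro hf
  have h1 := totalDegree_le_of_dvd_of_isDomain hf h
  have h2 : (pderiv i f).totalDegree + 1 ≤ f.totalDegree := by
    obtain ⟨m, hm⟩ := support_nonempty.2 h
    have h3 := succ_sum_le_of_mem_support_pderiv hm
    refine Nat.succ_le_of_lt ((Finset.sup_lt_iff (bot_lt_iff_ne_bot.2 ?_)).2 fun m hm =>
      succ_sum_le_of_mem_support_pderiv hm)
    rw [Nat.bot_eq_zero]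
    omega
  omega

theorem exists_pderiv_ne_zero {f : MvPolynomial (Fin 3) K} (hf : f.totalDegree ≠ 0)
    (hd : ((f.totalDegree.factorial : ℕ) : K) ≠ 0) : ∃ i, pderiv i f ≠ 0 := by
  by_contra! h
  rw [Ne, totalDegree_eq_zero_iff] at hf
  push Not at hf
  obtain ⟨m, hm, i, hi⟩ := hf
  have h1 := congrArg (coeff (m - Finsupp.single i 1)) (h i)
  have hle : Finsupp.single i 1 ≤ m := by
    rw [Finsupp.single_le_iff]
    omega
  have h3 : (m - Finsupp.single i 1 : Fin 3 →₀ ℕ) i + 1 = m i := by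
    simp
    omega
  rw [coeff_pderiv, tsub_add_cancel_of_le hle, coeff_zero] at h1
  have h2 := (mul_eq_zero.1 h1).resolve_left (mem_support_iff.1 hm)
  have h4 : m i ≤ f.totalDegree := by
    refine le_trans ?_ (le_totalDegree hm)
    rw [Finsupp.sum_fintype _ _ (by simp)]
    exact Finset.single_le_sum (f := fun j => m j) (fun _ _ => Nat.zero_le _) (Finset.mem_univ i)
  obtain ⟨c, hc⟩ := Nat.dvd_factorial (Nat.pos_of_ne_zero hi) h4
  apply hd
  rw [hc, Nat.cast_mul, ← h3, Nat.cast_add, Nat.cast_one, h2, zero_mul]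

theorem mul_mem_restrictTotalDegree {d e : ℕ} {p q : MvPolynomial (Fin 3) K}
    (hp : p ∈ restrictTotalDegree (Fin 3) K d) (hq : q ∈ restrictTotalDegree (Fin 3) K e) :
    p * q ∈ restrictTotalDegree (Fin 3) K (d + e) := by
  rw [mem_restrictTotalDegree] at *
  exact (totalDegree_mul _ _).trans (add_le_add hp hq)

theorem mul_mul_mul_mem_restrictTotalDegree {d : ℕ} {p q r s : MvPolynomial (Fin 3) K}
    (hp : p ∈ restrictTotalDegree (Fin 3) K d) (hq : q ∈ restrictTotalDegree (Fin 3) K d)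
    (hr : r ∈ restrictTotalDegree (Fin 3) K d) (hs : s ∈ restrictTotalDegree (Fin 3) K d) :
    p * q * r * s ∈ restrictTotalDegree (Fin 3) K (4 * d) := by
  have := mul_mem_restrictTotalDegree
    (mul_mem_restrictTotalDegree (mul_mem_restrictTotalDegree hp hq) hr) hs
  rwa [show d + d + d + d = 4 * d by ring] at this

theorem totalDegree_remLin_le (f : MvPolynomial (Fin 3) K) :
    (remLin f).totalDegree ≤ 4 * f.totalDegree := by
  have h1 : ∀ i, pderiv i f ∈ restrictTotalDegree (Fin 3) K f.totalDegree := fun i => by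
    rw [mem_restrictTotalDegree]
    exact totalDegree_pderiv_le f i
  have h2 : ∀ i j, pderiv i (pderiv j f) ∈ restrictTotalDegree (Fin 3) K f.totalDegree :=
    fun i j => by
      rw [mem_restrictTotalDegree]
      exact (totalDegree_pderiv_le _ i).trans (totalDegree_pderiv_le f j)
  rw [← mem_restrictTotalDegree]
  have h3 : ∀ i j a b c, pderiv i (pderiv j f) * pderiv a f * pderiv b f * pderiv c f ∈
      restrictTotalDegree (Fin 3) K (4 * f.totalDegree) := fun i j a b c =>
    mul_mul_mul_mem_restrictTotalDegree (h2 i j) (h1 a) (h1 b) (h1 c)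
  exact add_mem (sub_mem (sub_mem (sub_mem (add_mem (add_mem (neg_mem (h3 ..))
    (nsmul_mem (h3 ..) 2)) (nsmul_mem (h3 ..) 2)) (nsmul_mem (h3 ..) 2)) (h3 ..))
    (nsmul_mem (h3 ..) 2)) (nsmul_mem (h3 ..) 2)

theorem totalDegree_remConst_le (f : MvPolynomial (Fin 3) K) :
    (remConst f).totalDegree ≤ 4 * f.totalDegree := by
  have h1 : ∀ i, pderiv i f ∈ restrictTotalDegree (Fin 3) K f.totalDegree := fun i => by
    rw [mem_restrictTotalDegree]
    exact totalDegree_pderiv_le f i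
  have h2 : ∀ i j, pderiv i (pderiv j f) ∈ restrictTotalDegree (Fin 3) K f.totalDegree :=
    fun i j => by
      rw [mem_restrictTotalDegree]
      exact (totalDegree_pderiv_le _ i).trans (totalDegree_pderiv_le f j)
  rw [← mem_restrictTotalDegree]
  have h3 : ∀ i j a b c, pderiv i (pderiv j f) * pderiv a f * pderiv b f * pderiv c f ∈
      restrictTotalDegree (Fin 3) K (4 * f.totalDegree) := fun i j a b c =>
    mul_mul_mul_mem_restrictTotalDegree (h2 i j) (h1 a) (h1 b) (h1 c)
  exact add_mem (sub_mem (sub_mem (add_mem (add_mem (neg_mem (h3 ..)) (h3 ..))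
    (nsmul_mem (h3 ..) 2)) (h3 ..)) (nsmul_mem (h3 ..) 2)) (h3 ..)

/-- The discriminant of `T ↦ nullD T f`. -/
noncomputable def disc (f : MvPolynomial (Fin 3) K) : MvPolynomial (Fin 3) K :=
  pderiv 1 f * pderiv 1 f - 4 • (pderiv 0 f * pderiv 2 f)

theorem totalDegree_mul_disc_le (f : MvPolynomial (Fin 3) K) :
    (pderiv 2 f * disc f).totalDegree ≤ 4 * f.totalDegree := by
  have h1 : ∀ i, pderiv i f ∈ restrictTotalDegree (Fin 3) K f.totalDegree := fun i => by
    rw [mem_restrictTotalDegree]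
    exact totalDegree_pderiv_le f i
  have h2 : pderiv 2 f * disc f ∈
      restrictTotalDegree (Fin 3) K (f.totalDegree + (f.totalDegree + f.totalDegree)) :=
    mul_mem_restrictTotalDegree (h1 2) (sub_mem (mul_mem_restrictTotalDegree (h1 1) (h1 1))
      (nsmul_mem (mul_mem_restrictTotalDegree (h1 0) (h1 2)) 4))
  rw [mem_restrictTotalDegree] at h2
  omega

theorem eval_nullD (x : Fin 3 → K) (t : K) (f : MvPolynomial (Fin 3) K) :
    eval x (nullD t f) =
      eval x (pderiv 0 f) + t * eval x (pderiv 1 f) + t ^ 2 * eval x (pderiv 2 f) := by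
  simp [nullD_apply]

theorem eval_nullD_pt {r : NullRay K} {f : MvPolynomial (Fin 3) K} (h : r.res f = 0) (s : K) :
    eval (r.pt s) (nullD r.t f) = 0 := by
  rw [← eval_res, res_nullD_eq_zero h, Polynomial.eval_zero]

theorem eval_pt_eq_zero {r : NullRay K} {f : MvPolynomial (Fin 3) K} (h : r.res f = 0) (s : K) :
    eval (r.pt s) f = 0 := by
  rw [← eval_res, h, Polynomial.eval_zero]

/-- The polynomial vanishing at the points `x` for which a null direction tangent to the level
surface of `f` at `x` gives a ray conjugate to `l`. -/
noncomputable def cone (f : MvPolynomial (Fin 3) K) (l : NullRay K) : MvPolynomial (Fin 3) K :=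
  pderiv 0 f * l.e₁ ^ 2 + pderiv 1 f * (l.e₀ * l.e₁) + pderiv 2 f * l.e₀ ^ 2

theorem Conj.res_e₀ {r l : NullRay K} (h : r.Conj l) :
    r.res l.e₀ = Polynomial.C r.t * r.res l.e₁ := by
  unfold Conj at h
  rw [NullRay.res_e₀, NullRay.res_e₁]
  have h2 : r.t * r.a + r.g - l.t * r.a - l.g = r.t * (r.a - l.a) := by linear_combination h
  rw [h2]
  simp only [map_mul]
  ring

theorem conj_iff_eval (r l : NullRay K) (s : K) :
    r.Conj l ↔ eval (r.pt s) l.e₀ = r.t * eval (r.pt s) l.e₁ := by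
  rw [eval_e₀, eval_e₁]
  simp only [pt, Matrix.cons_val_one, Matrix.cons_val_zero, Matrix.cons_val, Conj]
  constructor
  · intro h
    linear_combination h
  · intro h
    linear_combination h

theorem Conj.res_cone {r l : NullRay K} (h : r.Conj l) {f : MvPolynomial (Fin 3) K}
    (hf : r.res f = 0) : r.res (cone f l) = 0 := by
  have h1 := res_nullD_eq_zero hf
  have hC : ∀ c : K, r.res (C c) = Polynomial.C c := fun c => by simp [res]
  rw [nullD_apply] at h1
  simp only [map_add, map_mul, hC, map_pow] at h1
  simp only [cone, map_add, map_mul, map_pow, h.res_e₀]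
  linear_combination (r.res l.e₁) ^ 2 * h1

theorem dvd_cone [Infinite K] {f : MvPolynomial (Fin 3) K} (hf : Irreducible f)
    (hd : ((f.totalDegree.factorial : ℕ) : K) ≠ 0) (hB : f ∣ remLin f) (hC : f ∣ remConst f)
    {l : NullRay K} (hl : l.res f = 0) (hl' : l.res (pderiv 2 f * disc f) ≠ 0) :
    f ∣ cone f l := by
  by_contra hdvd
  have hfin : {s : K | eval (l.pt s) (pderiv 2 f * disc f) ≠ 0}.Infinite := by
    refine Set.Infinite.mono ?_ (Set.Finite.infinite_compl
      (l.res (pderiv 2 f * disc f)).roots.toFinset.finite_toSet)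
    intro s hs
    rw [Set.mem_compl_iff, Finset.mem_coe, Multiset.mem_toFinset, Polynomial.mem_roots hl',
      Polynomial.IsRoot, eval_res] at hs
    exact hs
  obtain ⟨S, hS, hcard⟩ :=
    hfin.exists_subset_card_eq (f.totalDegree * (cone f l).totalDegree + 1)
  let τ : K → K := fun s => -eval (l.pt s) (pderiv 1 f) / eval (l.pt s) (pderiv 2 f) - l.t
  let μ : K → NullRay K := fun s => through (l.pt s) (τ s)
  have hpt : ∀ s, (μ s).pt s = l.pt s := fun s => pt_through (l.pt s) (τ s)
  have hne : ∀ s ∈ S, τ s ≠ l.t ∧ (μ s).res f = 0 := by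
    intro s hs
    have h1 : eval (l.pt s) (pderiv 2 f) * eval (l.pt s) (disc f) ≠ 0 := by
      rw [← map_mul]
      exact hS hs
    have h2 := left_ne_zero_of_mul h1
    have h3 := right_ne_zero_of_mul h1
    have h4 : eval (l.pt s) (pderiv 2 f) * (τ s + l.t) = -eval (l.pt s) (pderiv 1 f) := by
      simp only [τ]
      field_simp
      ring
    have h5 := eval_nullD_pt hl s
    rw [eval_nullD] at h5
    constructor
    · intro h
      rw [h] at h4
      apply h3
      simp only [disc, map_sub, map_mul, nsmul_eq_mul]
      push_cast
      rw [map_ofNat]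
      linear_combination (eval (l.pt s) (pderiv 1 f) +
        2 * l.t * eval (l.pt s) (pderiv 2 f)) * h4 - 4 * eval (l.pt s) (pderiv 2 f) * h5
    · refine res_through_eq_zero hd hB hC (eval_pt_eq_zero hl s) ?_ h2
      rw [eval_nullD]
      linear_combination h5 + (τ s - l.t) * h4
  have hinj : Set.InjOn μ S := by
    intro s hs s' hs' h
    have h1 := congrFun (hpt s) 1
    have h2 := congrFun (hpt s') 1
    rw [← h] at h2
    have h3 : (μ s).t ≠ l.t := (hne s hs).1
    simp only [pt, Matrix.cons_val_one, Matrix.cons_val_zero] at h1 h2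
    have h4 : ((μ s).t - l.t) * (s - s') = 0 := by linear_combination h1 - h2
    exact sub_eq_zero.1 ((mul_eq_zero.1 h4).resolve_left (sub_ne_zero.2 h3))
  have := card_le_mul_totalDegree hf hdvd (S := S.image μ)
    (by
      intro r hr
      obtain ⟨s, hs, rfl⟩ := Finset.mem_image.1 hr
      exact (hne s hs).2)
    (by
      intro r hr
      obtain ⟨s, hs, rfl⟩ := Finset.mem_image.1 hr
      exact (conj_of_pt_eq (hpt s)).res_cone (hne s hs).2)
  rw [Finset.card_image_of_injOn hinj] at this
  omega

/-- The rays of `L` that are conjugate to `r` and distinct from it. -/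
noncomputable def nbhd (L : Finset (NullRay K)) (r : NullRay K) : Finset (NullRay K) :=
  L.filter fun m => r ≠ m ∧ r.Conj m

theorem mem_nbhd {L : Finset (NullRay K)} {r m : NullRay K} :
    m ∈ nbhd L r ↔ m ∈ L ∧ r ≠ m ∧ r.Conj m := by
  simp [nbhd]

/-- The number of ordered pairs of distinct conjugate rays in `L`. -/
noncomputable def edges (L : Finset (NullRay K)) : ℕ := ∑ r ∈ L, (nbhd L r).card

theorem nbhd_mono {L L' : Finset (NullRay K)} (h : L ⊆ L') (r : NullRay K) :
    (nbhd L r).card ≤ (nbhd L' r).card :=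
  Finset.card_le_card (Finset.filter_subset_filter _ h)

theorem card_nbhd_add {L B : Finset (NullRay K)} (h : B ⊆ L) (r : NullRay K) :
    (nbhd L r).card = (nbhd B r).card + (nbhd (L \ B) r).card := by
  unfold nbhd
  rw [← Finset.card_union_of_disjoint (Finset.disjoint_filter_filter Finset.disjoint_sdiff),
    ← Finset.filter_union, Finset.union_sdiff_of_subset h]

theorem sum_card_nbhd_comm (L M : Finset (NullRay K)) :
    ∑ r ∈ L, (nbhd M r).card = ∑ r ∈ M, (nbhd L r).card := by
  have h := Finset.sum_card_bipartiteAbove_eq_sum_card_bipartiteBelow (s := L) (t := M)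
    (fun r m : NullRay K => r ≠ m ∧ r.Conj m)
  refine h.trans (Finset.sum_congr rfl fun r _ => congrArg Finset.card ?_)
  ext m
  simp only [Finset.mem_bipartiteBelow, mem_nbhd]
  exact ⟨fun h => ⟨h.1, h.2.1.symm, h.2.2.symm⟩, fun h => ⟨h.1, h.2.1.symm, h.2.2.symm⟩⟩

theorem edges_eq {L B : Finset (NullRay K)} (h : B ⊆ L) :
    edges L = edges B + edges (L \ B) + 2 * ∑ r ∈ L \ B, (nbhd B r).card := by
  have h1 := Finset.sum_sdiff (f := fun r => (nbhd L r).card) h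
  simp only [card_nbhd_add h, Finset.sum_add_distrib] at h1
  rw [sum_card_nbhd_comm B (L \ B)] at h1
  unfold edges
  simp only [card_nbhd_add h, Finset.sum_add_distrib]
  omega

theorem edges_le {L B : Finset (NullRay K)} (h : B ⊆ L) :
    edges L ≤ edges B + 2 * ∑ r ∈ L \ B, (nbhd L r).card := by
  rw [edges_eq h]
  simp only [card_nbhd_add h, Finset.sum_add_distrib]
  unfold edges
  omega

/-- A two-coloured family of rays in which rays of the same colour are never conjugate, conjugate
rays have distinct slopes, and two rays of the same colour have at most `k` common
neighbours. -/
structure IsConfig (U : Finset (NullRay K)) (χ : NullRay K → Bool) (k : ℕ) : Prop where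
  color_ne : ∀ r ∈ U, ∀ r' ∈ U, r ≠ r' → r.Conj r' → χ r ≠ χ r'
  slope_ne : ∀ r ∈ U, ∀ r' ∈ U, r ≠ r' → r.Conj r' → r.t ≠ r'.t
  card_le : ∀ r ∈ U, ∀ r' ∈ U, r ≠ r' → χ r = χ r' →
    (U.filter fun u => u.Conj r ∧ u.Conj r').card ≤ k

namespace IsConfig

variable {U : Finset (NullRay K)} {χ : NullRay K → Bool} {k : ℕ}

theorem mono (hU : IsConfig U χ k) {L : Finset (NullRay K)} (h : L ⊆ U) : IsConfig L χ k where
  color_ne r hr r' hr' := hU.color_ne r (h hr) r' (h hr')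
  slope_ne r hr r' hr' := hU.slope_ne r (h hr) r' (h hr')
  card_le r hr r' hr' h1 h2 := (Finset.card_le_card (Finset.filter_subset_filter _ h)).trans
    (hU.card_le r (h hr) r' (h hr') h1 h2)

theorem not_conj_of_mem_nbhd (hU : IsConfig U χ k) {a m m' : NullRay K} (ha : a ∈ U)
    (hm : m ∈ nbhd U a) (hm' : m' ∈ nbhd U a) (hne : m ≠ m') : ¬ m.Conj m' := by
  intro hc
  rw [mem_nbhd] at hm hm'
  have h1 := hU.color_ne a ha m hm.1 hm.2.1 hm.2.2
  have h2 := hU.color_ne a ha m' hm'.1 hm'.2.1 hm'.2.2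
  have h3 := hU.color_ne m hm.1 m' hm'.1 hne hc
  revert h1 h2 h3
  cases χ a <;> cases χ m <;> cases χ m' <;> simp

theorem card_filter_nbhd_le (hU : IsConfig U χ k) {a : NullRay K} (ha : a ∈ U)
    {M : Finset (NullRay K)} (hM : M ⊆ nbhd U a) {h : MvPolynomial (Fin 3) K} (hl : a.res h ≠ 0)
    (h0 : ∀ m ∈ M, eval (a.pt (a.meet m)) h = 0) : M.card ≤ h.totalDegree := by
  refine card_le_totalDegree hl (fun m hm => ?_)
    (fun m hm m' hm' hne => hU.not_conj_of_mem_nbhd ha (hM hm) (hM hm') hne) h0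
  have h1 := mem_nbhd.1 (hM hm)
  exact ⟨h1.2.2, hU.slope_ne a ha m h1.1 h1.2.1 h1.2.2⟩

variable {f h : MvPolynomial (Fin 3) K}

theorem exists_edges_le_of_sum_le (hf : Irreducible f) (hfh : ¬ f ∣ h)
    (hdeg : h.totalDegree ≤ 4 * f.totalDegree) (hL : ∀ r ∈ U, r.res f = 0) {N : ℕ}
    (hN : ∑ a ∈ U.filter (fun a => a.res h ≠ 0), (nbhd U a).card ≤ N * U.card) :
    ∃ B ⊆ U, B.card ≤ 4 * f.totalDegree ^ 2 ∧ edges U ≤ edges B + 2 * (N * U.card) := by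
  refine ⟨U.filter (fun a => a.res h = 0), Finset.filter_subset _ _, ?_, ?_⟩
  · have := card_le_mul_totalDegree hf hfh (S := U.filter (fun a => a.res h = 0))
      (fun r hr => hL r (Finset.mem_filter.1 hr).1) (fun r hr => (Finset.mem_filter.1 hr).2)
    nlinarith
  · refine (edges_le (Finset.filter_subset (fun a => a.res h = 0) U)).trans ?_
    rw [← Finset.filter_not]
    have : ∑ a ∈ U.filter (fun a => ¬ a.res h = 0), (nbhd U a).card ≤ N * U.card := hN
    omega

theorem exists_edges_le_of_vanish (hU : IsConfig U χ k) (hf : Irreducible f) (hfh : ¬ f ∣ h)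
    (hdeg : h.totalDegree ≤ 4 * f.totalDegree) (hL : ∀ r ∈ U, r.res f = 0)
    (h0 : ∀ a ∈ U, ∀ b ∈ nbhd U a, eval (a.pt (a.meet b)) h = 0) :
    ∃ B ⊆ U, B.card ≤ 4 * f.totalDegree ^ 2 ∧
      edges U ≤ edges B + (8 * f.totalDegree + 4 * (k + 1)) * U.card := by
  obtain ⟨B, h1, h2, h3⟩ := exists_edges_le_of_sum_le hf hfh hdeg hL (N := 4 * f.totalDegree) (by
    calc ∑ a ∈ U.filter (fun a => a.res h ≠ 0), (nbhd U a).card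
        ≤ (U.filter (fun a => a.res h ≠ 0)).card * (4 * f.totalDegree) := by
          rw [← smul_eq_mul]
          refine Finset.sum_le_card_nsmul _ _ _ fun a ha => ?_
          rw [Finset.mem_filter] at ha
          exact (hU.card_filter_nbhd_le ha.1 subset_rfl ha.2 (h0 a ha.1)).trans hdeg
      _ ≤ 4 * f.totalDegree * U.card := by
          rw [mul_comm]
          exact Nat.mul_le_mul_left _ (Finset.card_filter_le _ _))
  exact ⟨B, h1, h2, by nlinarith⟩

/-- The tangency conditions at a meeting point. -/
theorem eval_meet (hU : IsConfig U χ k) (hL : ∀ r ∈ U, r.res f = 0) {a b : NullRay K}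
    (ha : a ∈ U) (hb : b ∈ nbhd U a) :
    a.t ≠ b.t ∧ a.pt (a.meet b) = b.pt (a.meet b) ∧
    eval (a.pt (a.meet b)) (pderiv 1 f) = -(a.t + b.t) * eval (a.pt (a.meet b)) (pderiv 2 f) ∧
    eval (a.pt (a.meet b)) (pderiv 0 f) = a.t * b.t * eval (a.pt (a.meet b)) (pderiv 2 f) := by
  rw [mem_nbhd] at hb
  have ht := hU.slope_ne a ha b hb.1 hb.2.1 hb.2.2
  have hp := pt_meet hb.2.2 ht
  have h1 := eval_nullD_pt (hL a ha) (a.meet b)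
  have h2 := eval_nullD_pt (hL b hb.1) (a.meet b)
  rw [← hp] at h2
  rw [eval_nullD] at h1 h2
  refine ⟨ht, hp, ?_⟩
  have h3 : eval (a.pt (a.meet b)) (pderiv 1 f) =
      -(a.t + b.t) * eval (a.pt (a.meet b)) (pderiv 2 f) := by
    apply mul_left_cancel₀ (sub_ne_zero.2 ht)
    linear_combination h1 - h2
  exact ⟨h3, by linear_combination h1 - a.t * h3⟩

theorem eval_rem_meet (hU : IsConfig U χ k) (hL : ∀ r ∈ U, r.res f = 0) {a b : NullRay K}
    (ha : a ∈ U) (hb : b ∈ nbhd U a) :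
    eval (a.pt (a.meet b)) (remLin f) = 0 ∧ eval (a.pt (a.meet b)) (remConst f) = 0 := by
  obtain ⟨ht, hp, -, -⟩ := hU.eval_meet hL ha hb
  have key : ∀ r ∈ U, ∀ s, r.t * eval (r.pt s) (remLin f) + eval (r.pt s) (remConst f) = 0 := by
    intro r hr s
    obtain ⟨A, hA⟩ := exists_mul_nullD_nullD f r.t
    have h1 := congrArg (eval (r.pt s)) hA
    have h2 := eval_nullD_pt (hL r hr) s
    have h3 := eval_nullD_pt (res_nullD_eq_zero (hL r hr)) s
    simp only [map_mul, map_add, eval_C, h2, h3, mul_zero, zero_add] at h1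
    exact h1.symm
  have h1 := key a ha (a.meet b)
  have h2 := key b (mem_nbhd.1 hb).1 (a.meet b)
  rw [← hp] at h2
  have h3 : eval (a.pt (a.meet b)) (remLin f) = 0 := by
    apply (mul_eq_zero.1 (_ : (a.t - b.t) * _ = 0)).resolve_left (sub_ne_zero.2 ht)
    linear_combination h1 - h2
  exact ⟨h3, by linear_combination h1 - a.t * h3⟩

theorem conj_of_dvd_cone (hU : IsConfig U χ k) (hL : ∀ r ∈ U, r.res f = 0) {a b l : NullRay K}
    (ha : a ∈ U) (hb : b ∈ nbhd U a) (hu : eval (a.pt (a.meet b)) (pderiv 2 f) ≠ 0)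
    (hl : l ∈ U) (hla : χ l = χ a) (hdvd : f ∣ cone f l) : b ∈ nbhd U l := by
  obtain ⟨ht, hp, hv, hw⟩ := hU.eval_meet hL ha hb
  have hb' := mem_nbhd.1 hb
  have hχ := hU.color_ne a ha b hb'.1 hb'.2.1 hb'.2.2
  obtain ⟨q, hq⟩ := hdvd
  have h1 := congrArg (eval (a.pt (a.meet b))) hq
  rw [map_mul, eval_pt_eq_zero (hL a ha), zero_mul] at h1
  simp only [cone, map_add, map_mul, map_pow, hv, hw] at h1
  have h2 : (eval (a.pt (a.meet b)) l.e₀ - a.t * eval (a.pt (a.meet b)) l.e₁) *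
      (eval (a.pt (a.meet b)) l.e₀ - b.t * eval (a.pt (a.meet b)) l.e₁) = 0 := by
    apply mul_left_cancel₀ hu
    linear_combination h1
  rw [mem_nbhd]
  refine ⟨hb'.1, ?_, ?_⟩
  · rintro rfl
    exact hχ hla.symm
  · rcases mul_eq_zero.1 h2 with h | h
    · have h3 : a.Conj l := (conj_iff_eval a l _).2 (sub_eq_zero.1 h)
      by_cases hal : a = l
      · rw [← hal]
        exact hb'.2.2
      · exact absurd hla.symm (hU.color_ne a ha l hl hal h3)
    · rw [hp] at h
      exact ((conj_iff_eval b l _).2 (sub_eq_zero.1 h)).symm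

theorem sum_regular_le (hU : IsConfig U χ k) {G : Finset (NullRay K)} (hG : G ⊆ U)
    (c : Bool) (hc : ∀ a ∈ G, χ a = c) (R : NullRay K → Finset (NullRay K))
    (hR : ∀ a ∈ G, ∀ b ∈ R a, ∀ l ∈ G, b ∈ nbhd U l) :
    ∑ a ∈ G, (R a).card ≤ (k + 1) * U.card := by
  let H := G.biUnion R
  have hH : ∀ b ∈ H, ∀ l ∈ G, b ∈ nbhd U l := by
    intro b hb l hl
    obtain ⟨a, ha, hab⟩ := Finset.mem_biUnion.1 hb
    exact hR a ha b hab l hl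
  have h1 : ∑ a ∈ G, (R a).card ≤ G.card * H.card := by
    rw [← smul_eq_mul]
    exact Finset.sum_le_card_nsmul _ _ _ fun a ha =>
      Finset.card_le_card (Finset.subset_biUnion_of_mem R ha)
  have hGU := Finset.card_le_card hG
  rcases le_or_gt H.card 1 with h2 | h2
  · nlinarith
  · obtain ⟨b, hb, b', hb', hne⟩ := Finset.one_lt_card.1 h2
    rcases G.eq_empty_or_nonempty with rfl | ⟨l, hl⟩
    · simp
    have h3 := mem_nbhd.1 (hH b hb l hl)
    have h4 := mem_nbhd.1 (hH b' hb' l hl)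
    have h5 := hU.color_ne l (hG hl) b h3.1 h3.2.1 h3.2.2
    have h6 := hU.color_ne l (hG hl) b' h4.1 h4.2.1 h4.2.2
    have h7 : χ b = χ b' := by
      revert h5 h6
      cases χ l <;> cases χ b <;> cases χ b' <;> simp
    have h8 : G.card ≤ k := by
      refine le_trans (Finset.card_le_card fun g hg => ?_) (hU.card_le b h3.1 b' h4.1 hne h7)
      exact Finset.mem_filter.2 ⟨hG hg, (mem_nbhd.1 (hH b hb g hg)).2.2,
        (mem_nbhd.1 (hH b' hb' g hg)).2.2⟩
    have h9 : H.card ≤ U.card := Finset.card_le_card fun b hb => (mem_nbhd.1 (hH b hb l hl)).1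
    calc ∑ a ∈ G, (R a).card ≤ G.card * H.card := h1
      _ ≤ k * U.card := Nat.mul_le_mul h8 h9
      _ ≤ _ := Nat.mul_le_mul_right _ (Nat.le_succ k)

theorem exists_edges_le_of_irreducible [Infinite K] (hU : IsConfig U χ k) (hf : Irreducible f)
    (hd : ((f.totalDegree.factorial : ℕ) : K) ≠ 0) (hL : ∀ r ∈ U, r.res f = 0) :
    ∃ B ⊆ U, B.card ≤ 4 * f.totalDegree ^ 2 ∧
      edges U ≤ edges B + (8 * f.totalDegree + 4 * (k + 1)) * U.card := by
  have hdeg : ∀ i, (pderiv i f).totalDegree ≤ 4 * f.totalDegree := fun i =>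
    (totalDegree_pderiv_le f i).trans (by omega)
  by_cases hu : pderiv 2 f = 0
  · have huv : ∀ a ∈ U, ∀ b ∈ nbhd U a, eval (a.pt (a.meet b)) (pderiv 1 f) = 0 ∧
        eval (a.pt (a.meet b)) (pderiv 0 f) = 0 := by
      intro a ha b hb
      obtain ⟨-, -, hv, hw⟩ := hU.eval_meet hL ha hb
      rw [hv, hw, hu, map_zero, mul_zero, mul_zero]
      exact ⟨rfl, rfl⟩
    by_cases hv : pderiv 1 f = 0
    · have hdf : f.totalDegree ≠ 0 := by
        intro h0
        apply hf.not_isUnit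
        rw [totalDegree_eq_zero_iff_eq_C] at h0
        rw [h0]
        refine IsUnit.map C (isUnit_iff_ne_zero.2 fun h => hf.ne_zero ?_)
        rw [h0, h, map_zero]
      obtain ⟨i, hi⟩ := exists_pderiv_ne_zero hdf hd
      have hw : pderiv 0 f ≠ 0 := by
        fin_cases i
        · exact hi
        · exact absurd hv hi
        · exact absurd hu hi
      exact hU.exists_edges_le_of_vanish hf (not_dvd_pderiv hw) (hdeg 0) hL
        fun a ha b hb => (huv a ha b hb).2
    · exact hU.exists_edges_le_of_vanish hf (not_dvd_pderiv hv) (hdeg 1) hL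
        fun a ha b hb => (huv a ha b hb).1
  by_cases hΔ : f ∣ disc f
  · refine hU.exists_edges_le_of_vanish hf (not_dvd_pderiv hu) (hdeg 2) hL fun a ha b hb => ?_
    obtain ⟨ht, -, hv, hw⟩ := hU.eval_meet hL ha hb
    obtain ⟨q, hq⟩ := hΔ
    have h1 := congrArg (eval (a.pt (a.meet b))) hq
    rw [map_mul, eval_pt_eq_zero (hL a ha), zero_mul] at h1
    simp only [disc, map_sub, map_mul, nsmul_eq_mul, hv, hw] at h1
    push_cast at h1
    rw [map_ofNat] at h1
    have h2 : ((a.t - b.t) * eval (a.pt (a.meet b)) (pderiv 2 f)) ^ 2 = 0 := by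
      linear_combination h1
    exact (mul_eq_zero.1 (pow_eq_zero_iff two_ne_zero |>.1 h2)).resolve_left (sub_ne_zero.2 ht)
  by_cases hB : f ∣ remLin f
  swap
  · exact hU.exists_edges_le_of_vanish hf hB (totalDegree_remLin_le f) hL
      fun a ha b hb => (hU.eval_rem_meet hL ha hb).1
  by_cases hC : f ∣ remConst f
  swap
  · exact hU.exists_edges_le_of_vanish hf hC (totalDegree_remConst_le f) hL
      fun a ha b hb => (hU.eval_rem_meet hL ha hb).2
  have hfh : ¬ f ∣ pderiv 2 f * disc f := fun h =>
    (hf.prime.dvd_or_dvd h).elim (not_dvd_pderiv hu) hΔ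
  let G := U.filter (fun a => a.res (pderiv 2 f * disc f) ≠ 0)
  let R : NullRay K → Finset (NullRay K) := fun a =>
    (nbhd U a).filter fun b => eval (a.pt (a.meet b)) (pderiv 2 f) ≠ 0
  let I : NullRay K → Finset (NullRay K) := fun a =>
    (nbhd U a).filter fun b => ¬ eval (a.pt (a.meet b)) (pderiv 2 f) ≠ 0
  have hGU : G ⊆ U := Finset.filter_subset _ _
  have hI : ∀ a ∈ G, (I a).card ≤ f.totalDegree := by
    intro a ha
    refine le_trans (hU.card_filter_nbhd_le (hGU ha) (Finset.filter_subset _ _)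
      (h := pderiv 2 f) ?_ fun m hm => ?_) (totalDegree_pderiv_le f 2)
    · have := (Finset.mem_filter.1 ha).2
      rw [map_mul] at this
      exact left_ne_zero_of_mul this
    · exact not_not.1 (Finset.mem_filter.1 hm).2
  have hRG : ∀ c : Bool, ∑ a ∈ G.filter (fun a => χ a = c), (R a).card ≤
      (k + 1) * U.card := by
    intro c
    refine hU.sum_regular_le ((Finset.filter_subset _ _).trans hGU) c
      (fun a ha => (Finset.mem_filter.1 ha).2) R fun a ha b hb l hl => ?_
    rw [Finset.mem_filter] at ha hl hb
    refine hU.conj_of_dvd_cone hL (hGU ha.1) hb.1 hb.2 (hGU hl.1) (hl.2.trans ha.2.symm) ?_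
    exact dvd_cone hf hd hB hC (hL l (hGU hl.1)) (Finset.mem_filter.1 hl.1).2
  have hsplit : ∀ g : NullRay K → ℕ, ∑ a ∈ G, g a =
      ∑ a ∈ G.filter (fun a => χ a = true), g a + ∑ a ∈ G.filter (fun a => χ a = false), g a := by
    intro g
    rw [← Finset.sum_filter_add_sum_filter_not G (fun a => χ a = true)]
    simp
  have hsum : ∑ a ∈ G, (nbhd U a).card ≤ (4 * f.totalDegree + 2 * (k + 1)) * U.card := by
    have h1 : ∑ a ∈ G, (nbhd U a).card = ∑ a ∈ G, (R a).card + ∑ a ∈ G, (I a).card := by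
      rw [← Finset.sum_add_distrib]
      exact Finset.sum_congr rfl fun a _ => (Finset.card_filter_add_card_filter_not _).symm
    have h2 : ∑ a ∈ G, (I a).card ≤ G.card * f.totalDegree := by
      rw [← smul_eq_mul]
      exact Finset.sum_le_card_nsmul _ _ _ hI
    have h3 := hRG true
    have h4 := hRG false
    have h5 := Finset.card_le_card hGU
    rw [h1, hsplit]
    nlinarith
  obtain ⟨B, h1, h2, h3⟩ := exists_edges_le_of_sum_le hf hfh (totalDegree_mul_disc_le f) hL hsum
  exact ⟨B, h1, h2, by linarith⟩

theorem exists_edges_le [Infinite K] (f : MvPolynomial (Fin 3) K) (hf : f ≠ 0) :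
    ((f.totalDegree.factorial : ℕ) : K) ≠ 0 → ∀ U : Finset (NullRay K), IsConfig U χ k →
      (∀ r ∈ U, r.res f = 0) → ∃ B ⊆ U, B.card ≤ 4 * f.totalDegree ^ 2 ∧
        edges U ≤ edges B + (8 * f.totalDegree + 4 * (k + 1)) * U.card := by
  induction f using WfDvdMonoid.induction_on_irreducible with
  | zero => exact absurd rfl hf
  | unit f hunit =>
    intro _ U _ hL
    have : U = ∅ := by
      refine Finset.eq_empty_of_forall_notMem fun r hr => ?_
      have := hunit.map r.res
      rw [hL r hr] at this
      exact not_isUnit_zero this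
    subst this
    exact ⟨∅, subset_rfl, by simp, by simp⟩
  | mul h g hh hg ih =>
    intro hd U hU hL
    have hdeg := totalDegree_mul_of_isDomain hg.ne_zero hh
    rw [hdeg] at hd ⊢
    have hfac : ∀ n ≤ g.totalDegree + h.totalDegree, ((n.factorial : ℕ) : K) ≠ 0 := by
      intro n hn h0
      obtain ⟨c, hc⟩ := Nat.factorial_dvd_factorial hn
      apply hd
      rw [hc, Nat.cast_mul, h0, zero_mul]
    let V := U.filter fun r => r.res g = 0
    have hVU : V ⊆ U := Finset.filter_subset _ _
    have hV : ∀ r ∈ U \ V, r.res g ≠ 0 := by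
      intro r hr h0
      rw [Finset.mem_sdiff] at hr
      exact hr.2 (Finset.mem_filter.2 ⟨hr.1, h0⟩)
    obtain ⟨B₁, hB₁, hc₁, he₁⟩ := (hU.mono hVU).exists_edges_le_of_irreducible hg
      (hfac _ (by omega)) fun r hr => (Finset.mem_filter.1 hr).2
    obtain ⟨B₂, hB₂, hc₂, he₂⟩ := ih hh (hfac _ (by omega)) (U \ V)
      (hU.mono Finset.sdiff_subset) fun r hr => by
        have h1 := hL r (Finset.mem_sdiff.1 hr).1
        rw [map_mul] at h1
        exact (mul_eq_zero.1 h1).resolve_left (hV r hr)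
    have hcross : ∑ r ∈ U \ V, (nbhd V r).card ≤ (U \ V).card * g.totalDegree := by
      rw [← smul_eq_mul]
      refine Finset.sum_le_card_nsmul _ _ _ fun r hr => ?_
      refine hU.card_filter_nbhd_le (Finset.mem_sdiff.1 hr).1
        (Finset.filter_subset_filter _ hVU) (hV r hr) fun m hm => ?_
      have h1 := mem_nbhd.1 hm
      have h2 := hU.slope_ne r (Finset.mem_sdiff.1 hr).1 m (hVU h1.1) h1.2.1 h1.2.2
      rw [pt_meet h1.2.2 h2]
      exact eval_pt_eq_zero (Finset.mem_filter.1 h1.1).2 _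
    have hB : B₁ ∪ B₂ ⊆ U :=
      Finset.union_subset (hB₁.trans hVU) (hB₂.trans Finset.sdiff_subset)
    refine ⟨B₁ ∪ B₂, hB, ?_, ?_⟩
    · have := Finset.card_union_le B₁ B₂
      nlinarith [Nat.zero_le (g.totalDegree * h.totalDegree)]
    · have h1 := edges_eq hVU
      have hdisj : Disjoint B₁ B₂ :=
        Finset.disjoint_of_subset_left hB₁ (Finset.disjoint_of_subset_right hB₂
          Finset.disjoint_sdiff)
      have h2 := edges_eq (Finset.subset_union_left : B₁ ⊆ B₁ ∪ B₂)
      rw [Finset.union_sdiff_cancel_left hdisj] at h2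
      have h3 := Finset.card_sdiff_add_card_eq_card hVU
      have h4 : edges B₁ + edges B₂ ≤ edges (B₁ ∪ B₂) := by omega
      rw [h1, ← h3]
      nlinarith [Nat.zero_le (g.totalDegree * (U \ V).card), Nat.zero_le (h.totalDegree * V.card)]

end IsConfig

/-- A small set of rays meeting most members of a family of large minimal degree many times. -/
theorem exists_small_nbhd_card_gt (L : Finset (NullRay K)) {d D : ℕ} (hd : d < D)
    (hL : ∀ r ∈ L, D < (nbhd L r).card) :
    ∃ P ⊆ L, P.card * (D - d) ≤ 4 * L.card * (d + 1) ∧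
      4 * (L.filter fun r => (nbhd P r).card ≤ d).card ≤ L.card := by
  let Φ : Finset (NullRay K) → ℤ := fun P =>
    4 * ∑ r ∈ L, (min (nbhd P r).card (d + 1) : ℕ) - (D - d : ℕ) * P.card
  obtain ⟨P, hP, hmax⟩ := Finset.exists_max_image L.powerset Φ ⟨∅, by simp⟩
  rw [Finset.mem_powerset] at hP
  refine ⟨P, hP, ?_, ?_⟩
  · have h0 := hmax ∅ (by simp)
    have h1 : ∑ r ∈ L, min (nbhd P r).card (d + 1) ≤ L.card * (d + 1) := by
      rw [← smul_eq_mul]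
      exact Finset.sum_le_card_nsmul _ _ _ fun r _ => min_le_right _ _
    simp only [Φ, nbhd, Finset.filter_empty, Finset.card_empty, Nat.zero_min, Nat.cast_zero,
      Finset.sum_const_zero, mul_zero, sub_zero] at h0
    zify at h1 ⊢
    simp only [nbhd] at h0 h1
    push_cast at h0 h1
    nlinarith
  · set Q := L.filter fun r => (nbhd P r).card ≤ d with hQ
    have hQL : Q ⊆ L := Finset.filter_subset _ _
    have hstep : ∀ r ∈ L \ P, 4 * (nbhd Q r).card ≤ D - d := by
      intro r hr
      rw [Finset.mem_sdiff] at hr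
      have h0 := hmax (insert r P) (by
        rw [Finset.mem_powerset]
        exact Finset.insert_subset hr.1 hP)
      have h1 : ∑ l ∈ L, min (nbhd P l).card (d + 1) + (nbhd Q r).card ≤
          ∑ l ∈ L, min (nbhd (insert r P) l).card (d + 1) := by
        have h2 : (nbhd Q r).card = ∑ l ∈ L, if l ∈ nbhd Q r then 1 else 0 := by
          rw [Finset.sum_ite_mem, Finset.card_eq_sum_ones, Finset.inter_eq_right.2]
          exact (Finset.filter_subset _ _).trans hQL
        rw [h2, ← Finset.sum_add_distrib]
        refine Finset.sum_le_sum fun l hl => ?_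
        split_ifs with hlr
        · rw [mem_nbhd] at hlr
          have h3 : (nbhd P l).card ≤ d := (Finset.mem_filter.1 hlr.1).2
          have h4 : (nbhd P l).card < (nbhd (insert r P) l).card := by
            refine Finset.card_lt_card ((Finset.ssubset_iff_of_subset
              (Finset.filter_subset_filter _ (Finset.subset_insert r P))).2 ⟨r, ?_, ?_⟩)
            · exact mem_nbhd.2 ⟨Finset.mem_insert_self r P, hlr.2.1.symm, hlr.2.2.symm⟩
            · exact fun h => hr.2 (mem_nbhd.1 h).1
          omega
        · exact min_le_min_right _ (nbhd_mono (Finset.subset_insert r P) l)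
      simp only [Φ, Finset.card_insert_of_notMem hr.2] at h0
      zify at h1 ⊢
      push_cast at h0 h1 ⊢
      linarith
    have h1 : 4 * ∑ r ∈ L \ P, (nbhd Q r).card ≤ L.card * (D - d) := by
      rw [Finset.mul_sum]
      refine (Finset.sum_le_card_nsmul _ _ _ hstep).trans ?_
      rw [smul_eq_mul]
      exact Nat.mul_le_mul_right _ (Finset.card_le_card Finset.sdiff_subset)
    rw [sum_card_nbhd_comm] at h1
    have h2 : Q.card * (D - d) ≤ ∑ r ∈ Q, (nbhd (L \ P) r).card := by
      rw [← smul_eq_mul]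
      refine Finset.card_nsmul_le_sum _ _ _ fun r hr => ?_
      have h3 := hL r (hQL hr)
      rw [card_nbhd_add hP] at h3
      have h4 := (Finset.mem_filter.1 hr).2
      omega
    refine Nat.le_of_mul_le_mul_right (c := D - d) ?_ (by omega)
    rw [mul_assoc]
    omega

theorem edges_le_mul_card [Infinite K] {U : Finset (NullRay K)} {χ : NullRay K → Bool} {k : ℕ}
    (hU : IsConfig U χ k) (hd : ((U.card.sqrt.factorial : ℕ) : K) ≠ 0) :
    ∀ L ⊆ U, edges L ≤ 2 * (500 * (U.card.sqrt + 1) + 4 * k + 4) * L.card := by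
  intro L
  induction L using Finset.strongInductionOn with
  | _ L ih =>
  intro hLU
  set D := 500 * (U.card.sqrt + 1) + 4 * k + 4 with hD
  by_cases hmin : ∃ r ∈ L, (nbhd L r).card ≤ D
  · obtain ⟨r, hr, hrD⟩ := hmin
    have h1 := edges_eq (Finset.erase_subset r L)
    have h2 := ih (L.erase r) (Finset.erase_ssubset hr) ((Finset.erase_subset r L).trans hLU)
    rw [Finset.sdiff_erase hr, Finset.sdiff_self, insert_empty_eq] at h1
    have h3 : edges {r} = 0 := by
      simp [edges, nbhd, Finset.filter_singleton]
    have h4 := nbhd_mono (Finset.erase_subset r L) r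
    have h5 := Finset.card_erase_add_one hr
    rw [Finset.sum_singleton, h3] at h1
    rw [h1, ← h5]
    nlinarith
  push Not at hmin
  rcases L.eq_empty_or_nonempty with rfl | hne
  · simp [edges]
  have hn := hne.card_pos
  have hnU := Finset.card_le_card hLU
  set d := L.card.sqrt / 4 with hddef
  have hd1 : 16 * d ^ 2 ≤ L.card := by
    have h1 := Nat.sqrt_le' L.card
    have h2 : 4 * d ≤ L.card.sqrt := by omega
    nlinarith
  have hd2 : L.card < 16 * (d + 1) ^ 2 := by
    have h1 := Nat.lt_succ_sqrt' L.card
    have h2 : L.card.sqrt + 1 ≤ 4 * (d + 1) := by omega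
    rw [Nat.succ_eq_add_one] at h1
    nlinarith
  have hd3 : 4 * d ≤ U.card.sqrt := by
    have := Nat.sqrt_le_sqrt hnU
    omega
  obtain ⟨P, hPL, hP1, hP2⟩ := exists_small_nbhd_card_gt L (d := d) (D := D) (by omega) hmin
  have hP3 : 6 * P.card < (d + 2) * (d + 3) := by
    have h1 : 384 * (d + 1) ≤ D - d := by omega
    have h2 : P.card * (384 * (d + 1)) ≤ 4 * L.card * (d + 1) :=
      (Nat.mul_le_mul_left _ h1).trans hP1
    have h3 : P.card * 384 ≤ 4 * L.card := by
      refine Nat.le_of_mul_le_mul_right (c := d + 1) ?_ (Nat.succ_pos d)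
      rw [mul_assoc]
      exact h2
    nlinarith
  obtain ⟨f, hf0, hfd, hfP⟩ := exists_res_eq_zero P d hP3
  let E := L.filter fun r => r.res f ≠ 0
  let Z := L.filter fun r => r.res f = 0
  have hEL : E ⊆ L := Finset.filter_subset _ _
  have hZL : Z ⊆ L := Finset.filter_subset _ _
  have hLE : L \ Z = E := by
    rw [← Finset.filter_not]
  have hmeet : ∀ V : Finset (NullRay K), V ⊆ L → (∀ r ∈ V, r.res f = 0) →
      ∀ r ∈ E, (nbhd V r).card ≤ d := by
    intro V hVL hV r hr
    rw [Finset.mem_filter] at hr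
    refine le_trans ((hU.mono hLU).card_filter_nbhd_le hr.1 (Finset.filter_subset_filter _ hVL)
      hr.2 fun m hm => ?_) hfd
    have h1 := mem_nbhd.1 hm
    rw [pt_meet h1.2.2 ((hU.mono hLU).slope_ne r hr.1 m (hVL h1.1) h1.2.1 h1.2.2)]
    exact eval_pt_eq_zero (hV m h1.1) _
  have hE : 4 * E.card ≤ L.card := by
    refine le_trans (Nat.mul_le_mul_left 4 (Finset.card_le_card fun r hr => ?_)) hP2
    exact Finset.mem_filter.2 ⟨hEL hr, hmeet P hPL hfP r hr⟩
  have hfac : ((f.totalDegree.factorial : ℕ) : K) ≠ 0 := by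
    intro h0
    obtain ⟨c, hc⟩ := Nat.factorial_dvd_factorial (show f.totalDegree ≤ U.card.sqrt by omega)
    apply hd
    rw [hc, Nat.cast_mul, h0, zero_mul]
  obtain ⟨B, hBZ, hB1, hB2⟩ := IsConfig.exists_edges_le f hf0 hfac Z (hU.mono (hZL.trans hLU))
    fun r hr => (Finset.mem_filter.1 hr).2
  have hB3 : 4 * B.card ≤ L.card := by
    have : f.totalDegree ^ 2 ≤ d ^ 2 := Nat.pow_le_pow_left hfd 2
    omega
  have hlt : ∀ V ⊆ L, 4 * V.card ≤ L.card → edges V ≤ 2 * D * V.card := by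
    intro V hVL hV
    refine ih V (Finset.ssubset_iff_subset_ne.2 ⟨hVL, ?_⟩) (hVL.trans hLU)
    rintro rfl
    omega
  have h1 := hlt E hEL hE
  have h2 := hlt B (hBZ.trans hZL) hB3
  have h3 := edges_eq hZL
  rw [hLE] at h3
  have h4 : ∑ r ∈ E, (nbhd Z r).card ≤ E.card * d := by
    rw [← smul_eq_mul]
    exact Finset.sum_le_card_nsmul _ _ _
      (hmeet Z hZL fun r hr => (Finset.mem_filter.1 hr).2)
  have h5 := Finset.card_le_card hZL
  have h6 := Finset.card_le_card hEL
  have h7 : edges L ≤ 2 * D * B.card + (8 * d + 4 * (k + 1)) * L.card + 2 * D * E.card +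
      2 * (L.card * d) := by
    have h8 : (8 * f.totalDegree + 4 * (k + 1)) * Z.card ≤ (8 * d + 4 * (k + 1)) * L.card :=
      Nat.mul_le_mul (by omega) h5
    have h9 := Nat.mul_le_mul_right d h6
    omega
  have h10 : D * (4 * B.card) ≤ D * L.card := Nat.mul_le_mul_left _ hB3
  have h11 : D * (4 * E.card) ≤ D * L.card := Nat.mul_le_mul_left _ hE
  have h12 : (10 * d + 4 * (k + 1)) * L.card ≤ D * L.card := Nat.mul_le_mul_right _ (by omega)
  nlinarith

theorem card_conj_conj_le {W : Finset (NullRay K)} {k : ℕ} (ht : (W.image t).card ≤ k)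
    (ha : (W.image a).card ≤ k) {r r' : NullRay K} (h : r ≠ r') :
    (W.filter fun u => u.Conj r ∧ u.Conj r').card ≤ k := by
  have key : ∀ u ∈ W.filter fun u => u.Conj r ∧ u.Conj r',
      u ∈ W ∧ u.g - r.g = r.t * u.a - u.t * r.a ∧ u.g - r'.g = r'.t * u.a - u.t * r'.a :=
    fun u hu => Finset.mem_filter.1 hu
  by_cases h1 : r.t = r'.t
  · by_cases h2 : r.a = r'.a
    · rcases (W.filter fun u => u.Conj r ∧ u.Conj r').eq_empty_or_nonempty with h0 | ⟨u, hu⟩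
      · rw [h0]
        exact Nat.zero_le _
      · obtain ⟨-, h3, h4⟩ := key u hu
        refine absurd (NullRay.ext h1 h2 ?_) h
        rw [h1, h2] at h3
        linear_combination h4 - h3
    · refine le_trans (Finset.card_le_card_of_injOn a
        (fun u hu => Finset.mem_image_of_mem a (key u hu).1) ?_) ha
      intro u hu u' hu' huu
      obtain ⟨-, h3, h4⟩ := key u hu
      obtain ⟨-, h5, h6⟩ := key u' hu'
      rw [h1] at h3 h5
      have h7 : u.t = u'.t := by
        apply mul_left_cancel₀ (sub_ne_zero.2 h2)
        linear_combination h3 - h4 - h5 + h6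
      refine NullRay.ext h7 huu ?_
      rw [h7, huu] at h3
      linear_combination h3 - h5
  · refine le_trans (Finset.card_le_card_of_injOn t
      (fun u hu => Finset.mem_image_of_mem t (key u hu).1) ?_) ht
    intro u hu u' hu' huu
    obtain ⟨-, h3, h4⟩ := key u hu
    obtain ⟨-, h5, h6⟩ := key u' hu'
    rw [huu] at h3 h4
    have h7 : u.a = u'.a := by
      apply mul_left_cancel₀ (sub_ne_zero.2 h1)
      linear_combination h4 - h3 - h6 + h5
    refine NullRay.ext huu h7 ?_
    rw [h7] at h3
    linear_combination h3 - h5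

theorem isConfig_union {V W : Finset (NullRay K)} {k : ℕ}
    (hV : ∀ r ∈ V, ∀ r' ∈ V, r.Conj r' → r = r') (hW : ∀ r ∈ W, ∀ r' ∈ W, r.Conj r' → r = r')
    (hVW : ∀ r ∈ V, ∀ r' ∈ W, r.t ≠ r'.t) (hVt : (V.image t).card ≤ k)
    (hVa : (V.image a).card ≤ k) (hWt : (W.image t).card ≤ k) (hWa : (W.image a).card ≤ k) :
    IsConfig (V ∪ W) (fun r => decide (r ∈ V)) k where
  color_ne r hr r' hr' hne hc := by
    rcases Finset.mem_union.1 hr with h | h <;> rcases Finset.mem_union.1 hr' with h' | h'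
    · exact absurd (hV r h r' h' hc) hne
    · have : r' ∉ V := fun h1 => hVW r' h1 r' h' rfl
      simp [h, this]
    · have : r ∉ V := fun h1 => hVW r h1 r h rfl
      simp [h', this]
    · exact absurd (hW r h r' h' hc) hne
  slope_ne r hr r' hr' hne hc := by
    rcases Finset.mem_union.1 hr with h | h <;> rcases Finset.mem_union.1 hr' with h' | h'
    · exact absurd (hV r h r' h' hc) hne
    · exact hVW r h r' h'
    · exact (hVW r' h' r h).symm
    · exact absurd (hW r h r' h' hc) hne
  card_le r hr r' hr' hne hχ := by
    by_cases h : r ∈ V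
    · have h' : r' ∈ V := by simpa [h] using hχ
      refine le_trans (Finset.card_le_card fun u hu => ?_) (card_conj_conj_le hWt hWa hne)
      rw [Finset.mem_filter, Finset.mem_union] at hu
      refine Finset.mem_filter.2 ⟨hu.1.resolve_left fun hu' => hne ?_, hu.2⟩
      exact (hV u hu' r h hu.2.1).symm.trans (hV u hu' r' h' hu.2.2)
    · have h' : r' ∉ V := by simpa [h] using hχ
      replace h := (Finset.mem_union.1 hr).resolve_left h
      replace h' := (Finset.mem_union.1 hr').resolve_left h'
      refine le_trans (Finset.card_le_card fun u hu => ?_) (card_conj_conj_le hVt hVa hne)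
      rw [Finset.mem_filter, Finset.mem_union] at hu
      refine Finset.mem_filter.2 ⟨hu.1.resolve_right fun hu' => hne ?_, hu.2⟩
      exact (hW u hu' r h hu.2.1).symm.trans (hW u hu' r' h' hu.2.2)

theorem exists_forall_eval_ne_zero [Infinite K] (S : Finset (Polynomial K))
    (hS : ∀ p ∈ S, p ≠ 0) : ∃ θ : K, ∀ p ∈ S, p.eval θ ≠ 0 := by
  obtain ⟨θ, hθ⟩ := Infinite.exists_notMem_finset (S.biUnion fun p => p.roots.toFinset)
  refine ⟨θ, fun p hp h => hθ (Finset.mem_biUnion.2 ⟨p, hp, ?_⟩)⟩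
  rw [Multiset.mem_toFinset, Polynomial.mem_roots (hS p hp)]
  exact h

/-- The first family of rays encoding the equation `x y + z = x' y' + z'`. -/
def rayOut (θ : K) (q : K × K × K) : NullRay K :=
  ⟨q.1, q.2.1, q.2.2 + θ * q.1 + θ ^ 2 * q.2.1⟩

/-- The second family of rays encoding the equation `x y + z = x' y' + z'`. -/
def rayIn (θ : K) (q : K × K × K) : NullRay K := ⟨θ ^ 2 - q.1, -q.2.1 - θ, q.2.2⟩

theorem rayOut_conj_rayIn (θ x y z x' y' z' : K) :
    (rayOut θ (x, y', z')).Conj (rayIn θ (x', y, z)) ↔ x * y + z = x' * y' + z' := by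
  simp only [Conj, rayOut, rayIn]
  constructor <;> intro h <;> linear_combination -h

theorem rayOut_conj_iff (θ : K) (q q' : K × K × K) : (rayOut θ q).Conj (rayOut θ q') ↔
    (q.2.2 - q'.2.2 + (q.1 * q'.2.1 - q'.1 * q.2.1)) + (q.1 - q'.1) * θ +
      (q.2.1 - q'.2.1) * θ ^ 2 = 0 := by
  simp only [Conj, rayOut]
  constructor <;> intro h <;> linear_combination h

theorem rayIn_conj_iff (θ : K) (q q' : K × K × K) : (rayIn θ q).Conj (rayIn θ q') ↔
    (q.2.2 - q'.2.2 + (q.1 * q'.2.1 - q'.1 * q.2.1)) + (q.1 - q'.1) * θ +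
      (q.2.1 - q'.2.1) * θ ^ 2 = 0 := by
  simp only [Conj, rayIn]
  constructor <;> intro h <;> linear_combination h

theorem coeffs_eq_zero {x y z : K} (h : Polynomial.C x + Polynomial.C y * Polynomial.X +
    Polynomial.C z * Polynomial.X ^ 2 = 0) : x = 0 ∧ y = 0 ∧ z = 0 := by
  have c0 := congrArg (fun r => Polynomial.coeff r 0) h
  have c1 := congrArg (fun r => Polynomial.coeff r 1) h
  have c2 := congrArg (fun r => Polynomial.coeff r 2) h
  simp [Polynomial.coeff_X, Polynomial.coeff_C, Polynomial.coeff_X_pow] at c0 c1 c2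
  exact ⟨c0, c1, c2⟩

theorem exists_generic [Infinite K] (Q : Finset (K × K × K)) :
    ∃ θ : K, (∀ q ∈ Q, ∀ q' ∈ Q, (q.2.2 - q'.2.2 + (q.1 * q'.2.1 - q'.1 * q.2.1)) +
      (q.1 - q'.1) * θ + (q.2.1 - q'.2.1) * θ ^ 2 = 0 → q = q') ∧
      ∀ q ∈ Q, ∀ q' ∈ Q, q.1 ≠ θ ^ 2 - q'.1 := by
  let p : (K × K × K) × (K × K × K) → Polynomial K := fun q =>
    Polynomial.C (q.1.2.2 - q.2.2.2 + (q.1.1 * q.2.2.1 - q.2.1 * q.1.2.1)) +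
      Polynomial.C (q.1.1 - q.2.1) * Polynomial.X +
      Polynomial.C (q.1.2.1 - q.2.2.1) * Polynomial.X ^ 2
  let p' : (K × K × K) × (K × K × K) → Polynomial K := fun q =>
    Polynomial.X ^ 2 - Polynomial.C (q.1.1 + q.2.1)
  obtain ⟨θ, hθ⟩ := exists_forall_eval_ne_zero
    (((Q ×ˢ Q).filter fun q => q.1 ≠ q.2).image p ∪ (Q ×ˢ Q).image p') (by
      intro r hr
      rcases Finset.mem_union.1 hr with hr | hr
      · obtain ⟨⟨q, q'⟩, hq, rfl⟩ := Finset.mem_image.1 hr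
        intro h0
        refine (Finset.mem_filter.1 hq).2 ?_
        obtain ⟨c0, c1, c2⟩ := coeffs_eq_zero h0
        have e1 := sub_eq_zero.1 c1
        have e2 := sub_eq_zero.1 c2
        rw [e1, e2, sub_self, add_zero, sub_eq_zero] at c0
        exact Prod.ext e1 (Prod.ext e2 c0)
      · obtain ⟨q, hq, rfl⟩ := Finset.mem_image.1 hr
        exact Polynomial.X_pow_sub_C_ne_zero two_pos _)
  refine ⟨θ, fun q hq q' hq' h => ?_, fun q hq q' hq' h => ?_⟩
  · by_contra hne
    refine hθ (p (q, q')) (Finset.mem_union_left _ (Finset.mem_image_of_mem _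
      (Finset.mem_filter.2 ⟨Finset.mem_product.2 ⟨hq, hq'⟩, hne⟩))) ?_
    simpa [p] using h
  · refine hθ (p' (q, q')) (Finset.mem_union_right _ (Finset.mem_image_of_mem _
      (Finset.mem_product.2 ⟨hq, hq'⟩))) ?_
    simp [p', h]

/-- A bound for the number of solutions of `x y + z = x' y' + z'`. -/
theorem sq_card_collisions_le [Infinite K] {X : Finset K} {M : Finset (K × K)} {N k : ℕ}
    (hN : X.card * M.card ≤ N) (hX : X.card ≤ k) (hM : (M.image Prod.fst).card ≤ k)
    (hk : k ^ 2 ≤ N) (hfac : (((2 * N).sqrt.factorial : ℕ) : K) ≠ 0)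
    {G : Finset (K × K × K)} (hG : ∀ g ∈ G, g.1 ∈ X ∧ g.2 ∈ M) :
    ((G ×ˢ G).filter fun g => g.1.1 * g.1.2.1 + g.1.2.2 = g.2.1 * g.2.2.1 + g.2.2.2).card ^ 2 ≤
      40000000 * N ^ 3 := by
  obtain ⟨θ, hθ, hθ'⟩ := exists_generic (X ×ˢ M)
  let V := (X ×ˢ M).image (rayOut θ)
  let W := (X ×ˢ M).image (rayIn θ)
  have hV : ∀ r ∈ V, ∀ r' ∈ V, r.Conj r' → r = r' := by
    intro r hr r' hr' h
    obtain ⟨q, hq, rfl⟩ := Finset.mem_image.1 hr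
    obtain ⟨q', hq', rfl⟩ := Finset.mem_image.1 hr'
    rw [hθ q hq q' hq' ((rayOut_conj_iff θ q q').1 h)]
  have hW : ∀ r ∈ W, ∀ r' ∈ W, r.Conj r' → r = r' := by
    intro r hr r' hr' h
    obtain ⟨q, hq, rfl⟩ := Finset.mem_image.1 hr
    obtain ⟨q', hq', rfl⟩ := Finset.mem_image.1 hr'
    rw [hθ q hq q' hq' ((rayIn_conj_iff θ q q').1 h)]
  have hVW : ∀ r ∈ V, ∀ r' ∈ W, r.t ≠ r'.t := by
    intro r hr r' hr'
    obtain ⟨q, hq, rfl⟩ := Finset.mem_image.1 hr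
    obtain ⟨q', hq', rfl⟩ := Finset.mem_image.1 hr'
    exact hθ' q hq q' hq'
  have himage : ∀ (ρ : K × K × K → NullRay K) (π : NullRay K → K) (τ : K → K) (Y : Finset K)
      (σ : K × K × K → K), (∀ q, π (ρ q) = τ (σ q)) → (∀ q ∈ X ×ˢ M, σ q ∈ Y) → Y.card ≤ k →
      (((X ×ˢ M).image ρ).image π).card ≤ k := by
    intro ρ π τ Y σ h1 h2 h3
    refine le_trans (le_trans (Finset.card_le_card (t := Y.image τ) ?_) Finset.card_image_le) h3
    rw [Finset.image_image]
    intro y hy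
    obtain ⟨q, hq, rfl⟩ := Finset.mem_image.1 hy
    rw [Function.comp_apply, h1]
    exact Finset.mem_image_of_mem _ (h2 q hq)
  have hσ1 : ∀ q ∈ X ×ˢ M, q.1 ∈ X := fun q hq => (Finset.mem_product.1 hq).1
  have hσ2 : ∀ q ∈ X ×ˢ M, q.2.1 ∈ M.image Prod.fst := fun q hq =>
    Finset.mem_image_of_mem _ (Finset.mem_product.1 hq).2
  have hU : IsConfig (V ∪ W) (fun r => decide (r ∈ V)) k := isConfig_union hV hW hVW
    (himage _ t id X (fun q => q.1) (fun _ => rfl) hσ1 hX)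
    (himage _ a id _ (fun q => q.2.1) (fun _ => rfl) hσ2 hM)
    (himage _ t (fun x => θ ^ 2 - x) X (fun q => q.1) (fun _ => rfl) hσ1 hX)
    (himage _ a (fun y => -y - θ) _ (fun q => q.2.1) (fun _ => rfl) hσ2 hM)
  have hUcard : (V ∪ W).card ≤ 2 * N := by
    have h1 := Finset.card_union_le V W
    have h2 : V.card ≤ (X ×ˢ M).card := Finset.card_image_le
    have h3 : W.card ≤ (X ×ˢ M).card := Finset.card_image_le
    rw [Finset.card_product] at h2 h3
    omega
  have hfac' : (((V ∪ W).card.sqrt.factorial : ℕ) : K) ≠ 0 := by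
    intro h0
    obtain ⟨c, hc⟩ := Nat.factorial_dvd_factorial (Nat.sqrt_le_sqrt hUcard)
    apply hfac
    rw [hc, Nat.cast_mul, h0, zero_mul]
  have hedges := edges_le_mul_card hU hfac' (V ∪ W) subset_rfl
  have hT : ((G ×ˢ G).filter fun g =>
      g.1.1 * g.1.2.1 + g.1.2.2 = g.2.1 * g.2.2.1 + g.2.2.2).card ≤ edges (V ∪ W) := by
    unfold edges
    rw [← Finset.card_sigma]
    refine Finset.card_le_card_of_injOn
      (fun g => ⟨rayOut θ (g.1.1, g.2.2), rayIn θ (g.2.1, g.1.2)⟩) ?_ ?_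
    · intro g hg
      rw [Finset.mem_coe, Finset.mem_filter, Finset.mem_product] at hg
      have h1 := hG _ hg.1.1
      have h2 := hG _ hg.1.2
      have hv : rayOut θ (g.1.1, g.2.2) ∈ V :=
        Finset.mem_image_of_mem _ (Finset.mem_product.2 ⟨h1.1, h2.2⟩)
      have hw : rayIn θ (g.2.1, g.1.2) ∈ W :=
        Finset.mem_image_of_mem _ (Finset.mem_product.2 ⟨h2.1, h1.2⟩)
      rw [Finset.mem_coe, Finset.mem_sigma, mem_nbhd]
      exact ⟨Finset.mem_union_left _ hv, Finset.mem_union_right _ hw,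
        fun h => hVW _ hv _ hw (congrArg t h), (rayOut_conj_rayIn ..).2 hg.2⟩
    · rintro ⟨⟨x, y, z⟩, ⟨x', y', z'⟩⟩ _ ⟨⟨u, v, w⟩, ⟨u', v', w'⟩⟩ _ h
      simp only [Sigma.mk.injEq, heq_eq_eq, rayOut, rayIn, NullRay.mk.injEq] at h
      obtain ⟨⟨rfl, rfl, h1⟩, h2, h3, rfl⟩ := h
      have h4 : x' = u' := by linear_combination -h2
      have h5 : y = v := by linear_combination -h3
      have h6 : z' = w' := by linear_combination h1
      rw [h4, h5, h6]
  set s := (V ∪ W).card.sqrt with hs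
  have hs2 : s ^ 2 ≤ 2 * N := (Nat.sqrt_le' _).trans hUcard
  rcases Nat.eq_zero_or_pos N with rfl | hNpos
  · have h0 : (V ∪ W).card = 0 := by omega
    rw [h0, mul_zero] at hedges
    simp [Nat.le_zero.1 (hT.trans hedges)]
  have hT2 := (hT.trans hedges).trans (Nat.mul_le_mul_left _ hUcard)
  have h1 : (500 * s + 504 + 4 * k) ^ 2 ≤ 2500000 * N := by
    zify at hs2 hk hNpos ⊢
    nlinarith [sq_nonneg ((500 : ℤ) * s - 504), sq_nonneg ((500 : ℤ) * s - 4 * k),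
      sq_nonneg ((504 : ℤ) - 4 * k)]
  calc _ ≤ (2 * (500 * (s + 1) + 4 * k + 4) * (2 * N)) ^ 2 := Nat.pow_le_pow_left hT2 2
    _ = 16 * N ^ 2 * (500 * s + 504 + 4 * k) ^ 2 := by ring
    _ ≤ 16 * N ^ 2 * (2500000 * N) := Nat.mul_le_mul_left _ h1
    _ = _ := by ring

theorem card_pow_four_le [Infinite K] {X S : Finset K} {M : Finset (K × K)} {N k : ℕ}
    (hN : X.card * M.card ≤ N) (hX : X.card ≤ k) (hM : (M.image Prod.fst).card ≤ k)
    (hk : k ^ 2 ≤ N) (hfac : (((2 * N).sqrt.factorial : ℕ) : K) ≠ 0)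
    {G : Finset (K × K × K)} (hG : ∀ g ∈ G, g.1 ∈ X ∧ g.2 ∈ M)
    (hS : ∀ g ∈ G, g.1 * g.2.1 + g.2.2 ∈ S) :
    G.card ^ 4 ≤ 40000000 * S.card ^ 2 * N ^ 3 := by
  have hT := sq_card_collisions_le hN hX hM hk hfac hG
  set T := (G ×ˢ G).filter fun g => g.1.1 * g.1.2.1 + g.1.2.2 = g.2.1 * g.2.2.1 + g.2.2.2
    with hTdef
  have h1 := Finset.card_eq_sum_card_fiberwise (f := fun g : K × K × K => g.1 * g.2.1 + g.2.2)
    (s := G) (t := S) hS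
  have h2 := Finset.card_eq_sum_card_fiberwise
    (f := fun g : (K × K × K) × (K × K × K) => g.1.1 * g.1.2.1 + g.1.2.2) (s := T) (t := S)
    (fun g hg => hS _ (Finset.mem_product.1 (Finset.mem_filter.1 hg).1).1)
  have h3 : G.card ^ 2 ≤ S.card * T.card := by
    rw [h1, h2]
    refine sq_sum_le_card_mul_sum_sq.trans (Nat.mul_le_mul_left _ (Finset.sum_le_sum ?_))
    intro s _
    rw [sq, ← Finset.card_product]
    refine Finset.card_le_card fun g hg => ?_
    simp only [Finset.mem_product, Finset.mem_filter, hTdef] at hg ⊢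
    exact ⟨⟨⟨hg.1.1, hg.2.1⟩, hg.1.2.trans hg.2.2.symm⟩, hg.1.2⟩
  calc G.card ^ 4 = (G.card ^ 2) ^ 2 := by ring
    _ ≤ (S.card * T.card) ^ 2 := Nat.pow_le_pow_left h3 2
    _ = S.card ^ 2 * T.card ^ 2 := by ring
    _ ≤ S.card ^ 2 * (40000000 * N ^ 3) := Nat.mul_le_mul_left _ hT
    _ = _ := by ring

theorem card_pow_six_le_of_add [Infinite K] {B : Finset K} (h0 : (0 : K) ∉ B) (hB : B.Nonempty)
    (hfac : (((2 * ((B * B).card * B.card ^ 2)).sqrt.factorial : ℕ) : K) ≠ 0) :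
    B.card ^ 6 ≤ 40000000 * (B + B).card ^ 2 * (B * B).card ^ 3 := by
  have hne : ∀ b ∈ B, b ≠ 0 := fun b hb h => h0 (h ▸ hb)
  let M := (B ×ˢ B).image fun q => (q.1⁻¹, q.2)
  let G := (B ×ˢ B ×ˢ B).image fun q => (q.1 * q.2.1, (q.2.1⁻¹, q.2.2))
  have hM1 : M.card ≤ B.card ^ 2 := by
    refine Finset.card_image_le.trans ?_
    rw [Finset.card_product, sq]
  have hM2 : (M.image Prod.fst).card ≤ (B * B).card := by
    refine le_trans (le_trans (Finset.card_le_card (t := B.image fun b => b⁻¹) ?_)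
      Finset.card_image_le) (Finset.card_le_card_mul_right₀ hB.choose_spec
        (hne _ hB.choose_spec))
    intro x hx
    obtain ⟨q, hq, rfl⟩ := Finset.mem_image.1 hx
    obtain ⟨b, hb, rfl⟩ := Finset.mem_image.1 hq
    exact Finset.mem_image_of_mem _ (Finset.mem_product.1 hb).1
  have hG : G.card = B.card ^ 3 := by
    rw [Finset.card_image_of_injOn, Finset.card_product, Finset.card_product]
    · ring
    · rintro ⟨a, b, c⟩ hq ⟨a', b', c'⟩ - h
      simp only [Finset.coe_product, Set.mem_prod, Finset.mem_coe] at hq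
      simp only [Prod.mk.injEq, inv_inj] at h
      obtain ⟨h1, rfl, rfl⟩ := h
      rw [mul_right_cancel₀ (hne b hq.2.1) h1]
  have h := card_pow_four_le (X := B * B) (M := M) (S := B + B) (G := G)
    (N := (B * B).card * B.card ^ 2) (k := (B * B).card) (Nat.mul_le_mul_left _ hM1) le_rfl hM2
    (by rw [sq]; exact Nat.mul_le_mul_left _ (by rw [sq]; exact Finset.card_mul_le)) hfac
    (by
      intro g hg
      obtain ⟨q, hq, rfl⟩ := Finset.mem_image.1 hg
      simp only [Finset.mem_product] at hq
      exact ⟨Finset.mul_mem_mul hq.1 hq.2.1, Finset.mem_image.2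
        ⟨q.2, Finset.mem_product.2 hq.2, rfl⟩⟩)
    (by
      intro g hg
      obtain ⟨q, hq, rfl⟩ := Finset.mem_image.1 hg
      simp only [Finset.mem_product] at hq
      rw [mul_inv_cancel_right₀ (hne _ hq.2.1)]
      exact Finset.add_mem_add hq.1 hq.2.2)
  rw [hG] at h
  refine Nat.le_of_mul_le_mul_right ?_ (pow_pos hB.card_pos 6)
  calc B.card ^ 6 * B.card ^ 6 = (B.card ^ 3) ^ 4 := by ring
    _ ≤ _ := h
    _ = _ := by ring

theorem card_pow_six_le_of_mul [Infinite K] {B : Finset K} (h0 : (0 : K) ∉ B) (hB : B.Nonempty)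
    (hfac : (((2 * ((B + B).card * B.card ^ 2)).sqrt.factorial : ℕ) : K) ≠ 0) :
    B.card ^ 6 ≤ 40000000 * (B * B).card ^ 2 * (B + B).card ^ 3 := by
  have hne : ∀ b ∈ B, b ≠ 0 := fun b hb h => h0 (h ▸ hb)
  let M := (B ×ˢ B).image fun q => (q.1, -(q.1 * q.2))
  let G := (B ×ˢ B ×ˢ B).image fun q => (q.1 + q.2.2, (q.2.1, -(q.2.1 * q.2.2)))
  have hM1 : M.card ≤ B.card ^ 2 := by
    refine Finset.card_image_le.trans ?_
    rw [Finset.card_product, sq]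
  have hM2 : (M.image Prod.fst).card ≤ (B + B).card := by
    refine le_trans (Finset.card_le_card (t := B) ?_) (Finset.card_le_card_add_right hB)
    intro x hx
    obtain ⟨q, hq, rfl⟩ := Finset.mem_image.1 hx
    obtain ⟨b, hb, rfl⟩ := Finset.mem_image.1 hq
    exact (Finset.mem_product.1 hb).1
  have hG : G.card = B.card ^ 3 := by
    rw [Finset.card_image_of_injOn, Finset.card_product, Finset.card_product]
    · ring
    · rintro ⟨a, b, c⟩ hq ⟨a', b', c'⟩ - h
      simp only [Finset.coe_product, Set.mem_prod, Finset.mem_coe] at hq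
      simp only [Prod.mk.injEq, neg_inj] at h
      obtain ⟨h1, rfl, h2⟩ := h
      obtain rfl := mul_left_cancel₀ (hne b hq.2.1) h2
      rw [add_right_cancel h1]
  have h := card_pow_four_le (X := B + B) (M := M) (S := B * B) (G := G)
    (N := (B + B).card * B.card ^ 2) (k := (B + B).card) (Nat.mul_le_mul_left _ hM1) le_rfl hM2
    (by rw [sq]; exact Nat.mul_le_mul_left _ (by rw [sq]; exact Finset.card_add_le)) hfac
    (by
      intro g hg
      obtain ⟨q, hq, rfl⟩ := Finset.mem_image.1 hg
      simp only [Finset.mem_product] at hq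
      exact ⟨Finset.add_mem_add hq.1 hq.2.2, Finset.mem_image.2
        ⟨q.2, Finset.mem_product.2 hq.2, rfl⟩⟩)
    (by
      intro g hg
      obtain ⟨q, hq, rfl⟩ := Finset.mem_image.1 hg
      simp only [Finset.mem_product] at hq
      have : (q.1 + q.2.2) * q.2.1 + -(q.2.1 * q.2.2) = q.1 * q.2.1 := by ring
      rw [this]
      exact Finset.mul_mem_mul hq.1 hq.2.1)
  rw [hG] at h
  refine Nat.le_of_mul_le_mul_right ?_ (pow_pos hB.card_pos 6)
  calc B.card ^ 6 * B.card ^ 6 = (B.card ^ 3) ^ 4 := by ring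
    _ ≤ _ := h
    _ = _ := by ring

theorem natCast_factorial_ne_zero {K : Type*} [Field K] {n : ℕ}
    (h : ∀ p : ℕ, p.Prime → CharP K p → n < p) : ((n.factorial : ℕ) : K) ≠ 0 := by
  obtain ⟨p, hp⟩ := CharP.exists K
  rw [Ne, CharP.cast_eq_zero_iff K p]
  rcases CharP.char_is_prime_or_zero K p with h1 | rfl
  · rw [h1.dvd_factorial, not_le]
    exact h p h1 hp
  · rw [zero_dvd_iff]
    exact n.factorial_ne_zero

theorem sqrt_lt_of_pow_le {x n p : ℕ} (hx : x ^ 5 < n ^ 6) (hp : 256 * n ^ 8 ≤ p ^ 5) :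
    (2 * (x * n ^ 2)).sqrt < p := by
  rw [Nat.sqrt_lt']
  refine lt_of_pow_lt_pow_left₀ 5 (Nat.zero_le _) ?_
  have hn : 0 < n := by
    rcases Nat.eq_zero_or_pos n with rfl | h
    · simp at hx
    · exact h
  calc (2 * (x * n ^ 2)) ^ 5 = 32 * n ^ 10 * x ^ 5 := by ring
    _ < 32 * n ^ 10 * n ^ 6 := Nat.mul_lt_mul_of_pos_left hx (by positivity)
    _ ≤ (256 * n ^ 8) ^ 2 := by
      ring_nf
      omega
    _ ≤ (p ^ 5) ^ 2 := Nat.pow_le_pow_left hp 2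
    _ = (p ^ 2) ^ 5 := by ring

theorem card_pow_six_le {F : Type*} [Field F] {A : Finset F} (hA : A.Nonempty)
    (hp : ∀ p : ℕ, p.Prime → CharP F p → 256 * A.card ^ 8 ≤ p ^ 5) :
    A.card ^ 6 ≤ 2560000000 *
      (min (A + A).card (A * A).card ^ 3 * max (A + A).card (A * A).card ^ 2) := by
  have hs : 0 < (A + A).card := (hA.add hA).card_pos
  have hm : 0 < (A * A).card := (hA.mul hA).card_pos
  have hmin : 0 < min (A + A).card (A * A).card := lt_min hs hm
  rcases le_or_gt (A.card ^ 6) (min (A + A).card (A * A).card ^ 5) with h | h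
  · calc A.card ^ 6 ≤ min (A + A).card (A * A).card ^ 3 * min (A + A).card (A * A).card ^ 2 := by
          rwa [← pow_add]
      _ ≤ min (A + A).card (A * A).card ^ 3 * max (A + A).card (A * A).card ^ 2 :=
          Nat.mul_le_mul_left _ (Nat.pow_le_pow_left min_le_max 2)
      _ ≤ _ := Nat.le_mul_of_pos_left _ (by norm_num)
  have hA2 : 2 ≤ A.card := by
    by_contra h2
    have h3 : A.card ≤ 1 := by omega
    exact absurd (h.trans_le (Nat.pow_le_pow_left h3 6)) (by
      rw [one_pow, not_lt]
      exact Nat.one_le_pow _ _ hmin)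
  let φ := algebraMap F (AlgebraicClosure F)
  have hφ : Function.Injective φ := φ.injective
  let B := (A.erase 0).image φ
  have hBA : B ⊆ A.image φ := Finset.image_subset_image (Finset.erase_subset _ _)
  have hBcard : B.card = (A.erase 0).card := Finset.card_image_of_injective _ hφ
  have hB1 : B.card ≤ A.card := hBcard ▸ Finset.card_erase_le
  have hB2 : A.card ≤ 2 * B.card := by
    have := Finset.pred_card_le_card_erase (s := A) (a := 0)
    omega
  have hB : B.Nonempty := Finset.card_pos.1 (by omega)
  have h0 : (0 : AlgebraicClosure F) ∉ B := by
    intro h0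
    obtain ⟨a, ha, ha0⟩ := Finset.mem_image.1 h0
    exact (Finset.mem_erase.1 ha).1 ((map_eq_zero φ).1 ha0)
  have hadd : (B + B).card ≤ (A + A).card := by
    refine (Finset.card_le_card (Finset.add_subset_add hBA hBA)).trans ?_
    rw [← Finset.image_add]
    exact Finset.card_image_le
  have hmul : (B * B).card ≤ (A * A).card := by
    refine (Finset.card_le_card (Finset.mul_subset_mul hBA hBA)).trans ?_
    rw [← Finset.image_mul]
    exact Finset.card_image_le
  have hfac : ∀ x ≤ min (A + A).card (A * A).card,
      (((2 * (x * B.card ^ 2)).sqrt.factorial : ℕ) : AlgebraicClosure F) ≠ 0 := by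
    intro x hx
    refine natCast_factorial_ne_zero fun p h1 h2 => ?_
    refine lt_of_le_of_lt (Nat.sqrt_le_sqrt ?_) (sqrt_lt_of_pow_le h
      (hp p h1 ((RingHom.charP_iff φ hφ p).2 h2)))
    gcongr
  have hfin : ∀ {x y x' y' : ℕ}, B.card ^ 6 ≤ 40000000 * y ^ 2 * x ^ 3 → x ≤ x' → y ≤ y' →
      A.card ^ 6 ≤ 2560000000 * (x' ^ 3 * y' ^ 2) := by
    intro x y x' y' h1 hx hy
    calc A.card ^ 6 ≤ (2 * B.card) ^ 6 := Nat.pow_le_pow_left hB2 6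
      _ = 64 * B.card ^ 6 := by ring
      _ ≤ 64 * (40000000 * y ^ 2 * x ^ 3) := Nat.mul_le_mul_left _ h1
      _ ≤ 64 * (40000000 * y' ^ 2 * x' ^ 3) := by gcongr
      _ = _ := by ring
  rcases le_total (A + A).card (A * A).card with hle | hle
  · rw [min_eq_left hle] at hfac ⊢
    rw [max_eq_right hle]
    exact hfin (card_pow_six_le_of_mul h0 hB (hfac _ hadd)) hadd hmul
  · rw [min_eq_right hle] at hfac ⊢
    rw [max_eq_left hle]
    exact hfin (card_pow_six_le_of_add h0 hB (hfac _ hmul)) hmul hadd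

end NullRay

theorem stmt_7 :
    ∃ c C : ℝ, 0 < c ∧ 0 < C ∧
      ∀ (F : Type) [Field F] (A : Finset F), A.Nonempty →
        (∀ p : ℕ, p.Prime → CharP F p → (A.card : ℝ) ≤ c * (p : ℝ) ^ ((5 : ℝ) / 8)) →
        C * (A.card : ℝ) ^ 6 ≤
            (min ((A + A).card : ℝ) ((A * A).card : ℝ)) ^ 3 *
              (max ((A + A).card : ℝ) ((A * A).card : ℝ)) ^ 2 ∧
          C * (A.card : ℝ) ^ 6 ≤ ((A + A).card : ℝ) ^ 3 * ((A * A).card : ℝ) ^ 2 ∧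
          C * (A.card : ℝ) ^ 6 ≤ ((A + A).card : ℝ) ^ 2 * ((A * A).card : ℝ) ^ 3 := by
  refine ⟨1 / 2, 1 / 2560000000, by norm_num, by norm_num, fun F _ A hA hp => ?_⟩
  have hp' : ∀ p : ℕ, p.Prime → CharP F p → 256 * A.card ^ 8 ≤ p ^ 5 := by
    intro p h1 h2
    have h3 := pow_le_pow_left₀ (Nat.cast_nonneg _) (hp p h1 h2) 8
    rw [mul_pow, ← Real.rpow_natCast ((p : ℝ) ^ _), ← Real.rpow_mul (Nat.cast_nonneg _)] at h3
    norm_num at h3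
    have h4 : (256 * (A.card : ℝ) ^ 8) ≤ (p : ℝ) ^ 5 := by linarith
    exact_mod_cast h4
  have key : ((A.card ^ 6 : ℕ) : ℝ) ≤ ((2560000000 * (min (A + A).card (A * A).card ^ 3 *
      max (A + A).card (A * A).card ^ 2) : ℕ) : ℝ) :=
    Nat.cast_le.2 (NullRay.card_pow_six_le hA hp')
  push_cast at key
  have main : 1 / 2560000000 * (A.card : ℝ) ^ 6 ≤
      (min ((A + A).card : ℝ) ((A * A).card : ℝ)) ^ 3 *
        (max ((A + A).card : ℝ) ((A * A).card : ℝ)) ^ 2 := by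
    linarith
  have hs : (0 : ℝ) ≤ ((A + A).card : ℝ) := Nat.cast_nonneg _
  have hm : (0 : ℝ) ≤ ((A * A).card : ℝ) := Nat.cast_nonneg _
  have hprod : (min ((A + A).card : ℝ) ((A * A).card : ℝ)) ^ 3 *
      (max ((A + A).card : ℝ) ((A * A).card : ℝ)) ^ 2 =
      min ((A + A).card : ℝ) ((A * A).card : ℝ) *
        (((A + A).card : ℝ) * ((A * A).card : ℝ)) ^ 2 := by
    rw [← min_mul_max ((A + A).card : ℝ)]
    ring
  refine ⟨main, main.trans ?_, main.trans ?_⟩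
  · rw [hprod]
    refine (mul_le_mul_of_nonneg_right (min_le_left _ _) (sq_nonneg _)).trans (le_of_eq ?_)
    ring
  · rw [hprod]
    refine (mul_le_mul_of_nonneg_right (min_le_right _ _) (sq_nonneg _)).trans (le_of_eq ?_)
    ring
end

section
/- There exist absolute constants c > 0 and C > 0 such that the following holds. Let F be a field and let A ⊆ F be a finite nonempty set; if F has positive characteristic p, assume |A| ≤ c · p^{5/8}. Then for every real D ≥ 1: if min{|A+A|, |A·A|} ≤ D·|A|, then max{|A+A|, |A·A|} ≥ C · D^{-3/2} · |A|^{3/2}. -/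
open scoped Classical Pointwise

/-- The light ray `x ↦ (x, a x + b, a² x + c)`; its direction `(1, a, a²)` lies on a fixed conic. -/
@[ext]
structure NullLine (K : Type*) where
  a : K
  b : K
  c : K

namespace NullLine

variable {K : Type*} [Field K]

/-- Restriction of a polynomial in three variables to a light ray. -/
noncomputable def restr (l : NullLine K) : MvPolynomial (Fin 3) K →ₐ[K] Polynomial K :=
  MvPolynomial.aeval ![Polynomial.X, Polynomial.C l.a * Polynomial.X + Polynomial.C l.b,
    Polynomial.C (l.a ^ 2) * Polynomial.X + Polynomial.C l.c]

/-- The point of a light ray with first coordinate `x`. -/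
def pt (l : NullLine K) (x : K) : Fin 3 → K := ![x, l.a * x + l.b, l.a ^ 2 * x + l.c]

theorem eval_restr (l : NullLine K) (P : MvPolynomial (Fin 3) K) (x : K) :
    (l.restr P).eval x = MvPolynomial.eval (l.pt x) P := by
  induction P using MvPolynomial.induction_on with
  | C r => simp [restr]
  | add p q hp hq => simp [hp, hq]
  | mul_X p i hp =>
    rw [map_mul, Polynomial.eval_mul, hp, map_mul, MvPolynomial.eval_X]
    congr 1
    fin_cases i <;> simp [restr, pt]

theorem natDegree_restr_le (l : NullLine K) (P : MvPolynomial (Fin 3) K) :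
    (l.restr P).natDegree ≤ P.totalDegree := by
  have := MvPolynomial.aeval_natDegree_le (m := P.totalDegree) (n := 1) P le_rfl
    ![Polynomial.X, Polynomial.C l.a * Polynomial.X + Polynomial.C l.b,
      Polynomial.C (l.a ^ 2) * Polynomial.X + Polynomial.C l.c] (by
        intro i
        fin_cases i
        · simp
        · exact Polynomial.natDegree_linear_le
        · exact Polynomial.natDegree_linear_le)
  simpa [restr] using this

/-- Two light rays have a common point. -/
def Meets (l m : NullLine K) : Prop := ∃ x, l.pt x = m.pt x

end NullLine

theorem card_degree_le (m : ℕ) :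
    Nat.card {s : Fin 3 →₀ ℕ | (s.sum fun _ e => e) ≤ m} = (m + 3).choose 3 := by
  have h1 : {s : Fin 3 →₀ ℕ | (s.sum fun _ e => e) ≤ m} =
      ((Finset.range (m + 1)).biUnion fun n =>
        (Finset.univ : Finset (Fin 3)).finsuppAntidiag n : Finset (Fin 3 →₀ ℕ)) := by
    ext s
    simp [Finset.mem_finsuppAntidiag, Finsupp.sum_fintype]
  rw [h1, Nat.card_coe_set_eq, Set.ncard_coe_finset, Finset.card_biUnion]
  · simp only [Finset.card_finsuppAntidiag_nat_eq_choose, Finset.card_univ, Fintype.card_fin]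
    induction m with
    | zero => simp
    | succ k ih =>
      rw [Finset.sum_range_succ, ih (by ext s; simp [Finset.mem_finsuppAntidiag, Finsupp.sum_fintype])]
      have : (3 + (k + 1) - 1).choose (k + 1) = (k + 3).choose 2 := by
        rw [show 3 + (k + 1) - 1 = k + 3 by omega, ← Nat.choose_symm (by omega)]
        congr 1
        omega
      rw [this, show k + 1 + 3 = (k + 3) + 1 by ring, Nat.choose_succ_succ' (k+3) 2]
      ring
  · intro i _ j _ hij
    refine Finset.disjoint_left.mpr fun s hs hs' => hij ?_
    simp [Finset.mem_finsuppAntidiag] at hs hs'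
    omega

theorem finrank_restrictTotalDegree (K : Type*) [Field K] (m : ℕ) :
    Module.finrank K (MvPolynomial.restrictTotalDegree (Fin 3) K m) = (m + 3).choose 3 := by
  rw [← card_degree_le m]
  exact Module.finrank_eq_nat_card_basis (MvPolynomial.basisRestrictSupport K _)

theorem six_mul_choose_three (m : ℕ) : 6 * (m + 3).choose 3 = (m + 1) * (m + 2) * (m + 3) := by
  induction m with
  | zero => rfl
  | succ k ih =>
    rw [show k + 1 + 3 = (k + 3) + 1 by ring, Nat.choose_succ_succ' (k+3) 2, mul_add, ih,
      Nat.choose_two_right]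
    have h2 : 2 ∣ (k+3) * (k + 3 - 1) := (Nat.even_mul_pred_self (k+3)).two_dvd
    obtain ⟨t, ht⟩ := h2
    rw [ht, Nat.mul_div_cancel_left _ (by norm_num)]
    simp at ht
    nlinarith

theorem exists_vanishing {K : Type*} [Field K] (R : Finset (NullLine K)) (d : ℕ)
    (h : 6 * R.card < (d + 2) * (d + 3)) :
    ∃ P : MvPolynomial (Fin 3) K, P ≠ 0 ∧ P.totalDegree ≤ d ∧ ∀ l ∈ R, l.restr P = 0 := by
  let f : MvPolynomial.restrictTotalDegree (Fin 3) K d →ₗ[K]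
      (R → Polynomial.degreeLT K (d + 1)) :=
    LinearMap.pi fun l => LinearMap.codRestrict _
      (l.1.restr.toLinearMap ∘ₗ (MvPolynomial.restrictTotalDegree (Fin 3) K d).subtype) (by
        intro P
        have hP := (MvPolynomial.mem_restrictTotalDegree _ _ _).1 P.2
        rw [Polynomial.mem_degreeLT]
        refine lt_of_le_of_lt Polynomial.degree_le_natDegree ?_
        have := l.1.natDegree_restr_le P.1
        simp only [LinearMap.comp_apply, AlgHom.toLinearMap_apply, Submodule.subtype_apply]
        exact_mod_cast Nat.lt_succ_of_le (this.trans hP))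
  have hfr : Module.finrank K (R → Polynomial.degreeLT K (d + 1)) = R.card * (d + 1) := by
    rw [Module.finrank_pi_fintype]
    simp [(Polynomial.degreeLTEquiv K (d+1)).finrank_eq]
  have hker := LinearMap.ker_ne_bot_of_finrank_lt (f := f) (by
    rw [hfr, finrank_restrictTotalDegree]
    have := six_mul_choose_three d
    nlinarith)
  obtain ⟨P, hP, hne⟩ := Submodule.exists_mem_ne_zero_of_ne_bot hker
  refine ⟨P.1, by simpa using hne, (MvPolynomial.mem_restrictTotalDegree _ _ _).1 P.2, ?_⟩
  intro l hl
  have := congrArg (fun g => (g ⟨l, hl⟩).1) (LinearMap.mem_ker.1 hP)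
  simpa [f] using this

namespace NullLine

variable {K : Type*} [Field K]

/-- An affine form that vanishes on `m` but not on `l`. -/
theorem exists_separating {l m : NullLine K} (h : l ≠ m) :
    ∃ Q : MvPolynomial (Fin 3) K, Q.totalDegree ≤ 1 ∧ m.restr Q = 0 ∧ l.restr Q ≠ 0 := by
  have key : ∀ (i : Fin 3) (s t : K), MvPolynomial.totalDegree
      (MvPolynomial.X i - MvPolynomial.C s * MvPolynomial.X 0 - MvPolynomial.C t :
        MvPolynomial (Fin 3) K) ≤ 1 := by
    intro i s t
    refine (MvPolynomial.totalDegree_sub_C_le _ _).trans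
      ((MvPolynomial.totalDegree_sub _ _).trans (max_le ?_ ?_))
    · simp
    · refine (MvPolynomial.totalDegree_mul _ _).trans ?_
      simp
  have lin : ∀ s t : K, Polynomial.C s * Polynomial.X + Polynomial.C t = 0 → s = 0 ∧ t = 0 := by
    intro s t hst
    have h1 := congrArg (fun p => Polynomial.coeff p 1) hst
    have h0 := congrArg (fun p => Polynomial.coeff p 0) hst
    simp [Polynomial.coeff_C] at h1 h0
    exact ⟨h1, h0⟩
  by_cases hab : l.a = m.a ∧ l.b = m.b
  · refine ⟨_, key 2 (m.a ^ 2) m.c, by simp [restr], ?_⟩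
    intro h0
    have : l.c - m.c = 0 := (lin 0 (l.c - m.c) (by
      rw [← h0]; simp [restr, hab.1])).2
    exact h (NullLine.ext hab.1 hab.2 (sub_eq_zero.1 this))
  · refine ⟨_, key 1 m.a m.b, by simp [restr], ?_⟩
    intro h0
    have := lin (l.a - m.a) (l.b - m.b) (by rw [← h0]; simp [restr]; ring)
    exact hab ⟨sub_eq_zero.1 this.1, sub_eq_zero.1 this.2⟩

theorem exists_separating_prod (Λ : Finset (NullLine K)) (l : NullLine K) :
    ∃ Q : MvPolynomial (Fin 3) K, Q.totalDegree ≤ (Λ.erase l).card ∧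
      (∀ m ∈ Λ, m ≠ l → m.restr Q = 0) ∧ l.restr Q ≠ 0 := by
  choose! f hf using fun m (hm : l ≠ m) => exists_separating hm
  refine ⟨∏ m ∈ Λ.erase l, f m, ?_, ?_, ?_⟩
  · refine (MvPolynomial.totalDegree_finsetProd _ _).trans ?_
    rw [Finset.card_eq_sum_ones]
    exact Finset.sum_le_sum fun m hm => (hf m (Finset.ne_of_mem_erase hm).symm).1
  · intro m hm hml
    rw [map_prod]
    exact Finset.prod_eq_zero (Finset.mem_erase.2 ⟨hml, hm⟩) (hf m hml.symm).2.1
  · rw [map_prod]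
    exact Finset.prod_ne_zero_iff.2 fun m hm => (hf m (Finset.ne_of_mem_erase hm).symm).2.2

theorem finrank_bound {P Q : MvPolynomial (Fin 3) K} (hP : P ≠ 0)
    (hrel : ∀ X, P ∣ Q * X → P ∣ X) (Λ : Finset (NullLine K))
    (h : ∀ l ∈ Λ, l.restr P = 0 ∧ l.restr Q = 0) (j s : ℕ)
    (hs : s + Λ.card ≤ j + P.totalDegree + Q.totalDegree + 1) :
    (j + Q.totalDegree + 3).choose 3 + (j + P.totalDegree + 3).choose 3 + Λ.card * (s + 1) ≤
      (j + P.totalDegree + Q.totalDegree + 3).choose 3 + (j + 3).choose 3 := by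
  set d := P.totalDegree with hd
  set e := Q.totalDegree with he
  choose S hS1 hS2 hS3 using exists_separating_prod Λ
  let V := fun m => MvPolynomial.restrictTotalDegree (Fin 3) K m
  let W := Λ → Polynomial.degreeLT K (s + 1)
  let f1 : V (j + e) →ₗ[K] MvPolynomial (Fin 3) K := LinearMap.mulLeft K P ∘ₗ (V (j + e)).subtype
  let f2 : V (j + d) →ₗ[K] MvPolynomial (Fin 3) K := LinearMap.mulLeft K Q ∘ₗ (V (j + d)).subtype
  let ι : Polynomial K →ₐ[K] MvPolynomial (Fin 3) K := Polynomial.aeval (MvPolynomial.X 0)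
  let g : Λ → W →ₗ[K] MvPolynomial (Fin 3) K := fun l =>
    LinearMap.mulLeft K (S l) ∘ₗ ι.toLinearMap ∘ₗ (Polynomial.degreeLT K (s + 1)).subtype ∘ₗ
      LinearMap.proj l
  let f3 : W →ₗ[K] MvPolynomial (Fin 3) K := ∑ l, g l
  let Θ : (V (j + e) × V (j + d)) × W →ₗ[K] MvPolynomial (Fin 3) K := (f1.coprod f2).coprod f3
  have hΘ : ∀ X Y w, Θ ((X, Y), w) = P * X.1 + Q * Y.1 + ∑ l : Λ, S l * ι (w l).1 := by
    intro X Y w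
    simp [Θ, f1, f2, f3, g]
    rfl
  have hι : ∀ (l : NullLine K) (p : Polynomial K), l.restr (ι p) = p := by
    intro l p
    induction p using Polynomial.induction_on' with
    | add p q hp hq => simp [hp, hq]
    | monomial n r => simp [ι, restr, Polynomial.aeval_monomial, Polynomial.C_mul_X_pow_eq_monomial, MvPolynomial.algebraMap_eq]
  have hιdeg : ∀ p ∈ Polynomial.degreeLT K (s + 1), (ι p).totalDegree ≤ s := by
    intro p hp
    have hp' : p.natDegree ≤ s := by
      rcases eq_or_ne p 0 with rfl | h0
      · simp
      · have := (Polynomial.natDegree_lt_iff_degree_lt h0).2 (Polynomial.mem_degreeLT.1 hp)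
        omega
    simp only [ι]
    rw [Polynomial.aeval_eq_sum_range]
    refine MvPolynomial.totalDegree_finsetSum_le fun i hi => ?_
    refine (MvPolynomial.totalDegree_smul_le _ _).trans ?_
    refine (MvPolynomial.totalDegree_pow _ _).trans ?_
    simp at hi ⊢
    omega
  have hrange : LinearMap.range Θ ≤ V (j + d + e) := by
    rintro _ ⟨⟨⟨X, Y⟩, w⟩, rfl⟩
    rw [hΘ]
    have hX := (MvPolynomial.mem_restrictTotalDegree _ _ _).1 X.2
    have hY := (MvPolynomial.mem_restrictTotalDegree _ _ _).1 Y.2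
    refine Submodule.add_mem _ (Submodule.add_mem _ ?_ ?_) (Submodule.sum_mem _ fun l _ => ?_) <;>
      rw [MvPolynomial.mem_restrictTotalDegree] <;>
      refine (MvPolynomial.totalDegree_mul _ _).trans ?_
    · omega
    · omega
    · have h1 := hS1 l
      have h2 := hιdeg _ (w l).2
      rw [Finset.card_erase_of_mem l.2] at h1
      have := Finset.card_pos.2 ⟨l.1, l.2⟩
      omega
  let T : V j →ₗ[K] (V (j + e) × V (j + d)) × W :=
    LinearMap.prod (LinearMap.prod
      (LinearMap.codRestrict _ (LinearMap.mulLeft K (-Q) ∘ₗ (V j).subtype) (by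
        intro X
        have hX := (MvPolynomial.mem_restrictTotalDegree _ _ _).1 X.2
        rw [MvPolynomial.mem_restrictTotalDegree]
        refine (MvPolynomial.totalDegree_mul _ _).trans ?_
        rw [MvPolynomial.totalDegree_neg, Submodule.subtype_apply]
        omega))
      (LinearMap.codRestrict _ (LinearMap.mulLeft K P ∘ₗ (V j).subtype) (by
        intro X
        have hX := (MvPolynomial.mem_restrictTotalDegree _ _ _).1 X.2
        rw [MvPolynomial.mem_restrictTotalDegree]
        refine (MvPolynomial.totalDegree_mul _ _).trans ?_
        rw [Submodule.subtype_apply]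
        omega))) 0
  have hker : LinearMap.ker Θ ≤ LinearMap.range T := by
    rintro ⟨⟨X, Y⟩, w⟩ hk
    rw [LinearMap.mem_ker, hΘ] at hk
    have hw : w = 0 := by
      funext l
      have h1 := congrArg l.1.restr hk
      rw [map_add, map_add, map_mul, map_mul, (h l.1 l.2).1, (h l.1 l.2).2, map_sum,
        Finset.sum_eq_single l] at h1
      · simp only [zero_mul, zero_add, map_mul, hι, map_zero] at h1
        exact Subtype.ext ((mul_eq_zero.1 h1).resolve_left (hS3 l))
      · intro m _ hml
        rw [map_mul, hS2 m l.1 l.2 (fun h => hml (Subtype.ext h.symm)), zero_mul]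
      · simp
    subst hw
    have hz : ∑ l : Λ, S l * ι ((0 : W) l).1 = 0 := Finset.sum_eq_zero fun l _ => by
      rw [show ((0 : W) l).1 = 0 from rfl, map_zero, mul_zero]
    rw [hz, add_zero] at hk
    obtain ⟨T', hT'⟩ := hrel Y.1 ⟨-X.1, by linear_combination hk⟩
    have hX : X.1 = -Q * T' := by
      apply mul_left_cancel₀ hP
      rw [hT'] at hk
      linear_combination hk
    have hTd : T' ∈ V j := by
      rw [MvPolynomial.mem_restrictTotalDegree]
      rcases eq_or_ne T' 0 with rfl | h0
      · simp
      have hY := (MvPolynomial.mem_restrictTotalDegree _ _ _).1 Y.2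
      rw [hT', MvPolynomial.totalDegree_mul_of_isDomain hP h0] at hY
      omega
    refine ⟨⟨T', hTd⟩, ?_⟩
    refine Prod.ext (Prod.ext (Subtype.ext ?_) (Subtype.ext ?_)) rfl
    · exact hX.symm
    · exact hT'.symm
  have e1 := Submodule.finrank_mono hrange
  have e2 := Submodule.finrank_mono hker
  have e3 := LinearMap.finrank_range_add_finrank_ker Θ
  have e4 := LinearMap.finrank_range_le T
  have hW : Module.finrank K W = Λ.card * (s + 1) := by
    simp only [W]
    rw [Module.finrank_pi_fintype]
    simp [(Polynomial.degreeLTEquiv K (s + 1)).finrank_eq]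
  simp only [Module.finrank_prod, hW, V, finrank_restrictTotalDegree] at e1 e2 e3 e4
  omega

/-- The Bezout bound for light rays on two surfaces without a common component. -/
theorem bezout {P Q : MvPolynomial (Fin 3) K} (hP : P ≠ 0)
    (hrel : ∀ X, P ∣ Q * X → P ∣ X) (Λ : Finset (NullLine K))
    (h : ∀ l ∈ Λ, l.restr P = 0 ∧ l.restr Q = 0) :
    Λ.card ≤ P.totalDegree * Q.totalDegree := by
  by_contra! hlt
  set n := Λ.card
  set d := P.totalDegree
  set e := Q.totalDegree
  have h1 := finrank_bound hP hrel Λ h (n * n + n) (n * n + d + e) (by simp only [n, d, e]; omega)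
  have a1 := six_mul_choose_three (n * n + n + e)
  have a2 := six_mul_choose_three (n * n + n + d)
  have a3 := six_mul_choose_three (n * n + n + d + e)
  have a4 := six_mul_choose_three (n * n + n)
  change (n * n + n + e + 3).choose 3 + (n * n + n + d + 3).choose 3 + n * (n * n + d + e + 1) ≤
    (n * n + n + d + e + 3).choose 3 + (n * n + n + 3).choose 3 at h1
  have h2 : (n * n + n + e + 1) * (n * n + n + e + 2) * (n * n + n + e + 3) +
      (n * n + n + d + 1) * (n * n + n + d + 2) * (n * n + n + d + 3) +
      6 * (n * (n * n + d + e + 1)) ≤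
      (n * n + n + d + e + 1) * (n * n + n + d + e + 2) * (n * n + n + d + e + 3) +
      (n * n + n + 1) * (n * n + n + 2) * (n * n + n + 3) := by
    omega
  have h3 : 2 * (n * (n * n + d + e + 1)) ≤ d * e * (2 * (n * n + n) + d + e + 4) := by
    zify at h2 ⊢
    linarith
  have h4 : d * e + 1 ≤ n := hlt
  have h5 : (d * e + 1) * (2 * (n * n + n) + d + e + 4) ≤ n * (2 * (n * n + n) + d + e + 4) :=
    Nat.mul_le_mul_right _ h4
  nlinarith

end NullLine

/-- A solution `z` of the linear second order differential equation satisfied by the products of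
`y` with affine functions is a product of `y` and an affine function. -/
theorem Polynomial.eq_mul_affine_of_ode {K : Type*} [Field K] {y z : Polynomial K} {N : ℕ}
    (hN : ∀ m : ℕ, 0 < m → m ≤ N → (m : K) ≠ 0) (hy : y.natDegree + 1 ≤ N) (hz : z.natDegree ≤ N)
    {x₀ : K} (hx₀ : y.eval x₀ ≠ 0)
    (h : y * (z * derivative (derivative y) - y * derivative (derivative z)) =
      2 * derivative y * (z * derivative y - y * derivative z)) :
    ∃ α β : K, z = y * (C α + C β * X) := by
  set h₀ := z.eval x₀ / y.eval x₀
  set h₁ := ((derivative z).eval x₀ - (derivative y).eval x₀ * h₀) / y.eval x₀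
  set e := z - y * (C h₀ + C h₁ * (X - C x₀)) with he
  suffices e = 0 by
    refine ⟨h₀ - h₁ * x₀, h₁, ?_⟩
    rw [← sub_eq_zero, ← this, he]
    simp only [map_sub, map_mul]
    ring
  by_contra hne
  have hode : y * (e * derivative (derivative y) - y * derivative (derivative e)) =
      2 * derivative y * (e * derivative y - y * derivative e) := by
    simp only [he, derivative_sub, derivative_mul, derivative_add, derivative_C, derivative_X]
    simp only [zero_mul, zero_add, sub_zero, mul_one, add_zero, derivative_one, mul_zero,
      derivative_zero]
    linear_combination h
  have e0 : e.eval x₀ = 0 := by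
    simp only [he, h₀, eval_sub, eval_mul, eval_add, eval_C, eval_X]
    field_simp
    ring
  have e1 : (derivative e).eval x₀ = 0 := by
    simp only [he, derivative_sub, derivative_mul, derivative_add, derivative_C, derivative_X,
      eval_sub, eval_mul, eval_add, eval_C, eval_X, eval_zero, eval_one, h₁]
    field_simp
    ring
  have hk : 1 < e.rootMultiplicity x₀ :=
    (one_lt_rootMultiplicity_iff_isRoot hne).2 ⟨e0, e1⟩
  obtain ⟨g, hg, hg0⟩ := exists_eq_pow_rootMultiplicity_mul_and_not_dvd e hne x₀
  obtain ⟨j, hj⟩ := Nat.exists_eq_add_of_lt hk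
  have hdeg : e.rootMultiplicity x₀ ≤ N := by
    rw [← count_roots]
    refine ((Multiset.count_le_card _ _).trans (card_roots' _)).trans ?_
    refine (natDegree_sub_le _ _).trans (max_le hz (natDegree_mul_le.trans ?_))
    refine (Nat.add_le_add_left ?_ _).trans hy
    rw [show C h₀ + C h₁ * (X - C x₀) = C h₁ * X + C (h₀ - h₁ * x₀) by
      simp only [map_sub, map_mul]; ring]
    exact natDegree_linear_le
  rw [show e.rootMultiplicity x₀ = j + 2 by omega] at hg hdeg
  have hXd : derivative (X - C x₀) = 1 := by simp
  have d1 : derivative e = (X - C x₀) ^ (j + 1) * (((j + 2 : ℕ) : Polynomial K) * g + (X - C x₀) * derivative g) := by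
    rw [hg, derivative_mul, derivative_pow_succ, hXd]
    push_cast [map_add, map_natCast]
    simp only [map_one]
    ring
  have d2 : derivative (derivative e) = (X - C x₀) ^ j * (((j + 1 : ℕ) : Polynomial K) * (((j + 2 : ℕ) : Polynomial K) * g) +
      (X - C x₀) * (2 * ((j + 2 : ℕ) : Polynomial K) * derivative g + (X - C x₀) * derivative (derivative g))) := by
    rw [d1, derivative_mul, derivative_pow_succ, derivative_add, derivative_mul, derivative_mul, hXd,
      derivative_natCast]
    push_cast [map_add, map_natCast]
    simp only [map_one]
    ring
  have hX0 : (X - C x₀) ^ j ≠ 0 := pow_ne_zero _ (X_sub_C_ne_zero _)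
  have hc : y ^ 2 * (((j + 1 : ℕ) : Polynomial K) * (((j + 2 : ℕ) : Polynomial K) * g)) = (X - C x₀) *
      ((X - C x₀) * (g * (y * derivative (derivative y) - 2 * derivative y ^ 2))
        + 2 * y * derivative y * (((j + 2 : ℕ) : Polynomial K) * g + (X - C x₀) * derivative g)
        - y ^ 2 * (2 * ((j + 2 : ℕ) : Polynomial K) * derivative g + (X - C x₀) * derivative (derivative g))) := by
    apply mul_left_cancel₀ hX0
    rw [d2, d1, hg] at hode
    linear_combination -hode
  have := congrArg (eval x₀) hc
  simp only [eval_mul, eval_pow, eval_natCast, eval_sub, eval_X, eval_C, sub_self, zero_mul,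
    mul_eq_zero, hx₀, pow_eq_zero_iff, ne_eq, OfNat.ofNat_ne_zero, not_false_eq_true, false_or]
    at this
  rcases this with h | h | h
  · exact hN _ (by omega) (by omega) h
  · exact hN _ (by omega) (by omega) h
  · exact hg0 (dvd_iff_isRoot.2 h)

namespace NullLine
open MvPolynomial

variable {K : Type*} [Field K]

theorem derivative_restr (l : NullLine K) (P : MvPolynomial (Fin 3) K) :
    Polynomial.derivative (l.restr P) = l.restr (pderiv 0 P) +
      Polynomial.C l.a * l.restr (pderiv 1 P) + Polynomial.C l.a ^ 2 * l.restr (pderiv 2 P) := by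
  induction P using MvPolynomial.induction_on with
  | C r => simp [restr]
  | add p q hp hq =>
    simp only [map_add, hp, hq]
    ring
  | mul_X p i hp =>
    simp only [Derivation.leibniz, smul_eq_mul, map_add, map_mul, Polynomial.derivative_mul, hp]
    fin_cases i <;> simp [restr, pderiv_X, -map_pow] <;> simp only [map_pow] <;> ring

theorem totalDegree_pderiv_le' (i : Fin 3) (P : MvPolynomial (Fin 3) K) :
    (pderiv i P).totalDegree ≤ P.totalDegree - 1 := by
  refine Finset.sup_le fun m hm => ?_
  have h : m + Finsupp.single i 1 ∈ P.support := by
    rw [mem_support_iff, coeff_pderiv] at hm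
    exact mem_support_iff.2 (left_ne_zero_of_mul hm)
  have := le_totalDegree h
  rw [Finsupp.sum_add_index' (fun _ => rfl) (fun _ _ _ => rfl)] at this
  simp at this
  omega

theorem pderiv_comm' (i j : Fin 3) (P : MvPolynomial (Fin 3) K) :
    pderiv i (pderiv j P) = pderiv j (pderiv i P) := by
  have : ⁅(pderiv i : Derivation K (MvPolynomial (Fin 3) K) (MvPolynomial (Fin 3) K)),
      (pderiv j : Derivation K (MvPolynomial (Fin 3) K) (MvPolynomial (Fin 3) K))⁆ = 0 := by
    refine derivation_ext fun k => ?_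
    rw [Derivation.commutator_apply, pderiv_X, pderiv_X]
    simp only [Pi.single_apply]
    split_ifs <;> simp
  have h := DFunLike.congr_fun this P
  rwa [Derivation.commutator_apply, Derivation.zero_apply, sub_eq_zero] at h
end NullLine

namespace NullLine
open MvPolynomial

variable {K : Type*} [Field K]

/-- The coefficient of degree `0` of the pseudo-quotient of the second order condition by the first
order condition for light rays on a surface. -/
noncomputable def quot₀ (P : MvPolynomial (Fin 3) K) : MvPolynomial (Fin 3) K :=
  pderiv 2 P ^ 2 * (pderiv 1 (pderiv 1 P) + 2 * pderiv 0 (pderiv 2 P)) -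
    pderiv 1 P * (pderiv 2 P * (2 * pderiv 1 (pderiv 2 P)) - pderiv 1 P * pderiv 2 (pderiv 2 P)) -
    pderiv 0 P * pderiv 2 P * pderiv 2 (pderiv 2 P)

/-- The coefficient of degree `1` of the pseudo-quotient. -/
noncomputable def quot₁ (P : MvPolynomial (Fin 3) K) : MvPolynomial (Fin 3) K :=
  pderiv 2 P ^ 2 * (2 * pderiv 1 (pderiv 2 P)) - pderiv 1 P * pderiv 2 P * pderiv 2 (pderiv 2 P)

/-- The coefficient of degree `0` of the pseudo-remainder. -/
noncomputable def rem₀ (P : MvPolynomial (Fin 3) K) : MvPolynomial (Fin 3) K :=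
  pderiv 2 P ^ 3 * pderiv 0 (pderiv 0 P) - pderiv 0 P * quot₀ P

/-- The coefficient of degree `1` of the pseudo-remainder. -/
noncomputable def rem₁ (P : MvPolynomial (Fin 3) K) : MvPolynomial (Fin 3) K :=
  pderiv 2 P ^ 3 * (2 * pderiv 0 (pderiv 1 P)) - pderiv 1 P * quot₀ P - pderiv 0 P * quot₁ P

/-- The derivative along the direction `(1, a, a²)`. -/
noncomputable def dir (a : K) :
    Derivation K (MvPolynomial (Fin 3) K) (MvPolynomial (Fin 3) K) :=
  pderiv 0 + (C a : MvPolynomial (Fin 3) K) • pderiv 1 +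
    (C (a ^ 2) : MvPolynomial (Fin 3) K) • pderiv 2

/-- The derivative of `dir` with respect to its parameter. -/
noncomputable def dir' (a : K) :
    Derivation K (MvPolynomial (Fin 3) K) (MvPolynomial (Fin 3) K) :=
  pderiv 1 + (C (2 * a) : MvPolynomial (Fin 3) K) • pderiv 2

theorem dir_apply (a : K) (P : MvPolynomial (Fin 3) K) :
    dir a P = pderiv 0 P + C a * pderiv 1 P + C a ^ 2 * pderiv 2 P := by
  simp [dir]

theorem dir'_apply (a : K) (P : MvPolynomial (Fin 3) K) :
    dir' a P = pderiv 1 P + 2 * C a * pderiv 2 P := by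
  simp [dir', show (C 2 : MvPolynomial (Fin 3) K) = 2 from map_ofNat C 2]

theorem derivative_restr_eq (l : NullLine K) (P : MvPolynomial (Fin 3) K) :
    Polynomial.derivative (l.restr P) = l.restr (dir l.a P) := by
  rw [derivative_restr, dir_apply]
  simp [restr]

theorem dir_dir_eq (a : K) (P : MvPolynomial (Fin 3) K) :
    pderiv 2 P ^ 3 * dir a (dir a P) = dir a P * (quot₀ P + C a * quot₁ P +
      C a ^ 2 * (pderiv 2 P ^ 2 * pderiv 2 (pderiv 2 P))) + (rem₀ P + C a * rem₁ P) := by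
  simp only [dir_apply, map_add, Derivation.leibniz, Derivation.leibniz_pow, pderiv_C, smul_eq_mul, 
    rem₀, rem₁, quot₀, quot₁, pderiv_comm' 1 0 P, pderiv_comm' 2 0 P, pderiv_comm' 2 1 P]
  simp
  ring

theorem dir_dir'_eq (a : K) (P : MvPolynomial (Fin 3) K) :
    2 * pderiv 2 P ^ 3 * dir a (dir' a P) =
      dir a P * (quot₁ P + 2 * C a * (pderiv 2 P ^ 2 * pderiv 2 (pderiv 2 P))) +
      dir' a P * (quot₀ P + C a * quot₁ P +
        C a ^ 2 * (pderiv 2 P ^ 2 * pderiv 2 (pderiv 2 P))) + rem₁ P := by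
  have h2 : ∀ i : Fin 3, pderiv i (2 : MvPolynomial (Fin 3) K) = 0 := fun i => by
    rw [show (2 : MvPolynomial (Fin 3) K) = C 2 from (map_ofNat C 2).symm, pderiv_C]
  simp only [dir_apply, dir'_apply, map_add, Derivation.leibniz, pderiv_C, smul_eq_mul, rem₁, quot₀, quot₁,
    h2, pderiv_comm' 2 1 P]
  ring

theorem totalDegree_mul_le {P Q : MvPolynomial (Fin 3) K} {m n : ℕ} (hP : P.totalDegree ≤ m)
    (hQ : Q.totalDegree ≤ n) : (P * Q).totalDegree ≤ m + n :=
  (totalDegree_mul _ _).trans (add_le_add hP hQ)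

theorem totalDegree_rem_le (P : MvPolynomial (Fin 3) K) :
    (rem₀ P).totalDegree ≤ 4 * P.totalDegree ∧ (rem₁ P).totalDegree ≤ 4 * P.totalDegree := by
  set d := P.totalDegree
  have h1 : ∀ i, (pderiv i P).totalDegree ≤ d := fun i =>
    (totalDegree_pderiv_le' i P).trans (Nat.sub_le _ _)
  have h2 : ∀ i j, (pderiv i (pderiv j P)).totalDegree ≤ d := fun i j =>
    ((totalDegree_pderiv_le' i _).trans (Nat.sub_le _ _)).trans (h1 j)
  have hC : (2 : MvPolynomial (Fin 3) K).totalDegree ≤ 0 := by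
    rw [show (2 : MvPolynomial (Fin 3) K) = C 2 from (map_ofNat C 2).symm, totalDegree_C]
  have hsub : ∀ {A B : MvPolynomial (Fin 3) K} {n}, A.totalDegree ≤ n → B.totalDegree ≤ n →
    (A - B).totalDegree ≤ n := fun hA hB => (totalDegree_sub _ _).trans (max_le hA hB)
  have hadd : ∀ {A B : MvPolynomial (Fin 3) K} {n}, A.totalDegree ≤ n → B.totalDegree ≤ n →
    (A + B).totalDegree ≤ n := fun hA hB => (totalDegree_add _ _).trans (max_le hA hB)
  have h22 : ∀ i j, (2 * pderiv i (pderiv j P)).totalDegree ≤ d := fun i j =>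
    (totalDegree_mul_le hC (h2 i j)).trans (by omega)
  have hp : ∀ n : ℕ, (pderiv 2 P ^ n).totalDegree ≤ n * d := fun n =>
    (totalDegree_pow _ _).trans (Nat.mul_le_mul_left _ (h1 2))
  have q0 : (quot₀ P).totalDegree ≤ 3 * d := by
    refine hsub (hsub ?_ ?_) ?_
    · exact (totalDegree_mul_le (hp 2) (hadd (h2 _ _) (h22 _ _))).trans (by omega)
    · refine (totalDegree_mul_le (n := 2 * d) (h1 1) (hsub ?_ ?_)).trans (by omega)
      · exact (totalDegree_mul_le (h1 _) (h22 _ _)).trans (by omega)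
      · exact (totalDegree_mul_le (h1 _) (h2 _ _)).trans (by omega)
    · exact (totalDegree_mul_le (totalDegree_mul_le (h1 _) (h1 _)) (h2 _ _)).trans (by omega)
  have q1 : (quot₁ P).totalDegree ≤ 3 * d := by
    refine hsub ?_ ?_
    · exact (totalDegree_mul_le (hp 2) (h22 _ _)).trans (by omega)
    · exact (totalDegree_mul_le (totalDegree_mul_le (h1 _) (h1 _)) (h2 _ _)).trans (by omega)
  constructor
  · refine hsub ?_ ?_
    · exact (totalDegree_mul_le (hp 3) (h2 _ _)).trans (by omega)
    · exact (totalDegree_mul_le (h1 _) q0).trans (by omega)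
  · refine hsub (hsub ?_ ?_) ?_
    · exact (totalDegree_mul_le (hp 3) (h22 _ _)).trans (by omega)
    · exact (totalDegree_mul_le (h1 _) q0).trans (by omega)
    · exact (totalDegree_mul_le (h1 _) q1).trans (by omega)

/-- First and second order conditions at a point of a light ray on a surface. -/
theorem eval_dir_eq_zero {l : NullLine K} {P : MvPolynomial (Fin 3) K} (h : l.restr P = 0) (x : K) :
    eval (l.pt x) (dir l.a P) = 0 ∧ eval (l.pt x) (dir l.a (dir l.a P)) = 0 := by
  rw [← eval_restr, ← eval_restr, ← derivative_restr_eq, ← derivative_restr_eq,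
    ← derivative_restr_eq, h]
  simp

theorem crossing {l m : NullLine K} {P : MvPolynomial (Fin 3) K} {x : K} (hl : l.restr P = 0)
    (hm : m.restr P = 0) (ha : m.a ≠ l.a) (hx : m.pt x = l.pt x) :
    (l.restr (dir' l.a P)).eval x + (m.a - l.a) * (l.restr (pderiv 2 P)).eval x = 0 ∧
    (l.restr (rem₀ P)).eval x = 0 ∧ (l.restr (rem₁ P)).eval x = 0 := by
  have h1 := eval_dir_eq_zero hl x
  have h2 := eval_dir_eq_zero hm x
  have e1 := congrArg (eval (l.pt x)) (dir_dir_eq l.a P)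
  have e2 := congrArg (eval (l.pt x)) (dir_dir_eq m.a P)
  rw [hx] at h2
  simp only [map_mul, map_add, h1.1, h1.2, h2.1, h2.2, zero_mul, mul_zero, zero_add, eval_C] at e1 e2
  have f1 := h1.1
  have f2 := h2.1
  simp only [dir_apply, map_add, map_mul, map_pow, eval_C] at f1 f2
  have hne := sub_ne_zero.2 ha
  have r1 : eval (l.pt x) (rem₁ P) = 0 := by
    apply mul_left_cancel₀ hne
    linear_combination e1 - e2
  rw [eval_restr, eval_restr, eval_restr, eval_restr, dir'_apply]
  simp only [map_add, map_mul, map_ofNat, eval_C]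
  refine ⟨?_, ?_, r1⟩
  · apply mul_left_cancel₀ hne
    linear_combination f2 - f1
  · rw [r1] at e1
    linear_combination -e1

/-- On an irreducible surface on which the pseudo-remainder vanishes, every light ray satisfies
a second order linear differential equation. -/
theorem umbilic_ode {l : NullLine K} {P : MvPolynomial (Fin 3) K} (hl : l.restr P = 0)
    (h0 : P ∣ rem₀ P) (h1 : P ∣ rem₁ P) (hz : l.restr (pderiv 2 P) ≠ 0) :
    let y := l.restr (dir' l.a P)
    let z := l.restr (pderiv 2 P)
    y * (z * y.derivative.derivative - y * z.derivative.derivative) =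
      2 * y.derivative * (z * y.derivative - y * z.derivative) := by
  intro y z
  obtain ⟨A, hA⟩ := h0
  obtain ⟨B, hB⟩ := h1
  have c1 : ∀ Q, dir' l.a (dir l.a Q) = dir l.a (dir' l.a Q) := fun Q => by
    have h2 : ∀ i : Fin 3, pderiv i (2 : MvPolynomial (Fin 3) K) = 0 := fun i => by
      rw [show (2 : MvPolynomial (Fin 3) K) = C 2 from (map_ofNat C 2).symm, pderiv_C]
    simp only [dir_apply, dir'_apply, map_add, Derivation.leibniz, Derivation.leibniz_pow, pderiv_C,
      smul_eq_mul, h2, pderiv_comm' 1 0 Q, pderiv_comm' 2 0 Q, pderiv_comm' 2 1 Q]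
    simp
    ring
  have c2 : ∀ Q, pderiv 2 (dir l.a Q) = dir l.a (pderiv 2 Q) := fun Q => by
    simp only [dir_apply, map_add, Derivation.leibniz, Derivation.leibniz_pow, pderiv_C,
      smul_eq_mul, pderiv_comm' 2 0 Q, pderiv_comm' 2 1 Q]
    simp
  let T : Derivation K (MvPolynomial (Fin 3) K) (MvPolynomial (Fin 3) K) :=
    pderiv 2 P • dir' l.a - dir' l.a P • pderiv 2
  have hT : ∀ Q, T Q = pderiv 2 P * dir' l.a Q - dir' l.a P * pderiv 2 Q := fun Q => by simp [T]
  have hTP : T P = 0 := by rw [hT]; ring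
  have i1 := congrArg T (dir_dir_eq l.a P)
  have i2 := congrArg l.restr (dir_dir'_eq l.a P)
  rw [hA, hB, show P * A + C l.a * (P * B) = P * (A + C l.a * B) by ring] at i1
  rw [hB] at i2
  generalize quot₀ P + C l.a * quot₁ P +
    C l.a ^ 2 * (pderiv 2 P ^ 2 * pderiv 2 (pderiv 2 P)) = G at i1 i2
  have d1 : l.restr (dir l.a P) = 0 := by rw [← derivative_restr_eq, hl]; simp
  have d2 : l.restr (dir l.a (dir l.a P)) = 0 := by rw [← derivative_restr_eq, d1]; simp
  rw [map_add T, Derivation.leibniz T, Derivation.leibniz T, Derivation.leibniz T P, hTP] at i1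
  have i1 := congrArg l.restr i1
  simp only [map_add, smul_eq_mul, map_mul, hl, d1, d2, zero_mul, mul_zero, add_zero, zero_add] at i1
  simp only [map_add, map_mul, hl, d1, zero_mul, add_zero, zero_add, map_pow, map_ofNat] at i2
  simp only [hT, c1, c2, map_sub, map_mul, ← derivative_restr_eq, map_pow] at i1 i2
  change z ^ 3 * (z * y.derivative.derivative - y * z.derivative.derivative) =
    l.restr G * (z * y.derivative - y * z.derivative) at i1
  change 2 * z ^ 3 * y.derivative = y * l.restr G at i2
  apply mul_left_cancel₀ (pow_ne_zero 3 hz)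
  linear_combination y * i1 - (z * y.derivative - y * z.derivative) * i2

end NullLine

namespace NullLine
open MvPolynomial

variable {K : Type*} [Field K]

theorem dvd_of_lt_card {P Q : MvPolynomial (Fin 3) K} (hP : Prime P) (Λ : Finset (NullLine K))
    (h : ∀ l ∈ Λ, l.restr P = 0 ∧ l.restr Q = 0) (hc : P.totalDegree * Q.totalDegree < Λ.card) :
    P ∣ Q := by
  by_contra hn
  exact hc.not_ge (bezout hP.ne_zero (fun X hX => (hP.dvd_or_dvd hX).resolve_left hn) Λ h)

theorem Meets.of_pt_eq {l m m' : NullLine K} {x : K} (h : m.pt x = l.pt x)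
    (hm : m'.pt x = l.pt x) : m.Meets m' := ⟨x, h.trans hm.symm⟩

/-- Pairwise skew light rays meet a given one in different points. -/
theorem card_le_natDegree {l : NullLine K} {M : Finset (NullLine K)}
    (hM : ∀ m ∈ M, ∀ m' ∈ M, m.Meets m' → m = m') {g : Polynomial K} (hg : g ≠ 0)
    (h : ∀ m ∈ M, ∃ x, m.pt x = l.pt x ∧ g.eval x = 0) : M.card ≤ g.natDegree := by
  choose! x hx using h
  calc M.card = (M.image x).card := by
        refine (Finset.card_image_of_injOn fun m hm m' hm' hxx => hM m hm m' hm' ?_).symm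
        have h' := (hx m' hm').1
        rw [← hxx] at h'
        exact .of_pt_eq (hx m hm).1 h'
    _ ≤ g.roots.toFinset.card := by
        refine Finset.card_le_card fun t ht => ?_
        obtain ⟨m, hm, rfl⟩ := Finset.mem_image.1 ht
        exact Multiset.mem_toFinset.2 ((Polynomial.mem_roots hg).2 (hx m hm).2)
    _ ≤ g.natDegree := (Multiset.toFinset_card_le _).trans (Polynomial.card_roots' g)

theorem restr_eq_zero_of_lt_card {l : NullLine K} {M : Finset (NullLine K)}
    (hM : ∀ m ∈ M, ∀ m' ∈ M, m.Meets m' → m = m') {Q : MvPolynomial (Fin 3) K}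
    (h : ∀ m ∈ M, ∃ x, m.pt x = l.pt x ∧ (l.restr Q).eval x = 0) (hc : Q.totalDegree < M.card) :
    l.restr Q = 0 := by
  by_contra hne
  exact (hc.trans_le (card_le_natDegree hM hne h)).not_ge (l.natDegree_restr_le Q)

/-- The light rays of `R` on the surface `P = 0` that meet `l`. -/
noncomputable def crossers (R : Finset (NullLine K)) (P : MvPolynomial (Fin 3) K)
    (l : NullLine K) : Finset (NullLine K) :=
  R.filter fun m => m.restr P = 0 ∧ m.Meets l

theorem mem_crossers {R : Finset (NullLine K)} {P : MvPolynomial (Fin 3) K} {l m : NullLine K} :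
    m ∈ crossers R P l ↔ m ∈ R ∧ m.restr P = 0 ∧ m.Meets l := by
  simp [crossers]

theorem totalDegree_pos_of_prime {P : MvPolynomial (Fin 3) K} (hP : Prime P) :
    0 < P.totalDegree := by
  rw [Nat.pos_iff_ne_zero]
  intro h
  have hC := totalDegree_eq_zero_iff_eq_C.1 h
  refine hP.not_isUnit ?_
  rw [hC]
  refine (IsUnit.mk0 _ fun h0 => hP.ne_zero ?_).map C
  rw [hC, h0, C_0]

theorem pderiv_eq_zero_of_dvd {P : MvPolynomial (Fin 3) K} (hP : Prime P) {i : Fin 3}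
    (h : P ∣ pderiv i P) : pderiv i P = 0 := by
  by_contra hne
  have h1 := totalDegree_pos_of_prime hP
  have h2 := totalDegree_pderiv_le' i P
  obtain ⟨Q, hQ⟩ := h
  rw [hQ] at hne
  have := totalDegree_mul_of_isDomain hP.ne_zero (right_ne_zero_of_mul hne)
  rw [← hQ] at this
  omega

theorem exists_pderiv_ne_zero {P : MvPolynomial (Fin 3) K} (hP : Prime P)
    (hchar : ∀ m : ℕ, 0 < m → m ≤ P.totalDegree + 1 → (m : K) ≠ 0) : ∃ i, pderiv i P ≠ 0 := by
  by_contra! hall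
  have hpos := totalDegree_pos_of_prime hP
  rw [Nat.pos_iff_ne_zero, Ne, totalDegree_eq_zero_iff] at hpos
  push Not at hpos
  obtain ⟨m, hm, i, hi⟩ := hpos
  have h1 := congrArg (coeff (m - Finsupp.single i 1)) (hall i)
  have h2 : m - Finsupp.single i 1 + Finsupp.single i 1 = m :=
    tsub_add_cancel_of_le (Finsupp.single_le_iff.2 (Nat.one_le_iff_ne_zero.2 hi))
  rw [coeff_pderiv, h2, coeff_zero] at h1
  refine hchar (m i) (Nat.pos_of_ne_zero hi) ?_ ?_
  · have h3 := le_totalDegree hm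
    rw [Finsupp.sum_fintype _ _ (fun _ => rfl)] at h3
    have := Finset.single_le_sum (fun _ _ => Nat.zero_le _) (Finset.mem_univ i) (f := m)
    omega
  · have h4 := (mul_eq_zero.1 h1).resolve_left (mem_support_iff.1 hm)
    rw [← h2]
    simpa using h4

theorem false_of_umbilic {P : MvPolynomial (Fin 3) K} (hP : Prime P) {R Λ : Finset (NullLine K)}
    (hR : ∀ m ∈ R, ∀ m' ∈ R, m.Meets m' → m = m') (hne : ∀ m ∈ R, ∀ l ∈ Λ, m.a ≠ l.a) {k : ℕ}
    (hka : (R.image a).card ≤ k) (hkb : (R.image b).card ≤ k)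
    (hchar : ∀ m : ℕ, 0 < m → m ≤ P.totalDegree + 1 → (m : K) ≠ 0)
    (hΛ : ∀ l ∈ Λ, l.restr P = 0 ∧ k + 5 * P.totalDegree < (crossers R P l).card)
    (hc : 4 * P.totalDegree ^ 2 < Λ.card) : False := by
  set d := P.totalDegree with hd
  have hskew : ∀ l, ∀ m ∈ crossers R P l, ∀ m' ∈ crossers R P l, m.Meets m' → m = m' :=
    fun l m hm m' hm' => hR m (mem_crossers.1 hm).1 m' (mem_crossers.1 hm').1
  have hcr : ∀ l ∈ Λ, ∀ m ∈ crossers R P l, ∃ x, m.pt x = l.pt x ∧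
      (l.restr (dir' l.a P)).eval x + (m.a - l.a) * (l.restr (pderiv 2 P)).eval x = 0 ∧
      (l.restr (rem₀ P)).eval x = 0 ∧ (l.restr (rem₁ P)).eval x = 0 := by
    intro l hl m hm
    obtain ⟨hmR, hm0, x, hx⟩ := mem_crossers.1 hm
    exact ⟨x, hx, crossing (hΛ l hl).1 hm0 (hne m hmR l hl) hx⟩
  have hpd : ∀ i, (pderiv i P).totalDegree ≤ d := fun i =>
    (totalDegree_pderiv_le' i P).trans (Nat.sub_le _ _)
  have hdvd : ∀ Q : MvPolynomial (Fin 3) K, Q.totalDegree ≤ 4 * d → (∀ l ∈ Λ, l.restr Q = 0) →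
      P ∣ Q := fun Q hQ h => dvd_of_lt_card hP Λ (fun l hl => ⟨(hΛ l hl).1, h l hl⟩) <| by
    refine lt_of_le_of_lt (Nat.mul_le_mul_left d hQ) ?_
    rwa [show d * (4 * d) = 4 * d ^ 2 by ring]
  have hvan : ∀ l ∈ Λ, ∀ Q : MvPolynomial (Fin 3) K, Q.totalDegree ≤ 4 * d →
      (∀ m ∈ crossers R P l, ∃ x, m.pt x = l.pt x ∧ (l.restr Q).eval x = 0) → l.restr Q = 0 :=
    fun l hl Q hQ h => restr_eq_zero_of_lt_card (hskew l) h (by have := (hΛ l hl).2; omega)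
  have h0 : P ∣ rem₀ P := hdvd _ (totalDegree_rem_le P).1 fun l hl =>
    hvan l hl _ (totalDegree_rem_le P).1 fun m hm => by
      obtain ⟨x, h1, -, h2, -⟩ := hcr l hl m hm
      exact ⟨x, h1, h2⟩
  have h1 : P ∣ rem₁ P := hdvd _ (totalDegree_rem_le P).2 fun l hl =>
    hvan l hl _ (totalDegree_rem_le P).2 fun m hm => by
      obtain ⟨x, h1, -, -, h2⟩ := hcr l hl m hm
      exact ⟨x, h1, h2⟩
  have hdir' : ∀ a, (dir' a P).totalDegree ≤ d := fun a => by
    rw [dir'_apply]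
    refine (totalDegree_add _ _).trans (max_le (hpd 1) ?_)
    refine (totalDegree_mul_le (m := 0) ?_ (hpd 2)).trans (by omega)
    rw [show (2 : MvPolynomial (Fin 3) K) = C 2 from (map_ofNat C 2).symm, ← C_mul, totalDegree_C]
  have hex : ∃ l ∈ Λ, l.restr (dir' l.a P) ≠ 0 ∧ l.restr (pderiv 2 P) ≠ 0 := by
    by_contra! hall
    by_cases hz : P ∣ pderiv 2 P
    · have hz0 := pderiv_eq_zero_of_dvd hP hz
      have hy : pderiv 1 P = 0 := by
        refine pderiv_eq_zero_of_dvd hP (hdvd _ ((hpd 1).trans (by omega)) fun l hl => ?_)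
        refine hvan l hl _ ((hpd 1).trans (by omega)) fun m hm => ?_
        obtain ⟨x, h1, h2, -⟩ := hcr l hl m hm
        refine ⟨x, h1, ?_⟩
        simpa [hz0, dir'_apply] using h2
      have hx : pderiv 0 P = 0 := by
        refine pderiv_eq_zero_of_dvd hP (hdvd _ ((hpd 0).trans (by omega)) fun l hl => ?_)
        have := derivative_restr_eq l P
        rw [(hΛ l hl).1, dir_apply, hz0, hy] at this
        simpa using this.symm
      obtain ⟨i, hi⟩ := exists_pderiv_ne_zero hP hchar
      fin_cases i
      · exact hi hx
      · exact hi hy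
      · exact hi hz0
    · have hΔ : P ∣ pderiv 1 P ^ 2 - 4 * (pderiv 0 P * pderiv 2 P) ∧ ∀ l ∈ Λ,
          l.restr (pderiv 1 P ^ 2 - 4 * (pderiv 0 P * pderiv 2 P)) =
            l.restr (dir' l.a P) ^ 2 := by
        have hdeg : (pderiv 1 P ^ 2 - 4 * (pderiv 0 P * pderiv 2 P)).totalDegree ≤ 2 * d := by
          refine (totalDegree_sub _ _).trans (max_le ?_ ?_)
          · exact (totalDegree_pow _ _).trans (Nat.mul_le_mul_left _ (hpd 1))
          · refine (totalDegree_mul_le (m := 0) ?_ (totalDegree_mul_le (hpd 0) (hpd 2))).trans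
              (by omega)
            rw [show (4 : MvPolynomial (Fin 3) K) = C 4 from (map_ofNat C 4).symm, totalDegree_C]
        have hrestr : ∀ l ∈ Λ, l.restr (pderiv 1 P ^ 2 - 4 * (pderiv 0 P * pderiv 2 P)) =
            l.restr (dir' l.a P) ^ 2 := fun l hl => by
          have := derivative_restr_eq l P
          rw [(hΛ l hl).1, dir_apply, Polynomial.derivative_zero] at this
          have e1 : l.restr (dir' l.a P) ^ 2 = l.restr (pderiv 1 P ^ 2 -
            4 * (pderiv 0 P * pderiv 2 P)) + 4 * l.restr (pderiv 2 P) * l.restr (pderiv 0 P +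
              C l.a * pderiv 1 P + C l.a ^ 2 * pderiv 2 P) := by
            simp only [dir'_apply, map_add, map_sub, map_mul, map_pow, map_ofNat]
            ring
          rw [e1, ← this, mul_zero, add_zero]
        refine ⟨?_, hrestr⟩
        have hc1 : (Λ.filter fun l => l.restr (pderiv 2 P) = 0).card ≤ d * d := by
          by_contra! hlt
          refine hz (dvd_of_lt_card hP _ (fun l hl => ?_)
            ((Nat.mul_le_mul_left d (hpd 2)).trans_lt hlt))
          rw [Finset.mem_filter] at hl
          exact ⟨(hΛ l hl.1).1, hl.2⟩
        have hc2 := Finset.card_filter_add_card_filter_not (s := Λ)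
          (fun l => l.restr (pderiv 2 P) = 0)
        refine dvd_of_lt_card hP (Λ.filter fun l => ¬ l.restr (pderiv 2 P) = 0) (fun l hl => ?_)
          ((Nat.mul_le_mul_left d hdeg).trans_lt (by nlinarith))
        rw [Finset.mem_filter] at hl
        refine ⟨(hΛ l hl.1).1, ?_⟩
        rw [hrestr l hl.1, pow_eq_zero_iff two_ne_zero]
        by_contra hy
        exact hl.2 (hall l hl.1 hy)
      refine hz (hdvd _ ((hpd 2).trans (by omega)) fun l hl => ?_)
      refine hvan l hl _ ((hpd 2).trans (by omega)) fun m hm => ?_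
      obtain ⟨x, h1, h2, -⟩ := hcr l hl m hm
      refine ⟨x, h1, ?_⟩
      have hy : l.restr (dir' l.a P) = 0 := by
        obtain ⟨A, hA⟩ := hΔ.1
        have := hΔ.2 l hl
        rw [hA, map_mul, (hΛ l hl).1, zero_mul] at this
        exact pow_eq_zero_iff two_ne_zero |>.1 this.symm
      rw [hy, Polynomial.eval_zero, zero_add] at h2
      exact (mul_eq_zero.1 h2).resolve_left
        (sub_ne_zero.2 (hne m (mem_crossers.1 hm).1 l hl))
  obtain ⟨l, hl, hy, hz⟩ := hex
  have hode := umbilic_ode (hΛ l hl).1 h0 h1 hz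
  choose! x hx hx1 hx2 using hcr l hl
  have hx₀ : ∃ x₀, (l.restr (dir' l.a P)).eval x₀ ≠ 0 := by
    by_contra! hall
    exact hy (hvan l hl _ ((hdir' _).trans (by omega)) fun m hm => ⟨x m, hx m hm, hall _⟩)
  obtain ⟨x₀, hx₀⟩ := hx₀
  have dy : (l.restr (dir' l.a P)).natDegree ≤ d := (l.natDegree_restr_le _).trans (hdir' _)
  obtain ⟨α, β, hαβ⟩ := Polynomial.eq_mul_affine_of_ode hchar (Nat.add_le_add_right dy 1)
    ((l.natDegree_restr_le _).trans ((hpd 2).trans (Nat.le_succ d))) hx₀ hode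
  set y := l.restr (dir' l.a P)
  set M := crossers R P l with hM
  have hcard0 : (M.filter fun m => y.eval (x m) = 0).card ≤ d := by
    refine (card_le_natDegree (l := l) (fun m hm m' hm' => hskew l m (Finset.mem_filter.1 hm).1 m'
      (Finset.mem_filter.1 hm').1) hy fun m hm => ⟨x m, ?_⟩).trans dy
    rw [Finset.mem_filter] at hm
    exact ⟨hx m hm.1, hm.2⟩
  have hkey : ∀ m ∈ M.filter fun m => ¬ y.eval (x m) = 0,
      1 + (m.a - l.a) * (α + β * x m) = 0 := fun m hm => by
    rw [Finset.mem_filter] at hm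
    have := hx1 m hm.1
    rw [hαβ] at this
    simp only [Polynomial.eval_mul, Polynomial.eval_add, Polynomial.eval_C, Polynomial.eval_X]
      at this
    apply mul_left_cancel₀ hm.2
    linear_combination this
  have hmem : ∀ m ∈ M.filter fun m => ¬ y.eval (x m) = 0, m ∈ M := fun m hm =>
    (Finset.mem_filter.1 hm).1
  have heq : ∀ m ∈ M, ∀ m' ∈ M, x m = x m' → m = m' := fun m hm m' hm' h => by
    have h' := hx m' hm'
    rw [← h] at h'
    exact hskew l m hm m' hm' (.of_pt_eq (hx m hm) h')
  have hcard1 : (M.filter fun m => ¬ y.eval (x m) = 0).card ≤ k := by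
    by_cases hβ : β = 0
    · refine (Finset.card_le_card_of_injOn b (t := R.image b) (fun m hm => ?_) ?_).trans hkb
      · exact Finset.mem_image_of_mem _ (mem_crossers.1 (hmem m hm)).1
      · intro m hm m' hm' hb
        refine heq m (hmem m hm) m' (hmem m' hm') ?_
        have e1 := hkey m hm
        have e2 := hkey m' hm'
        have p1 := congrFun (hx m (hmem m hm)) 1
        have p2 := congrFun (hx m' (hmem m' hm')) 1
        simp only [pt, Matrix.cons_val_one, Matrix.cons_val_zero] at p1 p2
        rw [hβ] at e1 e2
        have hα : α ≠ 0 := by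
          rintro rfl
          simp at e1
        have ha : m.a = m'.a := by
          apply mul_left_cancel₀ hα
          linear_combination e1 - e2
        have hs := sub_ne_zero.2 (hne m (mem_crossers.1 (hmem m hm)).1 l hl)
        apply mul_left_cancel₀ hs
        rw [ha] at p1 ⊢
        linear_combination p1 - p2 - hb
    · refine (Finset.card_le_card_of_injOn a (t := R.image a) (fun m hm => ?_) ?_).trans hka
      · exact Finset.mem_image_of_mem _ (mem_crossers.1 (hmem m hm)).1
      · intro m hm m' hm' ha
        refine heq m (hmem m hm) m' (hmem m' hm') ?_
        have e1 := hkey m hm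
        have e2 := hkey m' hm'
        have hs := sub_ne_zero.2 (hne m (mem_crossers.1 (hmem m hm)).1 l hl)
        apply mul_left_cancel₀ (mul_ne_zero hs hβ)
        rw [← ha] at e2
        linear_combination e1 - e2
  have hsum := Finset.card_filter_add_card_filter_not (s := M) (fun m => y.eval (x m) = 0)
  have : k + 5 * d < M.card := (hΛ l hl).2
  omega

end NullLine

namespace NullLine
open MvPolynomial

variable {K : Type*} [Field K]

/-- The light rays of `B` on the surface `P = 0` that meet many light rays of `R` on it. -/
noncomputable def rich (R B : Finset (NullLine K)) (k : ℕ) (P : MvPolynomial (Fin 3) K) :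
    Finset (NullLine K) :=
  B.filter fun l => l.restr P = 0 ∧ k + P.totalDegree < (crossers R P l).card

theorem mem_rich {R B : Finset (NullLine K)} {k : ℕ} {P : MvPolynomial (Fin 3) K}
    {l : NullLine K} : l ∈ rich R B k P ↔
      l ∈ B ∧ l.restr P = 0 ∧ k + P.totalDegree < (crossers R P l).card := by
  simp [rich]

theorem lt_card_crossers_of_mul {R : Finset (NullLine K)} {k : ℕ} {G H : MvPolynomial (Fin 3) K}
    (hR : ∀ m ∈ R, ∀ m' ∈ R, m.Meets m' → m = m') (hG : G ≠ 0) (hH : H ≠ 0) {l : NullLine K}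
    (hl : l.restr H ≠ 0) (h : k + (G * H).totalDegree < (crossers R (G * H) l).card) :
    k + G.totalDegree < (crossers R G l).card := by
  have h1 : ((crossers R (G * H) l) \ crossers R G l).card ≤ H.totalDegree := by
    refine (card_le_natDegree (l := l) (fun m hm m' hm' => ?_) hl fun m hm => ?_).trans
      (l.natDegree_restr_le H)
    · exact hR m (mem_crossers.1 (Finset.mem_sdiff.1 hm).1).1 m'
        (mem_crossers.1 (Finset.mem_sdiff.1 hm').1).1
    · rw [Finset.mem_sdiff, mem_crossers, mem_crossers] at hm
      obtain ⟨⟨hmR, hm0, hml⟩, hm2⟩ := hm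
      have hmH : m.restr H = 0 := by
        rw [map_mul] at hm0
        exact (mul_eq_zero.1 hm0).resolve_left fun h0 => hm2 ⟨hmR, h0, hml⟩
      obtain ⟨x, hx⟩ := hml
      refine ⟨x, hx, ?_⟩
      rw [eval_restr, ← hx, ← eval_restr, hmH, Polynomial.eval_zero]
  have h2 := Finset.card_le_card_sdiff_add_card (t := crossers R G l) (s := crossers R (G * H) l)
  rw [totalDegree_mul_of_isDomain hG hH] at h
  omega

theorem card_rich_mul_le {R B : Finset (NullLine K)} {k : ℕ} {G H : MvPolynomial (Fin 3) K}
    (hR : ∀ m ∈ R, ∀ m' ∈ R, m.Meets m' → m = m') (hG : G ≠ 0) (hH : H ≠ 0)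
    (hrel : ∀ X, G ∣ H * X → G ∣ X) : (rich R B k (G * H)).card ≤
      (rich R B k G).card + (rich R B k H).card + G.totalDegree * H.totalDegree := by
  have hsub : rich R B k (G * H) ⊆ (rich R B k G ∪ rich R B k H) ∪
      B.filter fun l => l.restr G = 0 ∧ l.restr H = 0 := by
    intro l hl
    obtain ⟨hlB, hl0, hlc⟩ := mem_rich.1 hl
    simp only [Finset.mem_union, mem_rich, Finset.mem_filter]
    rw [map_mul, mul_eq_zero] at hl0
    by_cases h1 : l.restr G = 0
    · by_cases h2 : l.restr H = 0
      · exact .inr ⟨hlB, h1, h2⟩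
      · exact .inl (.inl ⟨hlB, h1, lt_card_crossers_of_mul hR hG hH h2 hlc⟩)
    · rw [mul_comm] at hlc
      exact .inl (.inr ⟨hlB, hl0.resolve_left h1, lt_card_crossers_of_mul hR hH hG h1 hlc⟩)
  refine (Finset.card_le_card hsub).trans ((Finset.card_union_le _ _).trans ?_)
  exact Nat.add_le_add (Finset.card_union_le _ _)
    (bezout hG hrel _ fun l hl => (Finset.mem_filter.1 hl).2)

theorem exists_prime_rich {R B : Finset (NullLine K)} {k : ℕ}
    (hR : ∀ m ∈ R, ∀ m' ∈ R, m.Meets m' → m = m') (n : ℕ) : ∀ P : MvPolynomial (Fin 3) K,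
    P.totalDegree = n → P ≠ 0 → 4 * P.totalDegree ^ 2 < (rich R B k P).card →
    ∃ Q : MvPolynomial (Fin 3) K, Prime Q ∧ Q.totalDegree ≤ P.totalDegree ∧
      4 * Q.totalDegree ^ 2 < (rich R B k Q).card := by
  induction n using Nat.strong_induction_on with
  | _ n ih =>
  intro P hn hP h
  have hunit : ¬ IsUnit P := by
    intro hu
    obtain ⟨l, hl⟩ := Finset.card_pos.1 (Nat.zero_lt_of_lt h)
    exact (hu.map l.restr).ne_zero (mem_rich.1 hl).2.1
  obtain ⟨π, hπ, Q, rfl⟩ := WfDvdMonoid.exists_irreducible_factor hunit hP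
  have hπp := hπ.prime
  have hQ := right_ne_zero_of_mul hP
  have hd := totalDegree_mul_of_isDomain hπp.ne_zero hQ
  have hpos := totalDegree_pos_of_prime hπp
  have descend : 4 * Q.totalDegree ^ 2 < (rich R B k Q).card →
      ∃ Q' : MvPolynomial (Fin 3) K, Prime Q' ∧ Q'.totalDegree ≤ (π * Q).totalDegree ∧
      4 * Q'.totalDegree ^ 2 < (rich R B k Q').card := fun hQr => by
    obtain ⟨Q', h1, h2, h3⟩ := ih Q.totalDegree (by omega) Q rfl hQ hQr
    exact ⟨Q', h1, h2.trans (by omega), h3⟩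
  by_cases hdvd : π ∣ Q
  · refine descend (lt_of_le_of_lt ?_ (h.trans_le (Finset.card_le_card fun l hl => ?_)))
    · gcongr
      omega
    · have hz : ∀ m : NullLine K, m.restr (π * Q) = 0 → m.restr Q = 0 := fun m hm => by
        obtain ⟨X, hX⟩ := hdvd
        rw [map_mul, mul_eq_zero] at hm
        refine hm.elim (fun h0 => ?_) id
        rw [hX, map_mul, h0, zero_mul]
      obtain ⟨hlB, hl0, hlc⟩ := mem_rich.1 hl
      refine mem_rich.2 ⟨hlB, hz l hl0, ?_⟩
      refine lt_of_lt_of_le (by omega) (hlc.trans_le (Finset.card_le_card fun m hm => ?_)).le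
      obtain ⟨h1, h2, h3⟩ := mem_crossers.1 hm
      exact mem_crossers.2 ⟨h1, hz m h2, h3⟩
  · have hle := card_rich_mul_le (B := B) (k := k) hR hπp.ne_zero hQ
      (fun X hX => (hπp.dvd_or_dvd hX).resolve_left hdvd)
    by_cases hπr : 4 * π.totalDegree ^ 2 < (rich R B k π).card
    · exact ⟨π, hπp, by omega, hπr⟩
    · refine descend ?_
      rw [hd] at h
      nlinarith

/-- Pairwise skew light rays cannot be met too often by many light rays. -/
theorem card_le_of_many_crossings {R B : Finset (NullLine K)} {k d : ℕ}
    (hR : ∀ m ∈ R, ∀ m' ∈ R, m.Meets m' → m = m') (hne : ∀ m ∈ R, ∀ l ∈ B, m.a ≠ l.a)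
    (hka : (R.image a).card ≤ k) (hkb : (R.image b).card ≤ k)
    (hchar : ∀ m : ℕ, 0 < m → m ≤ d + 1 → (m : K) ≠ 0)
    (hd : 6 * R.card < (d + 2) * (d + 3))
    (hB : ∀ l ∈ B, k + 5 * d < (R.filter fun m => m.Meets l).card) : B.card ≤ 4 * d ^ 2 := by
  by_contra! hlt
  obtain ⟨P, hP, hPd, hPR⟩ := exists_vanishing R d hd
  have hrich : rich R B (k + 4 * d) P = B := by
    refine Finset.Subset.antisymm (Finset.filter_subset _ _) fun l hl => ?_
    have hcr : crossers R P l = R.filter fun m => m.Meets l :=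
      Finset.filter_congr fun m hm => by simp [hPR m hm]
    have := hB l hl
    refine mem_rich.2 ⟨hl, restr_eq_zero_of_lt_card (M := R.filter fun m => m.Meets l)
      (fun m hm m' hm' => hR m (Finset.mem_filter.1 hm).1 m' (Finset.mem_filter.1 hm').1)
      (fun m hm => ?_) (by omega), by rw [hcr]; omega⟩
    obtain ⟨hmR, x, hx⟩ := Finset.mem_filter.1 hm
    refine ⟨x, hx, ?_⟩
    rw [eval_restr, ← hx, ← eval_restr, hPR m hmR, Polynomial.eval_zero]
  obtain ⟨Q, hQ, hQd, hQr⟩ := exists_prime_rich hR _ P rfl hP (by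
    rw [hrich]
    refine lt_of_le_of_lt ?_ hlt
    gcongr)
  refine false_of_umbilic hQ hR (fun m hm l hl => hne m hm l (mem_rich.1 hl).1) hka hkb
    (fun m hm0 hm => hchar m hm0 (by omega)) (fun l hl => ?_) hQr
  obtain ⟨-, h1, h2⟩ := mem_rich.1 hl
  exact ⟨h1, by omega⟩

end NullLine

theorem Finset.le_mul_of_subadditive {α : Type*} {T : Finset α} {f : Finset α → ℕ} {b M : ℕ}
    (h0 : f ∅ = 0) (hf : ∀ X ⊆ T, ∀ Y ⊆ X, f X ≤ f Y + f (X \ Y))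
    (hM : ∀ Y ⊆ T, Y.card ≤ b → f Y ≤ M) (a : ℕ) :
    ∀ X ⊆ T, X.card ≤ a * b → f X ≤ a * M := by
  induction a with
  | zero =>
    intro X _ hX
    rw [zero_mul, Nat.le_zero, Finset.card_eq_zero] at hX
    simp [hX, h0]
  | succ a ih =>
    intro X hXT hX
    obtain ⟨Y, hYX, hY⟩ := Finset.exists_subset_card_eq (min_le_left X.card b)
    have h1 := hM Y (hYX.trans hXT) (by omega)
    have h2 := ih (X \ Y) (Finset.sdiff_subset.trans hXT) (by
      rw [Finset.card_sdiff_of_subset hYX, hY]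
      rw [add_mul, one_mul] at hX
      omega)
    calc f X ≤ f Y + f (X \ Y) := hf X hXT Y hYX
      _ ≤ (a + 1) * M := by rw [add_mul, one_mul]; omega

/-- The number of related pairs in `R × B`. -/
noncomputable def incidences {α : Type*} (r : α → α → Prop) (R B : Finset α) : ℕ :=
  ∑ y ∈ B, (R.filter fun x => r x y).card

theorem incidences_sdiff_left {α : Type*} (r : α → α → Prop) {R Y : Finset α} (B : Finset α)
    (h : Y ⊆ R) : incidences r R B = incidences r Y B + incidences r (R \ Y) B := by
  rw [incidences, incidences, incidences, ← Finset.sum_add_distrib]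
  refine Finset.sum_congr rfl fun y _ => ?_
  rw [← Finset.card_union_of_disjoint (Finset.disjoint_filter_filter Finset.disjoint_sdiff),
    ← Finset.filter_union, Finset.union_sdiff_of_subset h]

theorem incidences_sdiff_right {α : Type*} (r : α → α → Prop) (R : Finset α) {B Y : Finset α}
    (h : Y ⊆ B) : incidences r R B = incidences r R Y + incidences r R (B \ Y) := by
  rw [incidences, incidences, incidences, add_comm, Finset.sum_sdiff h]

/-- A recursive bound for the number of incidences under the hypothesis that sets with few
elements have few rich neighbours. -/
theorem incidences_le_of_rich {α : Type*} {T : Finset α} {r : α → α → Prop} {k s M : ℕ}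
    (hs : 51 ≤ s)
    (H : ∀ R ⊆ T, ∀ B ⊆ T, ∀ j < M, R.card ≤ (s ^ 2) ^ j →
      (∀ y ∈ B, k + 15 * s ^ j < (R.filter fun x => r x y).card) → B.card ≤ 36 * (s ^ 2) ^ j)
    (i : ℕ) (hi : i ≤ M) : ∀ R ⊆ T, ∀ B ⊆ T, R.card ≤ (s ^ 2) ^ i → B.card ≤ (s ^ 2) ^ i →
      incidences r R B + (s ^ 2) ^ (i + 1) * k ≤
        (s ^ 2) ^ i * (36 ^ i * (1 + s ^ 2 * k) + s ^ 2 * s ^ i) := by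
  induction i with
  | zero =>
    intro R _ B _ hR hB
    have h1 : incidences r R B ≤ B.card * 1 := by
      rw [incidences, ← smul_eq_mul]
      exact Finset.sum_le_card_nsmul _ _ _ fun y _ => (Finset.card_filter_le _ _).trans hR
    simp only [pow_zero, zero_add, pow_one, one_mul, mul_one] at *
    have : 0 < s ^ 2 := by positivity
    omega
  | succ i ih =>
    intro R hR B hB hRc hBc
    set J := s ^ 2 with hJ
    have hstep : ∀ Y ⊆ T, Y.card ≤ J ^ i → incidences r Y B + J ^ (i + 1) * k * 35 ≤
        J ^ i * (36 ^ (i + 1) * (1 + J * k) + J * (51 * s ^ i)) := by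
      intro Y hY hYc
      set B₁ := B.filter fun y => k + 15 * s ^ i < (Y.filter fun x => r x y).card with hB₁
      have hB₁B : B₁ ⊆ B := Finset.filter_subset _ _
      have h1 : incidences r Y (B \ B₁) ≤ J ^ (i + 1) * (k + 15 * s ^ i) := by
        refine (Finset.sum_le_card_nsmul _ _ (k + 15 * s ^ i) fun y hy => ?_).trans ?_
        · rw [Finset.mem_sdiff, hB₁, Finset.mem_filter] at hy
          by_contra! hlt
          exact hy.2 ⟨hy.1, hlt⟩
        · rw [smul_eq_mul]
          exact Nat.mul_le_mul_right _ ((Finset.card_le_card Finset.sdiff_subset).trans hBc)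
      have h2 : B₁.card ≤ 36 * J ^ i := H Y hY B₁ (hB₁B.trans hB) i (by omega) hYc
        fun y hy => (Finset.mem_filter.1 hy).2
      set W := J ^ i * (36 ^ i * (1 + J * k) + J * s ^ i) with hW
      have h3 : incidences r Y B₁ ≤ 36 * (W - J ^ (i + 1) * k) :=
        Finset.le_mul_of_subadditive (T := T) (f := incidences r Y) (b := J ^ i)
          (by simp [incidences])
          (fun X _ Z hZ => (incidences_sdiff_right r Y hZ).le)
          (fun Z hZ hZc => by
            have := ih (by omega) Y hY Z hZ hYc hZc
            omega) 36 B₁ (hB₁B.trans hB) h2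
      have h4 : J ^ (i + 1) * k ≤ W := by
        have := ih (by omega) ∅ (by simp) ∅ (by simp) (by simp) (by simp)
        omega
      have h5 := incidences_sdiff_right r Y hB₁B
      have h6 : incidences r Y B + J ^ (i + 1) * k * 36 ≤
          J ^ (i + 1) * (k + 15 * s ^ i) + 36 * W := by omega
      have h7 : J ^ (i + 1) * (k + 15 * s ^ i) + 36 * W = J ^ (i + 1) * k +
          J ^ i * (36 ^ (i + 1) * (1 + J * k) + J * (51 * s ^ i)) := by
        rw [hW]
        ring
      omega
    set V := J ^ i * (36 ^ (i + 1) * (1 + J * k) + J * (51 * s ^ i)) with hV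
    have hle : J ^ (i + 1) * k * 35 ≤ V := by
      have := hstep ∅ (by simp) (by simp)
      omega
    have h1 : incidences r R B ≤ J * (V - J ^ (i + 1) * k * 35) :=
      Finset.le_mul_of_subadditive (T := T) (f := fun R => incidences r R B) (b := J ^ i)
        (by simp [incidences])
        (fun X _ Z hZ => (incidences_sdiff_left r B hZ).le)
        (fun Z hZ hZc => by
          have := hstep Z hZ hZc
          change incidences r Z B ≤ _
          omega) J R hR (by rw [← pow_succ']; exact hRc)
    have h2 : J * (V - J ^ (i + 1) * k * 35) + J * (J ^ (i + 1) * k * 35) = J * V := by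
      rw [← mul_add, Nat.sub_add_cancel hle]
    have h3 : J * V ≤ J ^ (i + 1) * (36 ^ (i + 1) * (1 + J * k) + J * s ^ (i + 1)) := by
      rw [hV, ← mul_assoc, ← pow_succ', pow_succ' s]
      gcongr
    have h4 : J ^ (i + 1 + 1) * k ≤ J * (J ^ (i + 1) * k * 35) := by
      rw [pow_succ' J (i + 1)]
      nlinarith [Nat.zero_le (J * J ^ (i + 1) * k)]
    omega

theorem exists_incidences_le : ∃ C : ℝ, 0 < C ∧ ∀ {α : Type} {T : Finset α} {r : α → α → Prop}
    {k : ℕ} {ν : ℝ}, 1 ≤ ν → (T.card : ℝ) ≤ ν ^ 8 → (k : ℝ) ≤ 2 * ν ^ 3 →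
    (∀ R ⊆ T, ∀ B ⊆ T, ∀ d : ℕ, (d : ℝ) ≤ 3 * ν ^ 4 → 6 * R.card < (d + 2) * (d + 3) →
      (∀ y ∈ B, k + 5 * d < (R.filter fun x => r x y).card) → B.card ≤ 4 * d ^ 2) →
    (incidences r T T : ℝ) ≤ C * ν ^ 12 := by
  obtain ⟨s, hs, hs36⟩ : ∃ s : ℕ, 51 ≤ s ∧ s = 36 ^ 4 := ⟨36 ^ 4, by norm_num, rfl⟩
  have hs1 : (1 : ℝ) < s := by exact_mod_cast (by omega : 1 < s)
  have hs36' : (s : ℝ) = 36 ^ 4 := by exact_mod_cast hs36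
  clear hs36
  refine ⟨(s : ℝ) ^ 2 * (36 * (1 + (s : ℝ) ^ 2 * 2) + (s : ℝ) ^ 2 * s), by positivity, ?_⟩
  intro α T r k ν hν hT hk H
  have hex : ∃ N : ℕ, ν ^ 4 ≤ (s : ℝ) ^ N := by
    obtain ⟨N, hN⟩ := pow_unbounded_of_one_lt (ν ^ 4) hs1
    exact ⟨N, hN.le⟩
  set N := Nat.find hex with hN
  have hN1 : ν ^ 4 ≤ (s : ℝ) ^ N := Nat.find_spec hex
  have hN2 : ∀ j < N, (s : ℝ) ^ j < ν ^ 4 := fun j hj => not_le.1 (Nat.find_min hex hj)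
  have hν4 : 1 ≤ ν ^ 4 := one_le_pow₀ hν
  have hN3 : (s : ℝ) ^ N ≤ s * ν ^ 4 ∧ (36 : ℝ) ^ N ≤ 36 * ν := by
    rcases Nat.eq_zero_or_pos N with h0 | hpos
    · rw [h0]
      constructor <;> nlinarith
    · obtain ⟨j, hj⟩ := Nat.exists_eq_succ_of_ne_zero hpos.ne'
      have h1 := hN2 j (by omega)
      rw [hj, Nat.succ_eq_add_one, pow_succ' (s : ℝ), pow_succ' (36 : ℝ)]
      refine ⟨by gcongr, ?_⟩
      rw [hs36', ← pow_mul, mul_comm, pow_mul] at h1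
      have := lt_of_pow_lt_pow_left₀ 4 (by linarith) h1
      linarith
  have hTN : T.card ≤ (s ^ 2) ^ N := by
    have h1 : (T.card : ℝ) ≤ ((s : ℝ) ^ 2) ^ N := by
      rw [← pow_mul, mul_comm, pow_mul]
      refine hT.trans ?_
      rw [show ν ^ 8 = (ν ^ 4) ^ 2 by ring]
      gcongr
    exact_mod_cast h1
  have hmain := incidences_le_of_rich (T := T) (r := r) (k := k) (M := N) hs
    (fun R hR B hB j hj hRj h => by
      have := H R hR B hB (3 * s ^ j) ?_ ?_ ?_
      · rw [mul_pow, ← pow_mul, mul_comm j 2, pow_mul] at this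
        linarith
      · push_cast
        have := hN2 j hj
        linarith
      · rw [← pow_mul, mul_comm 2 j, pow_mul] at hRj
        have : (3 * s ^ j + 2) * (3 * s ^ j + 3) = 9 * (s ^ j) ^ 2 + 15 * s ^ j + 6 := by ring
        omega
      · intro y hy
        have := h y hy
        linarith) N le_rfl T subset_rfl T subset_rfl hTN hTN
  have hmain' : (incidences r T T : ℝ) ≤
      ((s : ℝ) ^ N) ^ 2 * (36 ^ N * (1 + (s : ℝ) ^ 2 * k) + (s : ℝ) ^ 2 * (s : ℝ) ^ N) := by
    rw [← pow_mul, mul_comm N 2, pow_mul]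
    exact_mod_cast (Nat.le_add_right _ _).trans hmain
  have hν3 : 1 ≤ ν ^ 3 := one_le_pow₀ hν
  refine hmain'.trans ?_
  calc _ ≤ (s * ν ^ 4) ^ 2 * ((36 * ν) * (1 * ν ^ 3 + (s : ℝ) ^ 2 * (2 * ν ^ 3)) +
        (s : ℝ) ^ 2 * (s * ν ^ 4)) := by
        gcongr
        · exact hN3.1
        · exact hN3.2
        · linarith
        · exact hN3.1
    _ = _ := by ring

namespace NullLine

theorem Meets.sub_eq {K : Type*} [Field K] {l m : NullLine K} (h : l.Meets m) :
    m.c - l.c = (l.a + m.a) * (m.b - l.b) := by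
  obtain ⟨x, hx⟩ := h
  have h1 := congrFun hx 1
  have h2 := congrFun hx 2
  simp only [pt, Matrix.cons_val_one, Matrix.cons_val_zero, Matrix.cons_val] at h1 h2
  linear_combination (l.a + m.a) * h1 - h2

theorem meets_of_sub_eq {K : Type*} [Field K] {l m : NullLine K} (ha : l.a ≠ m.a)
    (h : m.c - l.c = (l.a + m.a) * (m.b - l.b)) : l.Meets m := by
  have hne := sub_ne_zero.2 ha
  have h0 : l.a * ((m.b - l.b) / (l.a - m.a)) + l.b = m.a * ((m.b - l.b) / (l.a - m.a)) + m.b := by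
    field_simp
    ring
  refine ⟨(m.b - l.b) / (l.a - m.a), ?_⟩
  rw [pt, pt, h0]
  congr 3
  linear_combination (l.a + m.a) * h0 - h

end NullLine

/-- The symmetric incidence relation between triples induced by a null polarity. -/
def Conjugate {F : Type*} [Field F] (q q' : F × F × F) : Prop :=
  q'.2.2 - q.2.2 = q.1 * q'.2.1 - q'.1 * q.2.1

theorem RatFunc.quadratic_eq_zero {F : Type*} [Field F] {u v w : F}
    (h : C u + C v * X + C w * X ^ 2 = 0) : u = 0 ∧ v = 0 ∧ w = 0 := by
  have h1 : algebraMap (Polynomial F) (RatFunc F)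
      (Polynomial.C u + Polynomial.C v * Polynomial.X + Polynomial.C w * Polynomial.X ^ 2) = 0 := by
    simpa using h
  have h2 := (map_eq_zero_iff _ (RatFunc.algebraMap_injective F)).1 h1
  have e0 := congrArg (Polynomial.coeff · 0) h2
  have e1 := congrArg (Polynomial.coeff · 1) h2
  have e2 := congrArg (Polynomial.coeff · 2) h2
  simp [Polynomial.coeff_X, Polynomial.coeff_C, Polynomial.coeff_X_pow] at e0 e1 e2
  exact ⟨e0, e1, e2⟩

theorem card_le_of_many_conjugate {F : Type*} [Field F] {R B : Finset (F × F × F)} {k d : ℕ}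
    (hka : (R.image fun q => q.1).card ≤ k) (hkb : (R.image fun q => q.2.1).card ≤ k)
    (hchar : ∀ m : ℕ, 0 < m → m ≤ d + 1 → (m : F) ≠ 0)
    (hd : 6 * R.card < (d + 2) * (d + 3))
    (hB : ∀ y ∈ B, k + 5 * d < (R.filter fun x => Conjugate x y).card) : B.card ≤ 4 * d ^ 2 := by
  let θ : RatFunc F := RatFunc.X
  let φ : F →+* RatFunc F := RatFunc.C
  have hφ : Function.Injective φ := φ.injective
  have hquad : ∀ {u v w : F}, φ u + φ v * θ + φ w * θ ^ 2 = 0 → u = 0 ∧ v = 0 ∧ w = 0 :=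
    fun h => RatFunc.quadratic_eq_zero h
  let red : F × F × F → NullLine (RatFunc F) := fun q =>
    ⟨φ q.1, φ q.2.1, φ q.2.2 + θ * φ q.2.1 + θ ^ 2 * φ q.1 + φ q.1 * φ q.2.1⟩
  let blue : F × F × F → NullLine (RatFunc F) := fun q =>
    ⟨φ q.1 + θ, φ q.2.1 - θ ^ 2, φ q.2.2 + (φ q.1 + θ) * (φ q.2.1 - θ ^ 2)⟩
  have hne : ∀ q q', (red q).a ≠ (blue q').a := fun q q' h => by
    have h1 : φ (q'.1 - q.1) + φ 1 * θ + φ 0 * θ ^ 2 = 0 := by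
      simp only [red, blue] at h
      rw [map_sub, map_one, map_zero, h]
      ring
    exact one_ne_zero (hquad h1).2.1
  have hredinj : ∀ q q', (red q).Meets (red q') → q = q' := fun q q' h => by
    have h1 := h.sub_eq
    simp only [red] at h1
    obtain ⟨e0, e1, e2⟩ := hquad (u := q'.2.2 - q.2.2 - (q.1 * q'.2.1 - q'.1 * q.2.1))
      (v := q'.2.1 - q.2.1) (w := q'.1 - q.1) (by
        simp only [map_sub, map_mul]
        linear_combination h1)
    rw [sub_eq_zero] at e1 e2
    rw [e1, e2, mul_comm, sub_self, sub_zero, sub_eq_zero] at e0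
    exact Prod.ext e2.symm (Prod.ext e1.symm e0.symm)
  have hblueinj : Function.Injective blue := fun q q' h => by
    have h1 := congrArg NullLine.a h
    have h2 := congrArg NullLine.b h
    have h3 := congrArg NullLine.c h
    simp only [blue, add_left_inj, sub_left_inj] at h1 h2 h3
    rw [h1, h2, add_left_inj] at h3
    exact Prod.ext (hφ h1) (Prod.ext (hφ h2) (hφ h3))
  have hmeet : ∀ q q', Conjugate q q' → (red q).Meets (blue q') := fun q q' h => by
    refine NullLine.meets_of_sub_eq (hne q q') ?_
    have := congrArg φ h
    simp only [map_sub, map_mul] at this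
    simp only [red, blue]
    linear_combination this
  have hredinj' : Function.Injective red := fun q q' h => hredinj q q' ⟨0, by rw [h]⟩
  rw [← Finset.card_image_of_injective B hblueinj]
  refine NullLine.card_le_of_many_crossings (R := R.image red) (k := k) ?_ ?_ ?_ ?_ ?_ ?_ ?_
  · intro m hm m' hm' h
    obtain ⟨q, -, rfl⟩ := Finset.mem_image.1 hm
    obtain ⟨q', -, rfl⟩ := Finset.mem_image.1 hm'
    rw [hredinj q q' h]
  · intro m hm l hl
    obtain ⟨q, -, rfl⟩ := Finset.mem_image.1 hm
    obtain ⟨q', -, rfl⟩ := Finset.mem_image.1 hl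
    exact hne q q'
  · rw [Finset.image_image, show NullLine.a ∘ red = φ ∘ fun q => q.1 from rfl,
      ← Finset.image_image, Finset.card_image_of_injective _ hφ]
    exact hka
  · rw [Finset.image_image, show NullLine.b ∘ red = φ ∘ fun q => q.2.1 from rfl,
      ← Finset.image_image, Finset.card_image_of_injective _ hφ]
    exact hkb
  · intro m h0 hm h
    rw [← map_natCast φ, map_eq_zero] at h
    exact hchar m h0 hm h
  · rwa [Finset.card_image_of_injective _ hredinj']
  · intro l hl
    obtain ⟨y, hy, rfl⟩ := Finset.mem_image.1 hl
    refine (hB y hy).trans_le ?_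
    rw [← Finset.card_image_of_injective _ hredinj']
    refine Finset.card_le_card fun m hm => ?_
    obtain ⟨q, hq, rfl⟩ := Finset.mem_image.1 hm
    rw [Finset.mem_filter] at hq ⊢
    exact ⟨Finset.mem_image_of_mem _ hq.1, hmeet q y hq.2⟩

theorem incidences_eq_card {α : Type*} (r : α → α → Prop) (R B : Finset α) :
    incidences r R B = ((R ×ˢ B).filter fun z => r z.1 z.2).card := by
  rw [incidences, Finset.card_filter, Finset.sum_product_right]
  exact Finset.sum_congr rfl fun y _ => Finset.card_filter _ _

theorem exists_incidences_conjugate_le : ∃ C : ℝ, 0 < C ∧ ∀ {F : Type} [Field F]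
    {T : Finset (F × F × F)} {k : ℕ} {ν : ℝ}, 1 ≤ ν → (T.card : ℝ) ≤ ν ^ 8 → (k : ℝ) ≤ 2 * ν ^ 3 →
    (T.image fun q => q.1).card ≤ k → (T.image fun q => q.2.1).card ≤ k →
    (∀ m : ℕ, 0 < m → (m : ℝ) ≤ 4 * ν ^ 4 → (m : F) ≠ 0) →
    (incidences Conjugate T T : ℝ) ≤ C * ν ^ 12 := by
  obtain ⟨C, hC, h⟩ := exists_incidences_le
  refine ⟨C, hC, fun {F _ T k ν} hν hT hk hka hkb hchar => h hν hT hk ?_⟩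
  intro R hR B _ d hd hRd hB
  refine card_le_of_many_conjugate
    ((Finset.card_le_card (Finset.image_subset_image hR)).trans hka)
    ((Finset.card_le_card (Finset.image_subset_image hR)).trans hkb)
    (fun m h0 hm => hchar m h0 ?_) hRd hB
  have h1 : (m : ℝ) ≤ d + 1 := by exact_mod_cast hm
  have h2 : 1 ≤ ν ^ 4 := one_le_pow₀ hν
  linarith

section Energy

variable {F : Type*} [Field F] {S : Finset F}

theorem sq_mul_mulEnergy_le_incidences (h0 : 0 ∉ S) :
    S.card ^ 2 * S.mulEnergy S ≤ incidences Conjugate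
      (((S + S) ×ˢ S ×ˢ S).image fun z => (z.1, z.2.1, z.2.2 * z.2.1))
      (((S + S) ×ˢ S ×ˢ S).image fun z => (z.1, z.2.1, z.2.2 * z.2.1)) := by
  rw [incidences_eq_card, Finset.mulEnergy, sq, ← Finset.card_product, ← Finset.card_product]
  refine Finset.card_le_card_of_injOn (fun z => ((z.2.1.1 + z.1.1, z.2.2.2, z.1.2 * z.2.2.2),
    (z.2.1.2 + z.1.2, z.2.2.1, z.1.1 * z.2.2.1))) ?_ ?_
  · rintro ⟨⟨b, b'⟩, ⟨a, a'⟩, c, c'⟩ hz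
    simp only [Finset.coe_product, Finset.coe_filter, Set.mem_prod, Finset.mem_coe,
      Set.mem_ofPred_eq, Finset.mem_product] at hz
    obtain ⟨⟨hb, hb'⟩, ⟨⟨ha, ha'⟩, hc, hc'⟩, h⟩ := hz
    simp only [Finset.coe_filter, Set.mem_ofPred_eq, Finset.mem_product, Finset.mem_image]
    refine ⟨⟨⟨(a + b, c', b'), ⟨Finset.add_mem_add ha hb, hc', hb'⟩, rfl⟩,
      ⟨(a' + b', c, b), ⟨Finset.add_mem_add ha' hb', hc, hb⟩, rfl⟩⟩, ?_⟩
    simp only [Conjugate]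
    linear_combination -h
  · rintro ⟨⟨b, b'⟩, ⟨a, a'⟩, c, c'⟩ hz ⟨⟨b₁, b₁'⟩, ⟨a₁, a₁'⟩, c₁, c₁'⟩ - h
    simp only [Finset.coe_product, Finset.coe_filter, Set.mem_prod, Finset.mem_coe,
      Set.mem_ofPred_eq, Finset.mem_product] at hz
    have hc : c ≠ 0 := fun h => h0 (h ▸ hz.2.1.2.1)
    have hc' : c' ≠ 0 := fun h => h0 (h ▸ hz.2.1.2.2)
    simp only [Prod.mk.injEq] at h
    obtain ⟨⟨h1, rfl, h3⟩, h4, rfl, h6⟩ := h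
    obtain rfl := mul_right_cancel₀ hc' h3
    obtain rfl := mul_right_cancel₀ hc h6
    rw [add_left_inj] at h1 h4
    rw [h1, h4]

theorem sq_mul_addEnergy_le_incidences (h0 : 0 ∉ S) :
    S.card ^ 2 * S.addEnergy S ≤
      incidences Conjugate ((S * S) ×ˢ S⁻¹ ×ˢ S) ((S * S) ×ˢ S⁻¹ ×ˢ S) := by
  rw [incidences_eq_card, Finset.addEnergy, sq, ← Finset.card_product, ← Finset.card_product]
  refine Finset.card_le_card_of_injOn (fun z => ((z.2.1.1 * z.1.1, z.1.2⁻¹, z.2.2.1),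
    (z.2.1.2 * z.1.2, z.1.1⁻¹, z.2.2.2))) ?_ ?_
  · rintro ⟨⟨e, e'⟩, ⟨a, a'⟩, c, c'⟩ hz
    simp only [Finset.coe_product, Finset.coe_filter, Set.mem_prod, Finset.mem_coe,
      Set.mem_ofPred_eq, Finset.mem_product] at hz
    obtain ⟨⟨he, he'⟩, ⟨⟨ha, ha'⟩, hc, hc'⟩, h⟩ := hz
    simp only [Finset.coe_filter, Set.mem_ofPred_eq, Finset.mem_product]
    refine ⟨⟨⟨Finset.mul_mem_mul ha he, Finset.inv_mem_inv he', hc⟩,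
      Finset.mul_mem_mul ha' he', Finset.inv_mem_inv he, hc'⟩, ?_⟩
    simp only [Conjugate]
    rw [mul_inv_cancel_right₀ fun h => h0 (h ▸ he), mul_inv_cancel_right₀ fun h => h0 (h ▸ he')]
    linear_combination -h
  · rintro ⟨⟨e, e'⟩, ⟨a, a'⟩, c, c'⟩ hz ⟨⟨e₁, e₁'⟩, ⟨a₁, a₁'⟩, c₁, c₁'⟩ - h
    simp only [Finset.coe_product, Finset.coe_filter, Set.mem_prod, Finset.mem_coe,
      Set.mem_ofPred_eq, Finset.mem_product] at hz
    have he : e ≠ 0 := fun h => h0 (h ▸ hz.1.1)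
    have he' : e' ≠ 0 := fun h => h0 (h ▸ hz.1.2)
    simp only [Prod.mk.injEq, inv_inj] at h
    obtain ⟨⟨h1, rfl, rfl⟩, h4, rfl, rfl⟩ := h
    rw [mul_right_cancel₀ he h1, mul_right_cancel₀ he' h4]

end Energy

theorem exists_sum_product_bound : ∃ C : ℝ, 0 < C ∧ ∀ {F : Type} [Field F] {S : Finset F} {m : ℕ}
    {ν : ℝ}, 0 ∉ S → 1 ≤ ν → (m : ℝ) * (S.card : ℝ) ^ 2 ≤ ν ^ 8 → (m : ℝ) ≤ 2 * ν ^ 3 →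
    S.card ≤ m → (∀ m : ℕ, 0 < m → (m : ℝ) ≤ 4 * ν ^ 4 → (m : F) ≠ 0) →
    ((S + S).card ≤ m → (S.card : ℝ) ^ 6 ≤ C * ν ^ 12 * (S * S).card) ∧
    ((S * S).card ≤ m → (S.card : ℝ) ^ 6 ≤ C * ν ^ 12 * (S + S).card) := by
  obtain ⟨C, hC, h⟩ := exists_incidences_conjugate_le
  have hcomb : ∀ {n E I M : ℕ} {x : ℝ}, n ^ 2 * E ≤ I → n ^ 2 * n ^ 2 ≤ M * E → (I : ℝ) ≤ x →
      (n : ℝ) ^ 6 ≤ x * M := by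
    intro n E I M x h1 h2 h3
    have h4 : n ^ 6 ≤ I * M := by
      calc n ^ 6 = n ^ 2 * (n ^ 2 * n ^ 2) := by ring
        _ ≤ n ^ 2 * (M * E) := by gcongr
        _ = n ^ 2 * E * M := by ring
        _ ≤ _ := by gcongr
    calc (n : ℝ) ^ 6 ≤ I * M := by exact_mod_cast h4
      _ ≤ _ := by gcongr
  refine ⟨C, hC, fun {F _ S m ν} h0 hν hS hm hSm hchar => ⟨fun hadd => ?_, fun hmul => ?_⟩⟩
  · refine hcomb (sq_mul_mulEnergy_le_incidences h0) (Finset.le_card_mul_mul_mulEnergy S S)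
      (h (k := m) hν (le_trans ?_ hS) hm ?_ ?_ hchar)
    · have : ((S + S) ×ˢ S ×ˢ S).card ≤ m * S.card ^ 2 := by
        rw [Finset.card_product, Finset.card_product, ← sq S.card]
        gcongr
      exact_mod_cast Finset.card_image_le.trans this
    · refine (Finset.card_le_card ?_).trans hadd
      rw [Finset.image_image]
      refine Finset.image_subset_iff.2 fun z hz => (Finset.mem_product.1 hz).1
    · refine (Finset.card_le_card ?_).trans hSm
      rw [Finset.image_image]
      exact Finset.image_subset_iff.2 fun z hz =>
        (Finset.mem_product.1 (Finset.mem_product.1 hz).2).1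
  · refine hcomb (sq_mul_addEnergy_le_incidences h0) (Finset.le_card_add_mul_addEnergy S S)
      (h (k := m) hν (le_trans ?_ hS) hm ?_ ?_ hchar)
    · have : ((S * S) ×ˢ S⁻¹ ×ˢ S).card ≤ m * S.card ^ 2 := by
        rw [Finset.card_product, Finset.card_product, Finset.card_inv, ← sq S.card]
        gcongr
      exact_mod_cast this
    · refine (Finset.card_le_card ?_).trans hmul
      exact Finset.image_subset_iff.2 fun z hz => (Finset.mem_product.1 hz).1
    · rw [← Finset.card_inv S] at hSm
      refine (Finset.card_le_card ?_).trans hSm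
      exact Finset.image_subset_iff.2 fun z hz =>
        (Finset.mem_product.1 (Finset.mem_product.1 hz).2).1

theorem le_max_of_energy_bound {C D : ℝ} {n m M : ℕ} (hC : 0 < C) (hn : 0 < n) (hm : 0 < m)
    (hM : m ≤ M) (hD : 1 ≤ D) (hmD : m ≤ D * n)
    (h : 2 ≤ n → m ^ 5 ≤ n ^ 6 → ∀ ν : ℝ, 1 ≤ ν → ν ^ 8 = m * (n : ℝ) ^ 2 →
      (n : ℝ) ^ 6 ≤ 64 * (C * ν ^ 12 * M)) :
    min 1 (1 / (64 * C)) * D ^ (-(3 : ℝ) / 2) * (n : ℝ) ^ ((3 : ℝ) / 2) ≤ M := by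
  have hn0 : (0 : ℝ) < n := by exact_mod_cast hn
  have hm1 : (1 : ℝ) ≤ m := by exact_mod_cast hm
  have hn1 : (1 : ℝ) ≤ n := by exact_mod_cast hn
  have hM' : (m : ℝ) ≤ M := by exact_mod_cast hM
  have hD0 : 0 < D := by linarith
  set X := D ^ ((3 : ℝ) / 2) with hX
  set Y := (n : ℝ) ^ ((3 : ℝ) / 2) with hY
  have hX0 : 0 < X := Real.rpow_pos_of_pos hD0 _
  have hY0 : 0 < Y := Real.rpow_pos_of_pos hn0 _
  have hsq : ∀ {x : ℝ}, 0 < x → (x ^ ((3 : ℝ) / 2)) ^ 2 = x ^ 3 := fun {x} hx => by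
    rw [← Real.rpow_natCast, ← Real.rpow_mul hx.le, ← Real.rpow_natCast]
    norm_num
  have hX2 : X ^ 2 = D ^ 3 := hsq hD0
  have hY2 : Y ^ 2 = (n : ℝ) ^ 3 := hsq hn0
  rw [neg_div, Real.rpow_neg hD0.le, ← hX]
  suffices hK : ∃ K, min 1 (1 / (64 * C)) ≤ K ∧ K * Y ≤ M * X by
    obtain ⟨K, hK1, hK2⟩ := hK
    calc _ ≤ K * X⁻¹ * Y := by gcongr
      _ = K * Y / X := by ring
      _ ≤ M := (div_le_iff₀ hX0).2 hK2
  have hlarge : (n : ℝ) ^ 3 ≤ m ^ 2 * D ^ 3 → ∃ K, min 1 (1 / (64 * C)) ≤ K ∧ K * Y ≤ M * X := by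
    refine fun h1 => ⟨1, min_le_left _ _, ?_⟩
    rw [← hX2, ← hY2, ← mul_pow] at h1
    have := le_of_sq_le_sq h1 (by positivity)
    calc 1 * Y ≤ m * X := by linarith
      _ ≤ _ := by gcongr
  rcases Nat.lt_or_ge n 2 with hn2 | hn2
  · obtain rfl : n = 1 := by omega
    refine hlarge ?_
    have := one_le_pow₀ hm1 (n := 2)
    have := one_le_pow₀ hD (n := 3)
    push_cast
    nlinarith
  rcases le_or_gt (m ^ 5) (n ^ 6) with hmn | hmn
  · refine ⟨1 / (64 * C), min_le_right _ _, ?_⟩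
    set ν := ((m : ℝ) * n ^ 2) ^ ((8 : ℕ) : ℝ)⁻¹ with hν
    have hmn0 : 1 ≤ (m : ℝ) * n ^ 2 := by
      have := one_le_pow₀ hn1 (n := 2)
      nlinarith
    have hν8 : ν ^ 8 = m * (n : ℝ) ^ 2 := Real.rpow_inv_natCast_pow (by linarith) (by norm_num)
    have hν1 : 1 ≤ ν := Real.one_le_rpow hmn0 (by positivity)
    have h1 := h hn2 hmn ν hν1 hν8
    have h2 : ν ^ 12 ≤ X * Y ^ 3 := by
      refine le_of_sq_le_sq ?_ (by positivity)
      calc (ν ^ 12) ^ 2 = (ν ^ 8) ^ 3 := by ring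
        _ ≤ (D * n * n ^ 2) ^ 3 := by
          rw [hν8]
          gcongr
        _ = X ^ 2 * (Y ^ 2) ^ 3 := by rw [hX2, hY2]; ring
        _ = _ := by ring
    have h3 : Y * Y ^ 3 ≤ 64 * C * M * X * Y ^ 3 := by
      calc Y * Y ^ 3 = (Y ^ 2) ^ 2 := by ring
        _ = (n : ℝ) ^ 6 := by rw [hY2]; ring
        _ ≤ 64 * (C * (X * Y ^ 3) * M) := h1.trans (by gcongr)
        _ = _ := by ring
    have h4 := le_of_mul_le_mul_right h3 (by positivity)
    rw [one_div, inv_mul_le_iff₀ (by positivity)]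
    linarith
  · refine hlarge ?_
    have h1 : (n : ℝ) ^ 6 ≤ m ^ 5 := by exact_mod_cast hmn.le
    have h2 : (n : ℝ) ≤ D ^ 5 := by
      have : (n : ℝ) * n ^ 5 ≤ D ^ 5 * n ^ 5 := by
        calc (n : ℝ) * n ^ 5 = n ^ 6 := by ring
          _ ≤ (D * n) ^ 5 := h1.trans (by gcongr)
          _ = _ := by ring
      exact le_of_mul_le_mul_right this (by positivity)
    refine le_of_pow_le_pow_left₀ (n := 5) (by norm_num) (by positivity) ?_
    calc ((n : ℝ) ^ 3) ^ 5 = (n ^ 6) ^ 2 * n ^ 3 := by ring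
      _ ≤ (m ^ 5) ^ 2 * (D ^ 5) ^ 3 := by gcongr
      _ = _ := by ring

theorem natCast_ne_zero_of_card_le {F : Type*} [Field F] {n m : ℕ} {ν : ℝ} (hn : 0 < n)
    (hp : ∀ p : ℕ, p.Prime → CharP F p → (n : ℝ) ≤ 1 / 32 * (p : ℝ) ^ ((5 : ℝ) / 8))
    (hm : m ^ 5 ≤ n ^ 6) (hν : ν ^ 8 = m * (n : ℝ) ^ 2) {j : ℕ} (hj : 0 < j)
    (hjν : (j : ℝ) ≤ 4 * ν ^ 4) : (j : F) ≠ 0 := by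
  intro h
  obtain ⟨p, hpF⟩ := CharP.exists F
  have hdvd := (CharP.cast_eq_zero_iff F p j).1 h
  have hp0 : p ≠ 0 := by
    rintro rfl
    exact hj.ne' (zero_dvd_iff.1 hdvd)
  have hprime := (CharP.char_is_prime_or_zero F p).resolve_right hp0
  have h1 : (p : ℝ) ≤ 4 * ν ^ 4 := le_trans (by exact_mod_cast Nat.le_of_dvd hj hdvd) hjν
  have h2 : (n : ℝ) ^ 16 ≤ (1 / 32) ^ 16 * (p : ℝ) ^ 10 := by
    calc (n : ℝ) ^ 16 ≤ (1 / 32 * (p : ℝ) ^ ((5 : ℝ) / 8)) ^ 16 := by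
          gcongr
          exact hp p hprime hpF
      _ = _ := by
        rw [mul_pow, ← Real.rpow_natCast ((p : ℝ) ^ _), ← Real.rpow_mul p.cast_nonneg,
          ← Real.rpow_natCast _ 10]
        norm_num
  have h3 : (m : ℝ) ^ 5 ≤ n ^ 6 := by exact_mod_cast hm
  have h4 : (p : ℝ) ^ 10 ≤ 4 ^ 10 * n ^ 16 := by
    calc (p : ℝ) ^ 10 ≤ (4 * ν ^ 4) ^ 10 := by gcongr
      _ = 4 ^ 10 * ((ν ^ 8) ^ 5) := by ring
      _ = 4 ^ 10 * (m ^ 5 * n ^ 10) := by rw [hν]; ring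
      _ ≤ 4 ^ 10 * (n ^ 6 * n ^ 10) := by gcongr
      _ = _ := by ring
  have h5 : (0 : ℝ) < (n : ℝ) ^ 16 := by positivity
  norm_num at h2 h4
  linarith

theorem stmt_8 :
    ∃ c C : ℝ, 0 < c ∧ 0 < C ∧
      ∀ (F : Type) [Field F] (A : Finset F), A.Nonempty →
        (∀ p : ℕ, p.Prime → CharP F p → (A.card : ℝ) ≤ c * (p : ℝ) ^ ((5 : ℝ) / 8)) →
        ∀ D : ℝ, 1 ≤ D →
          min ((A + A).card : ℝ) ((A * A).card : ℝ) ≤ D * (A.card : ℝ) →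
          C * D ^ (-(3 : ℝ) / 2) * (A.card : ℝ) ^ ((3 : ℝ) / 2) ≤
            max ((A + A).card : ℝ) ((A * A).card : ℝ) := by
  obtain ⟨C, hC, hbound⟩ := exists_sum_product_bound
  refine ⟨1 / 32, min 1 (1 / (64 * C)), by norm_num, by positivity, ?_⟩
  intro F _ A hA hp D hD hmin
  set S := A.erase 0
  have hSA : S ⊆ A := A.erase_subset 0
  have h0 : 0 ∉ S := A.notMem_erase 0
  have hA0 := hA.card_pos
  have hcase : ∀ m : ℕ, 2 ≤ A.card → S.card ≤ m → m ^ 5 ≤ A.card ^ 6 → ∀ ν : ℝ, 1 ≤ ν →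
      ν ^ 8 = m * (A.card : ℝ) ^ 2 →
      (A.card : ℝ) ^ 6 ≤ 64 * (S.card : ℝ) ^ 6 ∧
      ((S + S).card ≤ m → (S.card : ℝ) ^ 6 ≤ C * ν ^ 12 * (S * S).card) ∧
      ((S * S).card ≤ m → (S.card : ℝ) ^ 6 ≤ C * ν ^ 12 * (S + S).card) := by
    intro m hn hSm hm ν hν hν8
    have hS : (S.card : ℝ) ≤ A.card := by exact_mod_cast Finset.card_le_card hSA
    have hm' : (m : ℝ) ^ 5 ≤ A.card ^ 6 := by exact_mod_cast hm
    refine ⟨?_, hbound h0 hν ?_ ?_ hSm fun j hj hjν =>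
      natCast_ne_zero_of_card_le hA0 hp hm hν8 hj hjν⟩
    · have h1 : A.card ≤ 2 * S.card := by
        have : A.card - 1 ≤ S.card := A.pred_card_le_card_erase
        omega
      calc (A.card : ℝ) ^ 6 ≤ (2 * S.card) ^ 6 := by
            gcongr
            exact_mod_cast h1
        _ = _ := by ring
    · rw [hν8]
      gcongr
    · refine le_of_pow_le_pow_left₀ (n := 8) (by norm_num) (by positivity) ?_
      calc (m : ℝ) ^ 8 = m ^ 3 * m ^ 5 := by ring
        _ ≤ m ^ 3 * (A.card : ℝ) ^ 6 := by gcongr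
        _ = (ν ^ 8) ^ 3 := by rw [hν8]; ring
        _ ≤ 2 ^ 8 * (ν ^ 8) ^ 3 := le_mul_of_one_le_left (by positivity) (by norm_num)
        _ = _ := by ring
  have hadd : (S + S).card ≤ (A + A).card := Finset.card_le_card (Finset.add_subset_add hSA hSA)
  have hmul : (S * S).card ≤ (A * A).card := Finset.card_le_card (Finset.mul_subset_mul hSA hSA)
  rcases le_total (A + A).card (A * A).card with hle | hle
  · have hle' : ((A + A).card : ℝ) ≤ (A * A).card := by exact_mod_cast hle
    rw [min_eq_left hle'] at hmin
    rw [max_eq_right hle']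
    refine le_max_of_energy_bound hC hA0 (hA.add hA).card_pos hle hD hmin ?_
    intro hn hm ν hν hν8
    obtain ⟨h1, h2, -⟩ := hcase _ hn
      ((Finset.card_le_card hSA).trans Finset.card_le_card_add_self) hm ν hν hν8
    have : ((S * S).card : ℝ) ≤ (A * A).card := by exact_mod_cast hmul
    calc _ ≤ 64 * (C * ν ^ 12 * (S * S).card) := h1.trans (by gcongr; exact h2 hadd)
      _ ≤ _ := by gcongr
  · have hle' : ((A * A).card : ℝ) ≤ (A + A).card := by exact_mod_cast hle
    rw [min_eq_right hle'] at hmin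
    rw [max_eq_left hle']
    refine le_max_of_energy_bound hC hA0 (hA.mul hA).card_pos hle hD hmin ?_
    intro hn hm ν hν hν8
    have hSm : S.card ≤ (A * A).card := by
      rcases S.eq_empty_or_nonempty with hS | ⟨x, hx⟩
      · simp [hS]
      · refine (Finset.card_le_card_of_injOn (fun y => x * y) (fun y hy => ?_) fun y _ z _ h => ?_).trans
          hmul
        · exact Finset.mul_mem_mul hx hy
        · exact mul_left_cancel₀ (fun h => h0 (h ▸ hx)) h
    obtain ⟨h1, -, h2⟩ := hcase _ hn hSm hm ν hν hν8
    have : ((S + S).card : ℝ) ≤ (A + A).card := by exact_mod_cast hadd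
    calc _ ≤ 64 * (C * ν ^ 12 * (S + S).card) := h1.trans (by gcongr; exact h2 hmul)
      _ ≤ _ := by gcongr
end
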